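/- There exist at least 228 pairwise inequivalent s-extremal singly even self-dual [44,22,8] codes; that is, there exist at least 228 pairwise inequivalent singly even self-dual codes of length 44 with minimum weight 8 whose shadows have minimum weight 10. -/

import Mathlib

open Finset

/-- Hamming weight of a binary vector. -/
def wt {n : ℕ} (x : Fin n → ZMod 2) : ℕ := hammingNorm x

/-- The dual of a set of binary vectors with respect to the standard inner product. -/
def dualSet {n : ℕ} (C : Set (Fin n → ZMod 2)) : Set (Fin n → ZMod 2) :=
  {x | ∀ y ∈ C, ∑ i, x i * y i = 0}

/-- A binary linear code is self-dual if it equals its dual code. -/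
def IsSelfDual {n : ℕ} (C : Submodule (ZMod 2) (Fin n → ZMod 2)) : Prop :=
  (C : Set (Fin n → ZMod 2)) = dualSet (C : Set (Fin n → ZMod 2))

/-- A self-dual code is singly even if some codeword has weight not divisible by 4. -/
def IsSinglyEvenSelfDual {n : ℕ} (C : Submodule (ZMod 2) (Fin n → ZMod 2)) : Prop :=
  IsSelfDual C ∧ ∃ x ∈ C, ¬ (4 ∣ wt x)

/-- The doubly even subcode `C₀` of `C` (as a set): codewords of weight ≡ 0 (mod 4). -/
def evenSub {n : ℕ} (C : Submodule (ZMod 2) (Fin n → ZMod 2)) : Set (Fin n → ZMod 2) :=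
  {x | x ∈ C ∧ 4 ∣ wt x}

/-- The shadow `S = C₀^⊥ \ C` of a singly even self-dual code. -/
def shadow {n : ℕ} (C : Submodule (ZMod 2) (Fin n → ZMod 2)) : Set (Fin n → ZMod 2) :=
  dualSet (evenSub C) \ (C : Set (Fin n → ZMod 2))

/-- The minimum (nonzero) weight of a set of vectors. -/
noncomputable def minWtSet {n : ℕ} (S : Set (Fin n → ZMod 2)) : ℕ :=
  sInf {w | ∃ x ∈ S, x ≠ 0 ∧ wt x = w}

/-- The minimum weight of a code. -/
noncomputable def minWt {n : ℕ} (C : Submodule (ZMod 2) (Fin n → ZMod 2)) : ℕ :=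
  minWtSet (C : Set (Fin n → ZMod 2))

/-- A singly even self-dual code of length `n` is s-extremal if
`d(S) = n/2 + 4 - 2 d(C)`. -/
def IsSExtremal {n : ℕ} (C : Submodule (ZMod 2) (Fin n → ZMod 2)) : Prop :=
  IsSinglyEvenSelfDual C ∧
    (minWtSet (shadow C) : ℤ) = ((n / 2 : ℕ) : ℤ) + 4 - 2 * (minWt C : ℤ)

/-- Two codes are equivalent if one is obtained from the other by permuting coordinates. -/
def CodeEquiv {n : ℕ} (C D : Submodule (ZMod 2) (Fin n → ZMod 2)) : Prop :=
  ∃ σ : Equiv.Perm (Fin n),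
    Submodule.map (LinearMap.funLeft (ZMod 2) (ZMod 2) σ) C = D

/-- The neighbor `C₀ ∪ (t + C₀)` of `C` obtained from a shadow vector `t`:
the span of the doubly even subcode together with `t`. -/
def neighborCode {n : ℕ} (C : Submodule (ZMod 2) (Fin n → ZMod 2))
    (t : Fin n → ZMod 2) : Submodule (ZMod 2) (Fin n → ZMod 2) :=
  Submodule.span (ZMod 2) (evenSub C ∪ {t})


namespace SExt

/-! ### Bit-sliced checker -/

/-- `lin as es j` is the xor of those `es[r]` for which bit `j` of `as[r]` is set. -/
def lin (as es : List Nat) (j : Nat) : Nat :=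
  List.rec (motive := fun _ => List Nat → Nat) (fun _ => 0)
    (fun a _ ih es => List.rec (motive := fun _ => Nat) 0
      (fun e es' _ => Nat.xor (Nat.mul (Nat.mod (Nat.shiftRight a j) 2) e) (ih es')) es) as es

/-- The indices of the coordinates of one half. -/
def idx22 : List Nat := [0, 1, 2, 3, 4, 5, 6, 7, 8, 9, 10, 11, 12, 13, 14, 15, 16, 17, 18, 19, 20, 21]

/-- The product of the transpose of the bit matrix `as` with the bit matrix `es`. -/
def cols (as es : List Nat) : List Nat := idx22.map (lin as es)

/-- The identity matrix. -/
def pow22 : List Nat := idx22.map (fun r => Nat.pow 2 r)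

/-- Adding one more column to the thresholds. -/
def thrStep (y p : Nat) (ts : List Nat) : List Nat :=
  List.rec (motive := fun _ => Nat → List Nat) (fun _ => [])
    (fun t _ ih p => Nat.lor t (Nat.land p y) :: ih t) ts p

/-- Bit `i` of entry `k` of `thr ones m ys` says whether at least `k+1` of the `ys` have bit `i` set. -/
def thr (ones m : Nat) (ys : List Nat) : List Nat :=
  List.rec (motive := fun _ => List Nat) (List.replicate m 0)
    (fun y _ ih => thrStep y ones ih) ys

/-- Number of ones among the lowest bits. -/
def pop (n x : Nat) : Nat :=
  Nat.rec (motive := fun _ => Nat → Nat) (fun _ => 0)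
    (fun _ ih x => Nat.add (Nat.mod x 2) (ih (Nat.div x 2))) n x

/-- The bits of a number. -/
def bitsOf (x : Nat) : List Nat := idx22.map (fun r => Nat.mod (Nat.shiftRight x r) 2)

/-- Positions whose word contains the support of word `a` of the family `ks`. -/
def sel (ones a : Nat) (ks ys : List Nat) : Nat :=
  List.rec (motive := fun _ => List Nat → Nat) (fun _ => ones)
    (fun k _ ih ys => List.rec (motive := fun _ => Nat) ones
      (fun y ys' _ => Nat.rec (motive := fun _ => Nat) (ih ys') (fun _ _ => Nat.land y (ih ys'))
        (Nat.mod (Nat.shiftRight k a) 2)) ys) ks ys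

/-- Positions whose word contains the support of one of the first `n` words of the family `ks`. -/
def cov (ones : Nat) (ks ys : List Nat) (n : Nat) : Nat :=
  Nat.rec (motive := fun _ => Nat) 0
    (fun n ih => Nat.lor (sel ones n ks ys) ih) n

/-- Columns of the family `ks` which contain the word `a`. -/
def filt (a : Nat) (ks : List Nat) : List Nat :=
  List.rec (motive := fun _ => List Nat) []
    (fun k _ ih => Nat.rec (motive := fun _ => List Nat) ih (fun _ _ => k :: ih)
      (Nat.mod (Nat.shiftRight k a) 2)) ks

/-- All nonzero words of the family have weight at least 8, those of weight 8 are covered by `ks`. -/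
def chkMain (ones : Nat) (ks ys T : List Nat) : Bool :=
  Nat.beq (T.getD 7 0) (T.getD 0 0) &&
  (fun x => Nat.beq (Nat.land x (cov ones ks ys 44)) x) (Nat.xor (T.getD 7 0) (T.getD 8 0))

/-- All words of the family have weight at least 10. -/
def chkShadow (ones : Nat) (ys : List Nat) : Bool :=
  Nat.beq ((thr ones 10 ys).getD 9 0) ones

/-- Third powers of valencies, with a check that the words are different. -/
def invSum (ks : List Nat) (n : Nat) : Nat :=
  Nat.rec (motive := fun _ => Nat) 0
    (fun a ih => Nat.add (Nat.pow (pop 44 ((thr (2 ^ 44 - 1) 8 (filt a ks)).getD 2 0)) 3) ih) n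

/-- The words are pairwise different. -/
def chkDist (ks : List Nat) (n : Nat) : Bool :=
  Nat.rec (motive := fun _ => Bool) true
    (fun a ih => Nat.beq ((thr (2 ^ 44 - 1) 8 (filt a ks)).getD 7 0) (2 ^ a) && ih) n

/-- Exact weight of all words of a family. -/
def chkExact (ones m : Nat) (ys : List Nat) : Bool :=
  (fun T => Nat.beq (T.getD (m - 1) 0) ones && Nat.beq (T.getD m 0) 0) (thr ones (m + 1) ys)

/-- Weights of the rows modulo 4. -/
def chkRows : List Nat → List Nat → Bool
  | a :: as, w :: ws => Nat.beq (Nat.mod (Nat.add 1 (pop 22 a)) 4) (Nat.mul 2 w) && chkRows as ws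
  | [], _ => true
  | _ :: _, [] => true

/-- The data for one code: the rows of the right half of a generator matrix, the left half of a vector
of the shadow, the left half of a vector of weight 10 of the shadow,
the left halves of the words of weight 8 (transposed), the invariant. -/
structure Dat where
  /-- rows -/
  M : List Nat
  /-- shadow vector -/
  w : Nat
  /-- shadow vector of weight 10 -/
  z : Nat
  /-- words of weight 8 -/
  L : List Nat
  /-- invariant -/
  v : Nat

/-- Equality of lists. -/
def leq : List Nat → List Nat → Bool
  | [], [] => true
  | a :: as, b :: bs => Nat.beq a b && leq as bs
  | [], _ :: _ => false
  | _ :: _, [] => false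

/-- The whole check. -/
def chk2 (ones : Nat) (E M : List Nat) (w : Nat) (zl L : List Nat) (v : Nat) (wl at' : List Nat)
    (s : Nat) (ks : List Nat) : Bool :=
  Nat.beq M.length 22 && Nat.beq L.length 22 && leq (cols M M) pow22 &&
  chkRows M wl && wl.any (fun b => Nat.beq b 1) &&
  chkExact (2 ^ 44 - 1) 8 ks && chkDist ks 44 && Nat.beq (invSum ks 44) v &&
  chkExact 1 10 (zl ++ cols (s :: M) (1 :: zl)) &&
  (fun ys => chkMain ones ks ys (thr ones 9 ys)) (E ++ cols M E) &&
  (fun ys => chkMain ones ks ys (thr ones 9 ys)) (cols at' E ++ E) &&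
  chkShadow ones (E ++ cols (s :: M) (ones :: E)) &&
  chkShadow ones (cols (w :: at') (ones :: E) ++ E)

/-- The whole check. -/
def chk (ones : Nat) (E : List Nat) (d : Dat) : Bool :=
  chk2 ones E d.M d.w (bitsOf d.z) d.L d.v (bitsOf d.w) (cols d.M pow22) (lin (bitsOf d.w) d.M 0)
    (d.L ++ cols d.M d.L)

/-- One step of the enumeration of the words of small weight. -/
def nxtE (p q : Nat × List Nat) : Nat × List Nat :=
  (q.1 + p.1, 2 ^ q.1 * (2 ^ p.1 - 1) :: List.zipWith (fun a b => 2 ^ q.1 * b + a) q.2 p.2)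

/-- One step of the enumeration of the words of small weight. -/
def nxtAll : Nat × List Nat → List (Nat × List Nat) → List (Nat × List Nat)
  | _, [] => []
  | p, q :: qs => nxtE p q :: nxtAll q qs

/-- All words of length `n` of weight at most `0, 1, 2, 3, 4`. -/
def fam : Nat → List (Nat × List Nat)
  | 0 => List.replicate 5 (1, [])
  | n + 1 => match fam n with
    | [] => []
    | p :: ps => (p.1, 0 :: p.2) :: nxtAll p ps



/-! ### Semantics of the checker -/

/-- A bit as an element of the field. -/
def bz (b : Bool) : ZMod 2 := if b then 1 else 0

/-- An entry of a bit matrix. -/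
def ent (L : List Nat) (r i : Nat) : ZMod 2 := bz ((L.getD r 0).testBit i)

theorem bz_xor (a b : Bool) : bz (a ^^ b) = bz a + bz b := by
  revert a b; decide

theorem bz_inj {a b : Bool} (h : bz a = bz b) : a = b := by
  revert a b; decide

theorem bz_ne_zero {a : Bool} : bz a ≠ 0 ↔ a = true := by
  revert a; decide

theorem bz_val (a : Bool) : (bz a).val = a.toNat := by
  revert a; decide

theorem mod_shift (a j : Nat) : Nat.mod (Nat.shiftRight a j) 2 = (a.testBit j).toNat := by
  show (a >>> j) % 2 = _
  rw [Nat.toNat_testBit, Nat.shiftRight_eq_div_pow]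

theorem testBit_toNat_mul (b : Bool) (e i : Nat) :
    (Nat.mul b.toNat e).testBit i = (b && e.testBit i) := by
  show (b.toNat * e).testBit i = _
  cases b <;> simp

theorem lin_cons (a e j : Nat) (as es : List Nat) : lin (a :: as) (e :: es) j =
    Nat.xor (Nat.mul (Nat.mod (Nat.shiftRight a j) 2) e) (lin as es j) := rfl

theorem lin_spec : ∀ (as es : List Nat) (m j i : Nat), as.length = m → es.length = m →
    bz ((lin as es j).testBit i) = ∑ r ∈ Finset.range m, ent as r j * ent es r i
  | [], es, m, j, i, h1, h2 => by
      subst h1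
      simp [lin, bz]
  | a :: as, [], m, j, i, h1, h2 => by
      subst h1; simp at h2
  | a :: as, e :: es, 0, j, i, h1, h2 => by simp at h1
  | a :: as, e :: es, m + 1, j, i, h1, h2 => by
      have ih : bz ((lin as es j).testBit i) =
          ∑ r ∈ Finset.range m, ent (a :: as) (r + 1) j * ent (e :: es) (r + 1) i :=
        lin_spec as es m j i (by simpa using h1) (by simpa using h2)
      rw [Finset.sum_range_succ', ← ih, lin_cons, mod_shift]
      show bz ((_ ^^^ _ : Nat).testBit i) = _
      rw [Nat.testBit_xor, bz_xor, add_comm, testBit_toNat_mul]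
      congr 1
      simp only [ent, List.getD_cons_zero]
      generalize a.testBit j = x
      generalize e.testBit i = y
      revert x y; decide

theorem idx22_length : idx22.length = 22 := rfl

theorem idx22_getD (r : Nat) (h : r < 22) : idx22[r]'(by rw [idx22_length]; exact h) = r := by
  interval_cases r <;> rfl

theorem map_idx_getD (f : Nat → Nat) (r : Nat) (h : r < 22) : (idx22.map f).getD r 0 = f r := by
  have h' : r < (idx22.map f).length := by rw [List.length_map, idx22_length]; exact h
  rw [List.getD_eq_getElem _ _ h', List.getElem_map, idx22_getD r h]

theorem cols_length (as es : List Nat) : (cols as es).length = 22 := by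
  simp [cols, idx22_length]

theorem cols_spec (as es : List Nat) (m j i : Nat) (h1 : as.length = m) (h2 : es.length = m)
    (hj : j < 22) : ent (cols as es) j i = ∑ r ∈ Finset.range m, ent as r j * ent es r i := by
  rw [ent, cols, map_idx_getD _ _ hj, lin_spec as es m j i h1 h2]

theorem pow22_length : pow22.length = 22 := by simp [pow22, idx22_length]

theorem pow22_ent (r i : Nat) (hr : r < 22) : ent pow22 r i = if r = i then 1 else 0 := by
  rw [ent, pow22, map_idx_getD _ _ hr]
  show bz ((2 ^ r).testBit i) = _
  rw [Nat.testBit_two_pow]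
  by_cases h : r = i <;> simp [h, bz]

theorem bitsOf_length (x : Nat) : (bitsOf x).length = 22 := by simp [bitsOf, idx22_length]

theorem bitsOf_getD (x r : Nat) (hr : r < 22) : (bitsOf x).getD r 0 = (x.testBit r).toNat := by
  rw [bitsOf, map_idx_getD _ _ hr, mod_shift]

theorem bitsOf_ent (x r : Nat) (hr : r < 22) : ent (bitsOf x) r 0 = bz (x.testBit r) := by
  rw [ent, bitsOf_getD _ _ hr]
  cases x.testBit r <;> rfl

/-- The number of entries having bit `i`. -/
def cnt (ys : List Nat) (i : Nat) : Nat := ys.countP (fun y => y.testBit i)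

theorem thrStep_length (y : Nat) : ∀ (ts : List Nat) (p : Nat), (thrStep y p ts).length = ts.length
  | [], _ => rfl
  | t :: ts, p => by
      show (thrStep y t ts).length + 1 = _
      rw [thrStep_length y ts t]; rfl

theorem thr_length (ones m : Nat) : ∀ ys : List Nat, (thr ones m ys).length = m
  | [] => by simp [thr]
  | y :: ys => by
      show (thrStep y ones (thr ones m ys)).length = m
      rw [thrStep_length, thr_length ones m ys]

theorem thrStep_zero (y p t : Nat) (ts : List Nat) :
    (thrStep y p (t :: ts)).getD 0 0 = t ||| (p &&& y) := rfl

theorem thrStep_succ (y : Nat) : ∀ (ts : List Nat) (p k : Nat), k + 1 < ts.length →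
    (thrStep y p ts).getD (k + 1) 0 = ts.getD (k + 1) 0 ||| (ts.getD k 0 &&& y)
  | [], p, k, h => by simp at h
  | [t], p, k, h => by simp at h
  | t :: u :: ts, p, 0, h => rfl
  | t :: u :: ts, p, k + 1, h => by
      show (thrStep y t (u :: ts)).getD (k + 1) 0 = _
      rw [thrStep_succ y (u :: ts) t k (by simpa using h)]
      rfl

theorem thr_spec (ones m i : Nat) (hi : ones.testBit i = true) : ∀ (ys : List Nat) (k : Nat), k < m →
    ((thr ones m ys).getD k 0).testBit i = decide (k + 1 ≤ cnt ys i)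
  | [], k, hk => by
      have : (thr ones m []).getD k 0 = 0 := by
        simp [thr, List.getD_eq_getElem?_getD, hk]
      rw [this]; simp [cnt]
  | y :: ys, k, hk => by
      have ih := thr_spec ones m i hi ys
      have hl := thr_length ones m ys
      have hc : cnt (y :: ys) i = cnt ys i + (y.testBit i).toNat := by
        simp only [cnt, List.countP_cons]
        cases y.testBit i <;> rfl
      show ((thrStep y ones (thr ones m ys)).getD k 0).testBit i = _
      rw [hc]
      cases k with
      | zero =>
        have h0 := ih 0 hk
        cases hT : thr ones m ys with
        | nil => rw [hT] at hl; simp at hl; omega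
        | cons t ts =>
          rw [hT] at h0
          rw [thrStep_zero, Nat.testBit_or, Nat.testBit_and, hi]
          simp only [List.getD_cons_zero] at h0
          rw [h0]
          cases y.testBit i <;> simp
      | succ k =>
        rw [thrStep_succ _ _ _ _ (by omega), Nat.testBit_or, Nat.testBit_and, ih _ hk, ih k (by omega)]
        cases y.testBit i
        · simp
        · simp only [Bool.and_true, Bool.toNat_true]
          rw [← Bool.decide_or]
          congr 1
          apply propext
          omega

theorem pop_spec : ∀ (n x : Nat), pop n x = ∑ j ∈ Finset.range n, (x.testBit j).toNat
  | 0, x => by simp [pop]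
  | n + 1, x => by
      show x % 2 + pop n (x / 2) = _
      rw [pop_spec n, Finset.sum_range_succ', add_comm]
      congr 1
      · apply Finset.sum_congr rfl
        intro j _
        rw [Nat.testBit_succ]
      · rw [Nat.toNat_testBit]; simp

theorem toNat_cases (b : Bool) {α : Type} (x y : α) :
    Nat.rec (motive := fun _ => α) x (fun _ _ => y) b.toNat = if b = true then y else x := by
  cases b <;> rfl

theorem sel_cons (ones a k y : Nat) (ks ys : List Nat) : sel ones a (k :: ks) (y :: ys) =
    if k.testBit a = true then y &&& sel ones a ks ys else sel ones a ks ys := by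
  rw [← toNat_cases, ← mod_shift]; rfl

theorem sel_spec (ones a i : Nat) : ∀ (ks ys : List Nat),
    (sel ones a ks ys).testBit i = true → ∀ j, j < ks.length → j < ys.length →
      (ks.getD j 0).testBit a = true → (ys.getD j 0).testBit i = true
  | [], _, _, _, h, _, _ => by simp at h
  | _ :: _, [], _, _, _, h, _ => by simp at h
  | k :: ks, y :: ys, h, j, h1, h2, h3 => by
      rw [sel_cons] at h
      have hs : (sel ones a ks ys).testBit i = true := by
        split at h
        · rw [Nat.testBit_and] at h; simp at h; exact h.2
        · exact h
      cases j with
      | zero =>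
        simp only [List.getD_cons_zero] at h3 ⊢
        rw [if_pos h3, Nat.testBit_and] at h
        simp at h; exact h.1
      | succ j =>
        simp only [List.getD_cons_succ] at h3 ⊢
        exact sel_spec ones a i ks ys hs j (by simpa using h1) (by simpa using h2) h3

theorem cov_spec (ones i : Nat) (ks ys : List Nat) : ∀ n, (cov ones ks ys n).testBit i = true →
    ∃ a < n, (sel ones a ks ys).testBit i = true
  | 0, h => by simp [cov] at h
  | n + 1, h => by
      change (sel ones n ks ys ||| cov ones ks ys n).testBit i = true at h
      rw [Nat.testBit_or, Bool.or_eq_true] at h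
      rcases h with h | h
      · exact ⟨n, by omega, h⟩
      · obtain ⟨a, ha, h⟩ := cov_spec ones i ks ys n h
        exact ⟨a, by omega, h⟩

theorem filt_eq (a : Nat) : ∀ ks : List Nat, filt a ks = ks.filter (fun k => k.testBit a)
  | [] => rfl
  | k :: ks => by
      have : filt a (k :: ks) = if k.testBit a = true then k :: filt a ks else filt a ks := by
        rw [← toNat_cases, ← mod_shift]; rfl
      rw [this, filt_eq a ks, List.filter_cons]

theorem cnt_eq_sum : ∀ (ys : List Nat) (n i : Nat), ys.length = n →
    cnt ys i = ∑ j ∈ Finset.range n, ((ys.getD j 0).testBit i).toNat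
  | [], n, i, h => by subst h; simp [cnt]
  | y :: ys, 0, i, h => by simp at h
  | y :: ys, n + 1, i, h => by
      have hc : cnt (y :: ys) i = cnt ys i + (y.testBit i).toNat := by
        simp only [cnt, List.countP_cons]
        cases y.testBit i <;> rfl
      rw [hc, Finset.sum_range_succ', cnt_eq_sum ys n i (by simpa using h)]
      simp

theorem cnt_filt (a i : Nat) : ∀ (ys : List Nat) (n : Nat), ys.length = n →
    cnt (filt a ys) i =
      ∑ j ∈ Finset.range n, ((ys.getD j 0).testBit a).toNat * ((ys.getD j 0).testBit i).toNat
  | [], n, h => by subst h; simp [cnt, filt]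
  | y :: ys, 0, h => by simp at h
  | y :: ys, n + 1, h => by
      rw [Finset.sum_range_succ']
      have ih := cnt_filt a i ys n (by simpa using h)
      simp only [List.getD_cons_succ, List.getD_cons_zero]
      rw [← ih, filt_eq, filt_eq, List.filter_cons]
      cases y.testBit a
      · simp
      · simp only [cnt, if_true, List.countP_cons]
        cases y.testBit i <;> simp

theorem leq_eq : ∀ as bs : List Nat, leq as bs = true → as = bs
  | [], [], _ => rfl
  | a :: as, b :: bs, h => by
      rw [leq, Bool.and_eq_true] at h
      rw [Nat.eq_of_beq_eq_true h.1, leq_eq as bs h.2]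
  | [], _ :: _, h => by simp [leq] at h
  | _ :: _, [], h => by simp [leq] at h

theorem chkRows_cons (a w : Nat) (as ws : List Nat) : chkRows (a :: as) (w :: ws) =
    (Nat.beq ((1 + pop 22 a) % 4) (2 * w) && chkRows as ws) := rfl

theorem chkRows_spec (as ws : List Nat) (h : chkRows as ws = true) (r : Nat)
    (h1 : r < as.length) (h2 : r < ws.length) :
    (1 + pop 22 (as.getD r 0)) % 4 = 2 * ws.getD r 0 := by
  induction as generalizing ws r with
  | nil => simp at h1
  | cons a as ih =>
    cases ws with
    | nil => simp at h2
    | cons w ws =>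
      rw [chkRows_cons, Bool.and_eq_true] at h
      cases r with
      | zero =>
        rw [List.getD_cons_zero, List.getD_cons_zero]
        exact Nat.eq_of_beq_eq_true h.1
      | succ r =>
        rw [List.getD_cons_succ, List.getD_cons_succ]
        exact ih ws h.2 r (by simpa using h1) (by simpa using h2)

theorem chkDist_succ (ks : List Nat) (n : Nat) : chkDist ks (n + 1) =
    (Nat.beq ((thr (2 ^ 44 - 1) 8 (filt n ks)).getD 7 0) (2 ^ n) && chkDist ks n) := rfl

theorem chkDist_spec (ks : List Nat) (n : Nat) (h : chkDist ks n = true) (a : Nat) (ha : a < n) :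
    (thr (2 ^ 44 - 1) 8 (filt a ks)).getD 7 0 = 2 ^ a := by
  induction n with
  | zero => omega
  | succ n ih =>
    rw [chkDist_succ, Bool.and_eq_true] at h
    rcases Nat.lt_succ_iff_lt_or_eq.mp ha with e | e
    · exact ih h.2 e
    · rw [e]; exact Nat.eq_of_beq_eq_true h.1

theorem invSum_succ (ks : List Nat) (n : Nat) : invSum ks (n + 1) =
    (pop 44 ((thr (2 ^ 44 - 1) 8 (filt n ks)).getD 2 0)) ^ 3 + invSum ks n := rfl

theorem invSum_spec (ks : List Nat) (n : Nat) : invSum ks n =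
    ∑ a ∈ Finset.range n, (pop 44 ((thr (2 ^ 44 - 1) 8 (filt a ks)).getD 2 0)) ^ 3 := by
  induction n with
  | zero => rfl
  | succ n ih => rw [Finset.sum_range_succ, ← ih, invSum_succ, add_comm]

/-! ### The enumeration of words of small weight -/

/-- The family `E` of `N` words of length `n` contains all words of weight at most `k`. -/
def Good (k n : Nat) (q : Nat × List Nat) : Prop :=
  q.2.length = n ∧ (∀ r < n, q.2.getD r 0 < 2 ^ q.1) ∧
    ∀ m : Nat → Bool, ∑ r ∈ Finset.range n, (m r).toNat ≤ k →
      ∃ i < q.1, ∀ r < n, (q.2.getD r 0).testBit i = m r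

theorem zip_getD (f : Nat → Nat → Nat) (l1 l2 : List Nat) (n r : Nat) (h1 : l1.length = n)
    (h2 : l2.length = n) (hr : r < n) :
    (List.zipWith f l1 l2).getD r 0 = f (l1.getD r 0) (l2.getD r 0) := by
  subst h1
  rw [List.getD_eq_getElem _ _ (by simp [h2, hr]), List.getD_eq_getElem _ _ hr,
    List.getD_eq_getElem _ _ (by omega), List.getElem_zipWith]

theorem good_nxt (k n : Nat) (p q : Nat × List Nat) (hp : Good k n p) (hq : Good (k + 1) n q) :
    Good (k + 1) (n + 1) (nxtE p q) := by
  obtain ⟨p1, p2, p3⟩ := hp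
  obtain ⟨q1, q2, q3⟩ := hq
  have hpos : 0 < 2 ^ p.1 := by positivity
  have hz : ∀ r < n, (List.zipWith (fun a b => 2 ^ q.1 * b + a) q.2 p.2).getD r 0
      = 2 ^ q.1 * p.2.getD r 0 + q.2.getD r 0 := fun r hr => zip_getD _ _ _ n r q1 p1 hr
  refine ⟨by simp [nxtE, q1, p1], ?_, ?_⟩
  · intro r hr
    cases r with
    | zero =>
      show 2 ^ q.1 * (2 ^ p.1 - 1) < 2 ^ (q.1 + p.1)
      rw [pow_add]
      exact Nat.mul_lt_mul_of_pos_left (by omega) (by positivity)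
    | succ r =>
      have hr' : r < n := by omega
      show (List.zipWith (fun a b => 2 ^ q.1 * b + a) q.2 p.2).getD r 0 < 2 ^ (q.1 + p.1)
      rw [hz r hr', pow_add]
      have h1 := q2 r hr'
      have h2 : 2 ^ q.1 * (p.2.getD r 0 + 1) ≤ 2 ^ q.1 * 2 ^ p.1 := Nat.mul_le_mul_left _ (p2 r hr')
      rw [mul_add] at h2
      omega
  · intro m hm
    rw [Finset.sum_range_succ'] at hm
    cases h0 : m 0 with
    | false =>
      obtain ⟨i, hi, hh⟩ := q3 (fun r => m (r + 1)) (by simpa [h0] using hm)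
      refine ⟨i, by simp only [nxtE]; omega, ?_⟩
      intro r hr
      cases r with
      | zero =>
        show (2 ^ q.1 * (2 ^ p.1 - 1)).testBit i = _
        rw [h0, Nat.testBit_two_pow_mul]
        simp [hi]
      | succ r =>
        have hr' : r < n := by omega
        show ((List.zipWith (fun a b => 2 ^ q.1 * b + a) q.2 p.2).getD r 0).testBit i = _
        rw [hz r hr', Nat.testBit_two_pow_mul_add _ (q2 r hr'), if_pos hi]
        exact hh r hr'
    | true =>
      obtain ⟨i, hi, hh⟩ := p3 (fun r => m (r + 1)) (by simpa [h0] using hm)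
      refine ⟨q.1 + i, by simp only [nxtE]; omega, ?_⟩
      intro r hr
      cases r with
      | zero =>
        show (2 ^ q.1 * (2 ^ p.1 - 1)).testBit (q.1 + i) = _
        rw [h0, Nat.testBit_two_pow_mul]
        simp [hi]
      | succ r =>
        have hr' : r < n := by omega
        show ((List.zipWith (fun a b => 2 ^ q.1 * b + a) q.2 p.2).getD r 0).testBit (q.1 + i) = _
        rw [hz r hr', Nat.testBit_two_pow_mul_add _ (q2 r hr'), if_neg (by omega)]
        simpa using hh r hr'

theorem good_nxtAll (n : Nat) : ∀ (qs : List (Nat × List Nat)) (p : Nat × List Nat) (k : Nat),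
    Good k n p → (∀ l q, qs[l]? = some q → Good (k + 1 + l) n q) →
    ∀ l q, (nxtAll p qs)[l]? = some q → Good (k + 1 + l) (n + 1) q
  | [], p, k, _, _, l, q, h => by simp [nxtAll] at h
  | q0 :: qs, p, k, hp, hqs, l, q, h => by
      have h0 := hqs 0 q0 rfl
      cases l with
      | zero =>
        simp [nxtAll] at h
        subst h
        exact good_nxt k n p q0 hp h0
      | succ l =>
        have := good_nxtAll n qs q0 (k + 1) h0
          (fun l q hl => by
            have := hqs (l + 1) q (by simpa using hl)
            rwa [show k + 1 + (l + 1) = k + 1 + 1 + l by ring] at this) l q (by simpa [nxtAll] using h)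
        rwa [show k + 1 + (l + 1) = k + 1 + 1 + l by ring]

theorem good_fam : ∀ (n l : Nat) (q : Nat × List Nat), (fam n)[l]? = some q → Good l n q
  | 0, l, q, h => by
      have : q = (1, []) := by
        simp only [fam, List.getElem?_replicate] at h
        split at h <;> simp_all
      subst this
      exact ⟨rfl, by simp, fun m _ => ⟨0, by simp, by simp⟩⟩
  | n + 1, l, q, h => by
      have ih := good_fam n
      rw [fam] at h
      cases hf : fam n with
      | nil => rw [hf] at h; simp at h
      | cons p ps =>
        rw [hf] at h ih
        have hp := ih 0 p rfl
        cases l with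
        | zero =>
          simp at h
          subst h
          obtain ⟨p1, p2, p3⟩ := hp
          refine ⟨by simp [p1], ?_, ?_⟩
          · intro r hr
            cases r with
            | zero => simp
            | succ r => simpa using p2 r (by omega)
          · intro m hm
            rw [Finset.sum_range_succ'] at hm
            obtain ⟨i, hi, hh⟩ := p3 (fun r => m (r + 1)) (by omega)
            refine ⟨i, hi, ?_⟩
            intro r hr
            cases r with
            | zero =>
              cases h0 : m 0
              · simp
              · rw [h0] at hm; simp at hm
            | succ r => simpa using hh r (by omega)
        | succ l =>
          have := good_nxtAll n ps p 0 hp (fun l q hl => by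
            have := ih (l + 1) q (by simpa using hl)
            rwa [add_comm l 1, ← zero_add 1] at this) l q (by simpa using h)
          rwa [zero_add, add_comm] at this


/-! ### Weights and codes -/

/-- Vectors of length 44. -/
abbrev V := Fin 44 → ZMod 2

/-- Left half. -/
def lp (x : V) : Fin 22 → ZMod 2 := fun r => x (Fin.castAdd 22 r)

/-- Right half. -/
def rp (x : V) : Fin 22 → ZMod 2 := fun r => x (Fin.natAdd 22 r)

/-- The vector with given halves. -/
def jn (u v : Fin 22 → ZMod 2) : V := Fin.append u v

theorem lp_jn (u v) : lp (jn u v) = u := by ext r; exact Fin.append_left u v r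
theorem rp_jn (u v) : rp (jn u v) = v := by ext r; exact Fin.append_right u v r

theorem lr_ext {x y : V} (h1 : lp x = lp y) (h2 : rp x = rp y) : x = y := by
  funext j
  refine Fin.addCases (m := 22) (n := 22) (motive := fun j => x j = y j) ?_ ?_ j
  · exact fun r => congrFun h1 r
  · exact fun r => congrFun h2 r

theorem sum44 {α : Type} [AddCommMonoid α] (f : Fin 44 → α) :
    ∑ j, f j = ∑ r : Fin 22, f (Fin.castAdd 22 r) + ∑ r : Fin 22, f (Fin.natAdd 22 r) :=
  Fin.sum_univ_add (a := 22) (b := 22) f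

theorem dot_split (x y : V) : ∑ j, x j * y j = lp x ⬝ᵥ lp y + rp x ⬝ᵥ rp y := sum44 _

theorem val_le_one (a : ZMod 2) : a.val = if a ≠ 0 then 1 else 0 := by
  revert a; decide

theorem wt_eq_sum {n : ℕ} (x : Fin n → ZMod 2) : wt x = ∑ j, (x j).val := by
  rw [wt, hammingNorm, Finset.card_filter]
  exact Finset.sum_congr rfl fun j _ => (val_le_one (x j)).symm

/-- Size of the intersection of the supports. -/
def inter (x y : V) : ℕ := ∑ j, (x j).val * (y j).val

theorem wt_add (x y : V) : wt (x + y) + 2 * inter x y = wt x + wt y := by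
  simp only [wt_eq_sum, inter, Finset.mul_sum, ← Finset.sum_add_distrib]
  refine Finset.sum_congr rfl fun j _ => ?_
  show (x j + y j).val + _ = _
  generalize x j = a
  generalize y j = b
  revert a b; decide

theorem inter_cast (x y : V) : ((inter x y : ℕ) : ZMod 2) = ∑ j, x j * y j := by
  rw [inter, Nat.cast_sum]
  refine Finset.sum_congr rfl fun j _ => ?_
  rw [Nat.cast_mul, ZMod.natCast_zmod_val, ZMod.natCast_zmod_val]

theorem wt_split (x : V) : wt x = wt (lp x) + wt (rp x) := by
  rw [wt_eq_sum, wt_eq_sum, wt_eq_sum]; exact sum44 _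

/-- The code generated by the rows of `[I | A]`. -/
def code (A : Matrix (Fin 22) (Fin 22) (ZMod 2)) : Submodule (ZMod 2) V where
  carrier := {x | Matrix.vecMul (lp x) A = rp x}
  add_mem' := by
    intro a b ha hb
    show Matrix.vecMul (lp a + lp b) A = rp a + rp b
    rw [Matrix.add_vecMul, ha, hb]
  zero_mem' := by
    show Matrix.vecMul 0 A = 0
    exact Matrix.zero_vecMul A
  smul_mem' := by
    intro c a ha
    show Matrix.vecMul (c • lp a) A = c • rp a
    rw [Matrix.smul_vecMul, ha]

theorem mem_code {A : Matrix (Fin 22) (Fin 22) (ZMod 2)} {x : V} :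
    x ∈ code A ↔ Matrix.vecMul (lp x) A = rp x := Iff.rfl

theorem mem_dual {S : Set V} {x : V} : x ∈ dualSet S ↔ ∀ y ∈ S, ∑ i, x i * y i = 0 := Iff.rfl

section
variable {A : Matrix (Fin 22) (Fin 22) (ZMod 2)}

/-- The rows of the generator matrix. -/
def row (A : Matrix (Fin 22) (Fin 22) (ZMod 2)) (r : Fin 22) : V := jn (Pi.single r 1) (A r)

theorem row_mem (r : Fin 22) : row A r ∈ code A := by
  rw [mem_code, row, lp_jn, rp_jn, Matrix.single_one_vecMul]; rfl

theorem mul_comm_aux {R n : Type} [Field R] [Fintype n] [DecidableEq n] (A B : Matrix n n R)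
    (h : A * B = 1) : B * A = 1 := mul_eq_one_comm.mp h

theorem code_orth (h : A.transpose * A = 1) {x y : V} (hx : x ∈ code A) (hy : y ∈ code A) :
    ∑ j, x j * y j = 0 := by
  have h' : A * A.transpose = 1 := mul_comm_aux _ _ h
  rw [dot_split, ← mem_code.mp hx, ← mem_code.mp hy, ← Matrix.mulVec_transpose A (lp y),
    Matrix.dotProduct_mulVec, Matrix.vecMul_vecMul, h', Matrix.vecMul_one]
  exact CharTwo.add_self_eq_zero _

theorem selfDual (h : A.transpose * A = 1) : IsSelfDual (code A) := by
  apply Set.Subset.antisymm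
  · intro x hx y hy
    exact code_orth h hx hy
  · intro x hx
    have h1 : lp x = Matrix.vecMul (rp x) A.transpose := by
      ext r
      have := hx (row A r) (row_mem r)
      rw [dot_split, row, lp_jn, rp_jn, dotProduct_single, mul_one] at this
      rw [Matrix.vecMul_transpose, CharTwo.add_eq_zero.mp this]
      exact dotProduct_comm _ _
    show Matrix.vecMul (lp x) A = rp x
    rw [h1, Matrix.vecMul_vecMul, h, Matrix.vecMul_one]

theorem finrank_code : Module.finrank (ZMod 2) (code A) = 22 := by
  let e : code A ≃ₗ[ZMod 2] (Fin 22 → ZMod 2) :=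
    { toFun := fun x => lp x.1
      invFun := fun u => ⟨jn u (Matrix.vecMul u A), by rw [mem_code, lp_jn, rp_jn]⟩
      map_add' := fun _ _ => rfl
      map_smul' := fun _ _ => rfl
      left_inv := by
        rintro ⟨x, hx⟩
        apply Subtype.ext
        apply lr_ext
        · rw [lp_jn]
        · rw [rp_jn]; exact hx
      right_inv := fun u => lp_jn _ _ }
  rw [e.finrank_eq, Module.finrank_fin_fun]

theorem code_sum {x : V} (hx : x ∈ code A) : x = ∑ r, lp x r • row A r := by
  have h2 : (∑ r, lp x r • row A r) ∈ code A :=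
    Submodule.sum_mem _ fun r _ => Submodule.smul_mem _ _ (row_mem r)
  have h1 : lp (∑ r, lp x r • row A r) = lp x := by
    ext s
    have : lp (∑ r, lp x r • row A r) s = ∑ r, lp x r * lp (row A r) s := by
      simp [lp, Finset.sum_apply]
    rw [this]
    simp [row, lp_jn, Pi.single_apply]
  apply lr_ext h1.symm
  rw [← mem_code.mp hx, ← mem_code.mp h2, h1]

/-- Vector of the shadow. -/
def tv (w : Fin 22 → ZMod 2) : V := jn w 0

theorem tv_dot (w : Fin 22 → ZMod 2) (x : V) : ∑ j, tv w j * x j = w ⬝ᵥ lp x := by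
  rw [dot_split, tv, lp_jn, rp_jn, zero_dotProduct, add_zero]

theorem val_aux (a b : ZMod 2) (p q s i : ℕ) (h : s + 2 * i = p + q) (hi : (i : ZMod 2) = 0)
    (h1 : p % 4 = 2 * a.val) (h2 : q % 4 = 2 * b.val) : s % 4 = 2 * (a + b).val := by
  have he : i % 2 = 0 := by
    have := (ZMod.natCast_eq_zero_iff i 2).mp hi
    omega
  have : (a + b).val = (a.val + b.val) % 2 := ZMod.val_add a b
  omega

theorem wt_mod (h : A.transpose * A = 1) (w : Fin 22 → ZMod 2)
    (hw : ∀ r, wt (row A r) % 4 = 2 * (w r).val) {x : V} (hx : x ∈ code A) :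
    wt x % 4 = 2 * (w ⬝ᵥ lp x).val := by
  let P : Submodule (ZMod 2) V :=
    { carrier := {y | y ∈ code A ∧ wt y % 4 = 2 * (w ⬝ᵥ lp y).val}
      add_mem' := by
        rintro a b ⟨ha, ha'⟩ ⟨hb, hb'⟩
        refine ⟨add_mem ha hb, ?_⟩
        show _ = 2 * (w ⬝ᵥ (lp a + lp b)).val
        rw [dotProduct_add]
        exact val_aux _ _ _ _ _ _ (wt_add a b) (by rw [inter_cast, code_orth h ha hb]) ha' hb'
      zero_mem' := by
        refine ⟨zero_mem _, ?_⟩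
        have : lp 0 = 0 := rfl
        rw [this, dotProduct_zero, wt_eq_sum]
        simp
      smul_mem' := by
        rintro c a ⟨ha, ha'⟩
        have hc : c = 0 ∨ c = 1 := by revert c; decide
        rcases hc with rfl | rfl
        · rw [zero_smul]
          refine ⟨zero_mem _, ?_⟩
          have : lp 0 = 0 := rfl
          rw [this, dotProduct_zero, wt_eq_sum]
          simp
        · rw [one_smul]; exact ⟨ha, ha'⟩ }
  have : x ∈ P := by
    rw [code_sum hx]
    refine Submodule.sum_mem _ fun r _ => Submodule.smul_mem _ _ ⟨row_mem r, ?_⟩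
    rw [hw r, row, lp_jn, dotProduct_single, mul_one]
  exact this.2

theorem wt_four (h : A.transpose * A = 1) (w : Fin 22 → ZMod 2)
    (hw : ∀ r, wt (row A r) % 4 = 2 * (w r).val) {x : V} (hx : x ∈ code A) :
    4 ∣ wt x ↔ w ⬝ᵥ lp x = 0 := by
  have := wt_mod h w hw hx
  rw [← ZMod.val_eq_zero]
  omega

theorem zmod2_cases (a : ZMod 2) : a = 0 ∨ a = 1 := by revert a; decide

theorem singly (h : A.transpose * A = 1) (w : Fin 22 → ZMod 2)
    (hw : ∀ r, wt (row A r) % 4 = 2 * (w r).val) (r0 : Fin 22) (hr0 : w r0 = 1) :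
    IsSinglyEvenSelfDual (code A) := by
  refine ⟨selfDual h, row A r0, row_mem r0, ?_⟩
  rw [wt_four h w hw (row_mem r0), row, lp_jn, dotProduct_single, hr0]
  decide

theorem mem_shadow (h : A.transpose * A = 1) (w : Fin 22 → ZMod 2)
    (hw : ∀ r, wt (row A r) % 4 = 2 * (w r).val) (r0 : Fin 22) (hr0 : w r0 = 1) (z : V) :
    z ∈ shadow (code A) ↔ z + tv w ∈ code A := by
  have hmem : ∀ y : V, (∀ x ∈ code A, ∑ j, y j * x j = 0) → y ∈ code A := by
    intro y hy
    have : y ∈ dualSet (code A : Set V) := hy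
    rw [← selfDual h] at this
    exact this
  have hadd : ∀ x y v : V, ∑ j, (x + y) j * v j = ∑ j, x j * v j + ∑ j, y j * v j := by
    intro x y v
    rw [← Finset.sum_add_distrib]
    exact Finset.sum_congr rfl fun j _ => add_mul _ _ _
  have hadd' : ∀ x y v : V, ∑ j, v j * (x + y) j = ∑ j, v j * x j + ∑ j, v j * y j := by
    intro x y v
    rw [← Finset.sum_add_distrib]
    exact Finset.sum_congr rfl fun j _ => mul_add _ _ _
  constructor
  · rintro ⟨hz, hzC⟩
    have hz' : ∀ x ∈ code A, w ⬝ᵥ lp x = 0 → ∑ j, z j * x j = 0 := fun x hx hx0 =>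
      hz x ⟨hx, (wt_four h w hw hx).mpr hx0⟩
    obtain ⟨c, hc, hzc⟩ : ∃ c ∈ code A, ∑ j, z j * c j ≠ 0 := by
      by_contra hcon
      push Not at hcon
      exact hzC (hmem z hcon)
    have hzc1 : ∑ j, z j * c j = 1 := (zmod2_cases _).resolve_left hzc
    have hwc : w ⬝ᵥ lp c = 1 := (zmod2_cases _).resolve_left fun h0 => hzc (hz' c hc h0)
    apply hmem
    intro x hx
    rw [hadd, tv_dot]
    rcases zmod2_cases (w ⬝ᵥ lp x) with h0 | h1
    · rw [h0, hz' x hx h0, add_zero]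
    · have hxc : w ⬝ᵥ lp (x + c) = 0 := by
        show w ⬝ᵥ (lp x + lp c) = 0
        rw [dotProduct_add, h1, hwc]; decide
      have := hz' (x + c) (add_mem hx hc) hxc
      rw [hadd', hzc1] at this
      rw [h1, this]
  · intro hz
    have hzx : ∀ x ∈ code A, ∑ j, z j * x j = w ⬝ᵥ lp x := by
      intro x hx
      have := code_orth h hz hx
      rw [hadd, tv_dot] at this
      exact CharTwo.add_eq_zero.mp this
    refine ⟨fun x hx => ?_, fun hzC => ?_⟩
    · rw [hzx x hx.1]
      exact (wt_four h w hw hx.1).mp hx.2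
    · have h1 := code_orth h hzC (row_mem r0)
      rw [hzx _ (row_mem r0), row, lp_jn, dotProduct_single, hr0] at h1
      revert h1; decide

theorem minWtSet_eq {S : Set V} {m : ℕ} (hm : 0 < m) (h1 : ∃ x ∈ S, wt x = m)
    (h2 : ∀ x ∈ S, x ≠ 0 → m ≤ wt x) : minWtSet S = m := by
  obtain ⟨x, hx, hxm⟩ := h1
  have hne : x ≠ 0 := by
    rintro rfl
    rw [wt_eq_sum] at hxm
    simp at hxm
    omega
  have hmem : m ∈ {w | ∃ x ∈ S, x ≠ 0 ∧ wt x = w} := ⟨x, hx, hne, hxm⟩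
  apply le_antisymm
  · exact Nat.sInf_le hmem
  · obtain ⟨y, hy, hy0, hyw⟩ := Nat.sInf_mem ⟨m, hmem⟩
    show m ≤ sInf _
    rw [← hyw]
    exact h2 y hy hy0

end

/-! ### The invariant -/

open Classical in
/-- Words of weight 8. -/
noncomputable def W8 (C : Submodule (ZMod 2) V) : Finset V :=
  Finset.univ.filter fun x => x ∈ C ∧ wt x = 8

/-- Sum of the third powers of the numbers of words of weight 8 meeting a given word of weight 8
in at least 3 points. -/
noncomputable def inv (C : Submodule (ZMod 2) V) : ℕ :=
  ∑ a ∈ W8 C, ((W8 C).filter fun b => 3 ≤ inter a b).card ^ 3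

theorem mem_W8 {C : Submodule (ZMod 2) V} {x : V} : x ∈ W8 C ↔ x ∈ C ∧ wt x = 8 := by
  simp [W8]

/-- Permutation of the coordinates. -/
def pe (σ : Equiv.Perm (Fin 44)) : V ≃ V where
  toFun x := x ∘ σ
  invFun x := x ∘ σ.symm
  left_inv x := by funext j; simp
  right_inv x := by funext j; simp

theorem wt_pe (σ : Equiv.Perm (Fin 44)) (x : V) : wt (pe σ x) = wt x := by
  rw [wt_eq_sum, wt_eq_sum]
  exact Equiv.sum_comp σ fun j => (x j).val

theorem inter_pe (σ : Equiv.Perm (Fin 44)) (x y : V) : inter (pe σ x) (pe σ y) = inter x y := by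
  rw [inter, inter]
  exact Equiv.sum_comp σ fun j => (x j).val * (y j).val

theorem sum_aux {α : Type} [DecidableEq α] (f : α → α → ℕ) (e : α ≃ α) (hf : ∀ x y, f (e x) (e y) = f x y)
    (W W' : Finset α) (hW : ∀ x, x ∈ W ↔ e x ∈ W') :
    ∑ a ∈ W, (W.filter fun b => 3 ≤ f a b).card ^ 3 =
      ∑ a ∈ W', (W'.filter fun b => 3 ≤ f a b).card ^ 3 := by
  refine Finset.sum_equiv e hW fun a _ => ?_
  congr 1
  refine Finset.card_equiv e fun b => ?_
  rw [Finset.mem_filter, Finset.mem_filter, hf, hW]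

theorem mem_map_pe (σ : Equiv.Perm (Fin 44)) (C : Submodule (ZMod 2) V) (x : V) :
    pe σ x ∈ Submodule.map (LinearMap.funLeft (ZMod 2) (ZMod 2) σ) C ↔ x ∈ C := by
  rw [Submodule.mem_map]
  constructor
  · rintro ⟨y, hy, hyx⟩
    have h2 : pe σ y = pe σ x := hyx
    rwa [← (pe σ).injective h2]
  · intro hx
    exact ⟨x, hx, rfl⟩

theorem inv_equiv {C D : Submodule (ZMod 2) V} (h : CodeEquiv C D) : inv C = inv D := by
  obtain ⟨σ, hD⟩ := h
  have hmem : ∀ x, x ∈ W8 C ↔ pe σ x ∈ W8 D := by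
    intro x
    rw [mem_W8, mem_W8, wt_pe, ← hD, mem_map_pe]
  unfold inv
  exact sum_aux inter (pe σ) (inter_pe σ) _ _ hmem

theorem inv_eq {C : Submodule (ZMod 2) V} (n : ℕ) (x : ℕ → V)
    (hinj : ∀ a < n, ∀ b < n, x a = x b → a = b) (h1 : ∀ a < n, x a ∈ C ∧ wt (x a) = 8)
    (h2 : ∀ y ∈ C, wt y = 8 → ∃ a < n, y = x a) :
    inv C = ∑ a ∈ Finset.range n,
      (∑ b ∈ Finset.range n, if 3 ≤ inter (x a) (x b) then 1 else 0) ^ 3 := by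
  classical
  have hi : Set.InjOn x (Finset.range n : Set ℕ) := by
    intro a ha b hb hab
    exact hinj a (by simpa using ha) b (by simpa using hb) hab
  have hW : W8 C = (Finset.range n).image x := by
    ext y
    rw [mem_W8, Finset.mem_image]
    constructor
    · rintro ⟨hy, hy8⟩
      obtain ⟨a, ha, rfl⟩ := h2 y hy hy8
      exact ⟨a, by simpa using ha, rfl⟩
    · rintro ⟨a, ha, rfl⟩
      exact h1 a (by simpa using ha)
  rw [inv, hW, Finset.sum_image hi]
  refine Finset.sum_congr rfl fun a _ => ?_
  rw [Finset.card_filter, Finset.sum_image hi]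



/-! ### Soundness of the checker -/

/-- The matrix given by a list of rows. -/
def mat (M : List Nat) : Matrix (Fin 22) (Fin 22) (ZMod 2) := fun r j => ent M r j

/-- A word of a family. -/
def wd (ys : List Nat) (i : Nat) : V := fun j => ent ys j i

/-- One half of a word of a family. -/
def hv (ys : List Nat) (i : Nat) : Fin 22 → ZMod 2 := fun r => ent ys r i

/-- The vector of bits of a number. -/
def bv (s : Nat) : Fin 22 → ZMod 2 := fun j => bz (s.testBit j)

theorem ent_append_left (P Q : List Nat) (hP : P.length = 22) (r i : Nat) (hr : r < 22) :
    ent (P ++ Q) r i = ent P r i := by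
  rw [ent, ent, List.getD_append _ _ _ _ (by omega)]

theorem ent_append_right (P Q : List Nat) (hP : P.length = 22) (r i : Nat) :
    ent (P ++ Q) (22 + r) i = ent Q r i := by
  rw [ent, ent, List.getD_append_right _ _ _ _ (by omega), hP, Nat.add_sub_cancel_left]

theorem lp_wd (P Q : List Nat) (hP : P.length = 22) (i : Nat) : lp (wd (P ++ Q) i) = hv P i := by
  funext r
  exact ent_append_left P Q hP r i r.2

theorem rp_wd (P Q : List Nat) (hP : P.length = 22) (i : Nat) : rp (wd (P ++ Q) i) = hv Q i := by
  funext r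
  exact ent_append_right P Q hP r i

theorem vm_apply {n : Type} [Fintype n] (v : n → ZMod 2) (A : Matrix n n (ZMod 2)) (j : n) :
    Matrix.vecMul v A j = ∑ r, v r * A r j := rfl

theorem lp_add (x y : V) : lp (x + y) = lp x + lp y := rfl
theorem rp_add (x y : V) : rp (x + y) = rp x + rp y := rfl

theorem hv_apply (ys : List Nat) (i : Nat) (r : Fin 22) : hv ys i r = ent ys r i := rfl
theorem mat_apply (M : List Nat) (r j : Fin 22) : mat M r j = ent M r j := rfl
theorem bv_apply (s : Nat) (j : Fin 22) : bv s j = bz (s.testBit j) := rfl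
theorem ent_zero (s : Nat) (as : List Nat) (j : Nat) : ent (s :: as) 0 j = bz (s.testBit j) := rfl
theorem ent_succ (s : Nat) (as : List Nat) (r j : Nat) : ent (s :: as) (r + 1) j = ent as r j := rfl

theorem hv_cols (as es : List Nat) (h1 : as.length = 22) (h2 : es.length = 22) (i : Nat) :
    hv (cols as es) i = Matrix.vecMul (hv es i) (mat as) := by
  funext j
  rw [hv_apply, cols_spec as es 22 j i h1 h2 j.2, Finset.sum_range, vm_apply]
  refine Finset.sum_congr rfl fun r _ => ?_
  rw [hv_apply, mat_apply, mul_comm]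

theorem hv_cols_cons (s o : Nat) (as es : List Nat) (h1 : as.length = 22) (h2 : es.length = 22)
    (i : Nat) (ho : o.testBit i = true) :
    hv (cols (s :: as) (o :: es)) i = bv s + Matrix.vecMul (hv es i) (mat as) := by
  funext j
  rw [hv_apply, cols_spec _ _ 23 j i (by rw [List.length_cons, h1]) (by rw [List.length_cons, h2])
    j.2, Finset.sum_range_succ', Finset.sum_range, add_comm, Pi.add_apply, vm_apply, ent_zero,
    ent_zero, ho, bv_apply]
  have h3 : bz true = 1 := rfl
  rw [h3, mul_one]
  refine congrArg (fun t => bz (s.testBit j) + t) (Finset.sum_congr rfl fun r _ => ?_)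
  rw [ent_succ, ent_succ, hv_apply, mat_apply, mul_comm]

theorem mat_transpose (M : List Nat) (h1 : M.length = 22) :
    mat (cols M pow22) = (mat M).transpose := by
  funext j i
  show ent (cols M pow22) j i = ent M i j
  rw [cols_spec _ _ 22 j i h1 pow22_length j.2, Finset.sum_eq_single i.1]
  · rw [pow22_ent _ _ i.2, if_pos rfl, mul_one]
  · intro r hr hne
    rw [pow22_ent _ _ (Finset.mem_range.mp hr), if_neg hne, mul_zero]
  · intro hi
    exact absurd (Finset.mem_range.mpr i.2) hi

theorem mat_orth (M : List Nat) (h1 : M.length = 22) (h : cols M M = pow22) :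
    (mat M).transpose * mat M = 1 := by
  funext j i
  have h2 := cols_spec M M 22 j i h1 h1 j.2
  rw [h, pow22_ent _ _ j.2, Finset.sum_range] at h2
  rw [Matrix.mul_apply, Matrix.one_apply]
  have h3 : (if (j : ℕ) = i then (1 : ZMod 2) else 0) = if j = i then 1 else 0 := by
    simp only [Fin.ext_iff]
  rw [← h3, h2]
  rfl

theorem bv_lin (w : Nat) (M : List Nat) (h1 : M.length = 22) :
    bv (lin (bitsOf w) M 0) = Matrix.vecMul (bv w) (mat M) := by
  funext i
  rw [bv_apply, lin_spec (bitsOf w) M 22 0 i (bitsOf_length w) h1, Finset.sum_range, vm_apply]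
  refine Finset.sum_congr rfl fun r _ => ?_
  rw [bitsOf_ent _ _ r.2, bv_apply, mat_apply]

theorem wt_wd (ys : List Nat) (h : ys.length = 44) (i : Nat) : wt (wd ys i) = cnt ys i := by
  rw [wt_eq_sum, cnt_eq_sum ys 44 i h, Finset.sum_range]
  exact Finset.sum_congr rfl fun j _ => bz_val _

theorem inter_wd (ys : List Nat) (h : ys.length = 44) (a b : Nat) :
    inter (wd ys a) (wd ys b) = cnt (filt a ys) b := by
  rw [inter, cnt_filt a b ys 44 h, Finset.sum_range]
  refine Finset.sum_congr rfl fun j _ => ?_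
  rw [wd, wd, ent, ent, bz_val, bz_val]

theorem inter_self (x : V) : inter x x = wt x := by
  rw [inter, wt_eq_sum]
  refine Finset.sum_congr rfl fun j _ => ?_
  generalize x j = a
  revert a; decide

theorem hv_complete (E : List Nat) (N : Nat) (hE : Good 4 22 (N, E)) (u : Fin 22 → ZMod 2)
    (hu : wt u ≤ 4) : ∃ i < N, hv E i = u := by
  obtain ⟨-, -, h3⟩ := hE
  obtain ⟨i, hi, h⟩ := h3 (fun r => if hr : r < 22 then decide (u ⟨r, hr⟩ = 1) else false) (by
    rw [Finset.sum_range]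
    refine le_trans (le_of_eq ?_) hu
    rw [wt_eq_sum]
    refine Finset.sum_congr rfl fun r _ => ?_
    rw [dif_pos r.2]
    show (decide (u r = 1)).toNat = (u r).val
    generalize u r = a
    revert a; decide)
  refine ⟨i, hi, ?_⟩
  funext r
  have h4 := h r r.2
  rw [dif_pos r.2] at h4
  show bz ((E.getD r 0).testBit i) = u r
  rw [h4]
  show bz (decide (u r = 1)) = u r
  generalize u r = a
  revert a; decide

theorem supp_eq {x y : V} (hw : wt x = wt y) (h : ∀ j, x j = 1 → y j = 1) : x = y := by
  have hle : ∀ j ∈ Finset.univ, (x j).val ≤ (y j).val := by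
    intro j _
    have := h j
    generalize x j = a at this
    generalize y j = b at this
    revert a b; decide
  rw [wt_eq_sum, wt_eq_sum] at hw
  have h2 := (Finset.sum_eq_sum_iff_of_le hle).mp hw
  funext j
  exact ZMod.val_injective 2 (h2 j (Finset.mem_univ j))

theorem chkMain_spec (ones : Nat) (ks ys : List Nat) (hk : ks.length = 44) (hy : ys.length = 44)
    (h : chkMain ones ks ys (thr ones 9 ys) = true) (i : Nat) (hi : ones.testBit i = true) :
    (1 ≤ wt (wd ys i) → 8 ≤ wt (wd ys i)) ∧
      (wt (wd ys i) = 8 → ∃ a < 44, ∀ j, wd ks a j = 1 → wd ys i j = 1) := by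
  rw [chkMain, Bool.and_eq_true] at h
  obtain ⟨h1, h2⟩ := h
  replace h1 := Nat.eq_of_beq_eq_true h1
  replace h2 := Nat.eq_of_beq_eq_true h2
  have t0 := thr_spec ones 9 i hi ys 0 (by omega)
  have t7 := thr_spec ones 9 i hi ys 7 (by omega)
  have t8 := thr_spec ones 9 i hi ys 8 (by omega)
  rw [wt_wd ys hy]
  generalize cnt ys i = c at *
  constructor
  · intro hc
    rw [h1, t0] at t7
    have : decide (0 + 1 ≤ c) = true := decide_eq_true hc
    rw [this] at t7
    exact of_decide_eq_true t7.symm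
  · intro hc
    subst hc
    have hx : (Nat.xor ((thr ones 9 ys).getD 7 0) ((thr ones 9 ys).getD 8 0)).testBit i = true := by
      have : ∀ a b : Nat, (Nat.xor a b).testBit i = (a.testBit i ^^ b.testBit i) :=
        fun a b => Nat.testBit_xor a b i
      rw [this, t7, t8]; rfl
    have hl : ∀ a b : Nat, Nat.land a b = a → a.testBit i = true → b.testBit i = true := by
      intro a b hab ha
      have h3 : (a &&& b).testBit i = (a.testBit i && b.testBit i) := Nat.testBit_and a b i
      have h4 : a &&& b = a := hab
      rw [h4, ha] at h3
      simpa using h3.symm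
    obtain ⟨a, ha, hs⟩ := cov_spec ones i ks ys 44 (hl _ _ h2 hx)
    refine ⟨a, ha, fun j hj => ?_⟩
    have h5 : ∀ b : Bool, bz b = 1 ↔ b = true := by decide
    have h6 := sel_spec ones a i ks ys hs j (by rw [hk]; exact j.2) (by rw [hy]; exact j.2)
      ((h5 _).mp hj)
    exact (h5 _).mpr h6

theorem chkShadow_spec (ones : Nat) (ys : List Nat) (hy : ys.length = 44)
    (h : chkShadow ones ys = true) (i : Nat) (hi : ones.testBit i = true) :
    10 ≤ wt (wd ys i) := by
  have h1 := Nat.eq_of_beq_eq_true h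
  have t := thr_spec ones 10 i hi ys 9 (by omega)
  rw [h1, hi] at t
  rw [wt_wd ys hy]
  exact of_decide_eq_true t.symm

theorem chkExact_spec (ones m : Nat) (hm : 0 < m) (ys : List Nat) (hy : ys.length = 44)
    (h : chkExact ones m ys = true) (i : Nat) (hi : ones.testBit i = true) :
    wt (wd ys i) = m := by
  have h' : (Nat.beq ((thr ones (m + 1) ys).getD (m - 1) 0) ones &&
    Nat.beq ((thr ones (m + 1) ys).getD m 0) 0) = true := h
  rw [Bool.and_eq_true] at h'
  have h1 := Nat.eq_of_beq_eq_true h'.1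
  have h2 := Nat.eq_of_beq_eq_true h'.2
  have t1 := thr_spec ones (m + 1) i hi ys (m - 1) (by omega)
  have t2 := thr_spec ones (m + 1) i hi ys m (by omega)
  rw [h1, hi] at t1
  rw [h2, Nat.zero_testBit] at t2
  rw [wt_wd ys hy]
  have a1 := of_decide_eq_true t1.symm
  have a2 := of_decide_eq_false t2.symm
  omega

theorem ones44 (m : Nat) (i : Nat) (hi : i < m) : (2 ^ m - 1).testBit i = true := by
  rw [Nat.testBit_two_pow_sub_one]
  exact decide_eq_true hi

/-- What the check proves about a code. -/
structure Nice (C : Submodule (ZMod 2) V) (v : Nat) : Prop where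
  /-- singly even and self-dual -/
  se : IsSinglyEvenSelfDual C
  /-- dimension -/
  dim : Module.finrank (ZMod 2) C = 22
  /-- minimum weight -/
  mw : minWt C = 8
  /-- minimum weight of the shadow -/
  sh : minWtSet (shadow C) = 10
  /-- invariant -/
  iv : inv C = v

theorem inv_wd (C : Submodule (ZMod 2) V) (ks : List Nat) (hk : ks.length = 44) (v : Nat)
    (h1 : ∀ a < 44, wd ks a ∈ C ∧ wt (wd ks a) = 8)
    (h2 : ∀ y ∈ C, wt y = 8 → ∃ a < 44, y = wd ks a)
    (hd : chkDist ks 44 = true) (hv : invSum ks 44 = v) : inv C = v := by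
  rw [inv_eq 44 (wd ks) ?_ h1 h2, ← hv, invSum_spec]
  · refine Finset.sum_congr rfl fun a _ => ?_
    rw [pop_spec]
    refine congrArg (fun t => t ^ 3) (Finset.sum_congr rfl fun b hb => ?_)
    rw [thr_spec _ 8 b (ones44 44 b (Finset.mem_range.mp hb)) _ 2 (by omega), inter_wd ks hk]
    by_cases h : 3 ≤ cnt (filt a ks) b
    · rw [if_pos h, decide_eq_true (by omega)]; rfl
    · rw [if_neg h, decide_eq_false (by omega)]; rfl
  · intro a ha b hb hab
    have hi : inter (wd ks a) (wd ks b) = 8 := by rw [← hab, inter_self, (h1 a ha).2]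
    rw [inter_wd ks hk] at hi
    have t := thr_spec (2 ^ 44 - 1) 8 b (ones44 44 b hb) (filt a ks) 7 (by omega)
    rw [chkDist_spec ks 44 hd a ha, hi, Nat.testBit_two_pow] at t
    exact of_decide_eq_true t

theorem wt_row (M : List Nat) (r : Fin 22) :
    wt (row (mat M) r) = 1 + pop 22 (M.getD r 0) := by
  have h1 : wt (Pi.single r 1 : Fin 22 → ZMod 2) = 1 := by
    rw [wt_eq_sum, Finset.sum_eq_single r]
    · rw [Pi.single_eq_same]; exact ZMod.val_one 2
    · intro b _ hb
      rw [Pi.single_eq_of_ne hb]; exact ZMod.val_zero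
    · intro h
      exact absurd (Finset.mem_univ r) h
  have h2 : wt (mat M r) = pop 22 (M.getD r 0) := by
    rw [wt_eq_sum, pop_spec, Finset.sum_range]
    refine Finset.sum_congr rfl fun j _ => ?_
    rw [mat_apply, ent, bz_val]
  rw [wt_split, row, lp_jn, rp_jn, h1, h2]

theorem code_left {A : Matrix (Fin 22) (Fin 22) (ZMod 2)} (h : A.transpose * A = 1) {x : V}
    (hx : x ∈ code A) : lp x = Matrix.vecMul (rp x) A.transpose := by
  rw [← mem_code.mp hx, Matrix.vecMul_vecMul, mul_comm_aux _ _ h, Matrix.vecMul_one]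

theorem chk_nice (ones : Nat) (E : List Nat) (N : Nat) (hones : ∀ i < N, ones.testBit i = true)
    (hE : Good 4 22 (N, E)) (d : Dat) (h : chk ones E d = true) : Nice (code (mat d.M)) d.v := by
  have hEl : E.length = 22 := hE.1
  obtain ⟨M, w, z, L, v⟩ := d
  rw [chk, chk2] at h
  simp only [Bool.and_eq_true] at h
  obtain ⟨⟨⟨⟨⟨⟨⟨⟨⟨⟨⟨⟨c1, c2⟩, c3⟩, c4⟩, c5⟩, c6⟩, c7⟩, c8⟩, c9⟩, c10⟩, c11⟩, c12⟩, c13⟩ := h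
  replace c1 : M.length = 22 := Nat.eq_of_beq_eq_true c1
  replace c2 : L.length = 22 := Nat.eq_of_beq_eq_true c2
  replace c3 := leq_eq _ _ c3
  replace c8 := Nat.eq_of_beq_eq_true c8
  have len : ∀ P Q : List Nat, P.length = 22 → Q.length = 22 → (P ++ Q).length = 44 := by
    intro P Q hP hQ
    rw [List.length_append, hP, hQ]
  have hA : (mat M).transpose * mat M = 1 := mat_orth M c1 c3
  have hw : ∀ r, wt (row (mat M) r) % 4 = 2 * (bv w r).val := by
    intro r
    rw [wt_row, chkRows_spec _ _ c4 r (by rw [c1]; exact r.2) (by rw [bitsOf_length]; exact r.2),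
      bitsOf_getD _ _ r.2, bv, bz_val]
  obtain ⟨r0, hr0⟩ : ∃ r0, bv w r0 = 1 := by
    rw [List.any_eq_true] at c5
    obtain ⟨b, hb, hb1⟩ := c5
    have hb2 : b = 1 := Nat.eq_of_beq_eq_true hb1
    obtain ⟨r, hr, hrb⟩ := List.getElem_of_mem hb
    have hr' : r < 22 := by rw [bitsOf_length] at hr; exact hr
    refine ⟨⟨r, hr'⟩, ?_⟩
    have h5 := bitsOf_getD w r hr'
    rw [List.getD_eq_getElem _ _ hr, hrb, hb2] at h5
    show bz (w.testBit r) = 1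
    generalize w.testBit r = b at h5
    revert b; decide
  have hat : (cols M pow22).length = 22 := cols_length _ _
  have hkl := len L (cols M L) c2 (cols_length _ _)
  -- the known words
  have hks : ∀ a < 44, wd (L ++ cols M L) a ∈ code (mat M) ∧ wt (wd (L ++ cols M L) a) = 8 := by
    intro a ha
    refine ⟨?_, chkExact_spec _ 8 (by omega) _ hkl c6 a (ones44 44 a ha)⟩
    rw [mem_code, lp_wd _ _ c2, rp_wd _ _ c2, hv_cols _ _ c1 c2]
  -- completeness
  have hcomp : ∀ x ∈ code (mat M), wt x ≤ 9 → (1 ≤ wt x → 8 ≤ wt x) ∧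
      (wt x = 8 → ∃ a < 44, ∀ j, wd (L ++ cols M L) a j = 1 → x j = 1) := by
    intro x hx hx9
    rw [wt_split] at hx9
    by_cases hl : wt (lp x) ≤ 4
    · obtain ⟨i, hi, hiu⟩ := hv_complete E N hE _ hl
      have : x = wd (E ++ cols M E) i := by
        apply lr_ext
        · rw [lp_wd _ _ hEl, hiu]
        · rw [rp_wd _ _ hEl, hv_cols _ _ c1 hEl, hiu, mem_code.mp hx]
      rw [this]
      exact chkMain_spec ones _ _ hkl (len _ _ hEl (cols_length _ _)) c10 i (hones i hi)
    · obtain ⟨i, hi, hiu⟩ := hv_complete E N hE (rp x) (by omega)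
      have : x = wd (cols (cols M pow22) E ++ E) i := by
        apply lr_ext
        · rw [lp_wd _ _ (cols_length _ _), hv_cols _ _ hat hEl, hiu, mat_transpose _ c1,
            code_left hA hx]
        · rw [rp_wd _ _ (cols_length _ _), hiu]
      rw [this]
      exact chkMain_spec ones _ _ hkl (len _ _ (cols_length _ _) hEl) c11 i (hones i hi)
  have hmemS := mem_shadow hA (bv w) hw r0 hr0
  refine ⟨singly hA (bv w) hw r0 hr0, finrank_code, ?_, ?_, ?_⟩
  · refine minWtSet_eq (by omega) ⟨_, (hks 0 (by omega)).1, (hks 0 (by omega)).2⟩ ?_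
    intro x hx hx0
    by_cases h9 : wt x ≤ 9
    · refine (hcomp x hx h9).1 ?_
      rw [wt]
      exact Nat.one_le_iff_ne_zero.mpr (hammingNorm_ne_zero_iff.mpr hx0)
    · omega
  · have hsum : ∀ x : V, x + tv (bv w) ∈ code (mat M) →
        Matrix.vecMul (lp x + bv w) (mat M) = rp x := by
      intro x hx
      have h6 := mem_code.mp hx
      rw [lp_add, rp_add, tv, lp_jn, rp_jn, add_zero] at h6
      exact h6
    refine minWtSet_eq (by omega) ?_ ?_
    · have hzl := bitsOf_length z
      refine ⟨wd (bitsOf z ++ cols (lin (bitsOf w) M 0 :: M) (1 :: bitsOf z)) 0, ?_,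
        chkExact_spec 1 10 (by omega) _ (len _ _ hzl (cols_length _ _)) c9 0 rfl⟩
      rw [hmemS, mem_code, lp_add, rp_add, tv, lp_jn, rp_jn, lp_wd _ _ hzl, rp_wd _ _ hzl, hv_cols_cons _ _ _ _ c1 hzl 0 rfl,
        bv_lin _ _ c1, Matrix.add_vecMul, add_zero, add_comm]
    · intro x hx _
      rw [hmemS] at hx
      have hx1 := hsum x hx
      by_contra h10
      have h10' := h10
      rw [wt_split] at h10'
      by_cases hl : wt (lp x) ≤ 4
      · obtain ⟨i, hi, hiu⟩ := hv_complete E N hE _ hl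
        have : x = wd (E ++ cols (lin (bitsOf w) M 0 :: M) (ones :: E)) i := by
          apply lr_ext
          · rw [lp_wd _ _ hEl, hiu]
          · rw [rp_wd _ _ hEl, hv_cols_cons _ _ _ _ c1 hEl i (hones i hi), hiu, bv_lin _ _ c1,
              ← hx1, Matrix.add_vecMul, add_comm]
        rw [this] at h10
        exact h10 (chkShadow_spec ones _ (len _ _ hEl (cols_length _ _)) c12 i (hones i hi))
      · obtain ⟨i, hi, hiu⟩ := hv_complete E N hE (rp x) (by omega)
        have : x = wd (cols (w :: cols M pow22) (ones :: E) ++ E) i := by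
          apply lr_ext
          · rw [lp_wd _ _ (cols_length _ _), hv_cols_cons _ _ _ _ hat hEl i (hones i hi), hiu,
              mat_transpose _ c1, ← hx1, Matrix.vecMul_vecMul, mul_comm_aux _ _ hA,
              Matrix.vecMul_one, add_comm (lp x), ← add_assoc]
            have : bv w + bv w = 0 := by
              funext j
              exact CharTwo.add_self_eq_zero _
            rw [this, zero_add]
          · rw [rp_wd _ _ (cols_length _ _), hiu]
        rw [this] at h10
        exact h10 (chkShadow_spec ones _ (len _ _ (cols_length _ _) hEl) c13 i (hones i hi))
  · refine inv_wd _ _ hkl v hks ?_ c7 c8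
    intro y hy hy8
    obtain ⟨a, ha, hj⟩ := (hcomp y hy (by omega)).2 hy8
    exact ⟨a, ha, (supp_eq (by rw [(hks a ha).2, hy8]) hj).symm⟩

/-- The all-one vector. -/
def ones22 : Nat := 2 ^ 9109 - 1

/-- The words of length 22 and weight at most 4, transposed. -/
def E22 : List Nat := [
  0x1ffffffffffffffffffffffffffffffffffffffffffffffffffffffffffffffffffffffffffffffffffffffffffffffffffffffffffffffffffffffffffffffffffffffffffffffffffffffffffffffffffffffffffffffffffffffffffffffffffffffffffffffffffffffffffffffffffffffffffffffffffffffffffffffffffffffffffffffffffffffffffffffffffffffffffffffffffffffffffffffffffffffffffffffffffffffffffffffffffffffffffffffffffffffffffffffffffffff8000000000000000000000000000000000000000000000000000000000000000000000000000000000000000000000000000000000000000000000000000000000000000000000000000000000000000000000000000000000000000000000000000000000000000000000000000000000000000000000000000000000000000000000000000000000000000000000000000000000000000000000000000000000000000000000000000000000000000000000000000000000000000000000000000000000000000000000000000000000000000000000000000000000000000000000000000000000000000000000000000000000000000000000000000000000000000000000000000000000000000000000000000000000000000000000000000000000000000000000000000000000000000000000000000000000000000000000000000000000000000000000000000000000000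00000000000000000000000000000000000000000000000000000000000000000000000000000000000000000000000000000000000000000000000000000000000000000000000000000000000000000000000000000000000000000000000000000000000000000000000000000000000000000000000000000000000000000000000000000000000000000000000000000000000000000000000000000000000000000000000000000000000000000000000000000000000000000000000000000000000000000000000000000000000000000000000000000000000000000000000000000000000000000000000000000000000000000000000000000000000000000000000000000000000000000000000000000000000000000000000000000000000000000000000000000000000000000000000000000000000000000000000000000000000000000000000000000000000000000000000000000000000000000000000000000000000000000000000000000000000000000000000000000000000000000000000000000000000000000000000000000000000000000000000000000000000000000000000000000000000000000000000000000000000000000000000000000000000000000000000000000000000000000000000000000000000000000000000000000000000000000000000000000000000000000000000000000000000000000000000000000000000000000000000000000000000000000000000000000000000000000000000000000000000000000000000000000000000000000000000000000000000000000000000000,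
  0x1ffffffffffffffffffffffffffffffffffffffffffffffffffffc00000000000000000000000000000000000000000000000000000000000000000000000000000000000000000000000000000000000000000000000000000000000000000000000000000000000000000000000000000000000000000000000000000000000000000000000000000000000000000000000000000000000000000000000000000000000000000000000000000000000000000000000000000000000000000000000007fffffffffffffffffffffffffffffffffffffffffffffffffffffffffffffffffffffffffffffffffffffffffffffffffffffffffffffffffffffffffffffffffffffffffffffffffffffffffffffffffffffffffffffffffffffffffffffffffffffffffffffffffffffffffffffffffffffffffffffffffffffffffffffffffffffffffffffffffffffffffffffffffffffffffffffffffffffffffffffffffffffffffffffffff0000000000000000000000000000000000000000000000000000000000000000000000000000000000000000000000000000000000000000000000000000000000000000000000000000000000000000000000000000000000000000000000000000000000000000000000000000000000000000000000000000000000000000000000000000000000000000000000000000000000000000000000000000000000000000000000000000000000000000000000000000000000000000000000000000000000000000000000000000000000000000000000000000000000000000000000000000000000000000000000000000000000000000000000000000000000000000000000000000000000000000000000000000000000000000000000000000000000000000000000000000000000000000000000000000000000000000000000000000000000000000000000000000000000000000000000000000000000000000000000000000000000000000000000000000000000000000000000000000000000000000000000000000000000000000000000000000000000000000000000000000000000000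000000000000000000000000000000000000000000000000000000000000000000000000000000000000000000000000000000000000000000000000000000000000000000000000000000000000000000000000000000000000000000000000000000000000000000000000000000000000000000000000000000000000000000000000000000000000000000000000000000000000000000000000000000000000000000000000000000000000000000000000000000000000000000000000000000000000000000000000000000000000000000000000000000000000000000000000000000000000000000000000000000000000000000000000000000000000000000000000000000000000000000000000000000000000000000000000000000000000000000000000000000000000000000000000000000000000000000000000000000000000000000000000000000000000000000000000,
  0x1ffffe000000000000000000000000000000000000000000000003fffffffffffffffffffffffffffffffffffffffffffffff800000000000000000000000000000000000000000000000000000000000000000000000000000000000000000000000000000000000000000000000000000000000000000000000000000000000000000000000000000000000000000000000000000000000000000000000000000000000000000000000000000000000000000000000000000000000000000000000007fffffffffffffffffffffffffffffffffffffffffffffff00000000000000000000000000000000000000000000000000000000000000000000000000000000000000000000000000000000000000000000000000000000000000000000000000000000000000000000000000000000000000000000000000000000000000000000000000000000000000000000000000000000000000000000000000000000000000000000000000ffffffffffffffffffffffffffffffffffffffffffffffffffffffffffffffffffffffffffffffffffffffffffffffffffffffffffffffffffffffffffffffffffffffffffffffffffffffffffffffffffffffffffffffffffffffffffffffffffffff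ffffffffffffffffffffffffffffffffffffffffffffffffffffffffffffffffffffffffffffffffffffffffffff00000000000000000000000000000000000000000000000000000000000000000000000000000000000000000000000000000000000000000000000000000000000000000000000000000000000000000000000000000000000000000000000000000000000000000000000000000000000000000000000000000000000000000000000000000000000000000000000000000000000000000000000000000000000000000000000000000000000000000000000000000000000000000000000000000000000000000000000000000000000000000000000000000000000000000000000000000000000000000000000000000000000000000000000000000000000000000000000000000000000000000000000000000000000000000000000000000000000000000000000000000000000000000000000000000000000000000000000000000000000000000000000000000000000000000000000000000000000000000000000000000000000000000000000000000000000000000000000000000000000000000000000000000000000000000000000000000000000000000000000000000000000000000000000000000000000000000000000000000000000000000000000000000000000000000000000000000000000000000000000000000000000000000000000000000000000000000000000000000000000000000000000000000000000000000000000000000000000000000000000000000000000000000000000000000000000000000000000000000000000000000000000000000000000000000000000000000000000000000000000000000000000000000000000000000000000000000000000000000000000,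
  0x100001ffffc0000000000000000000000000000000000000000003ffff80000000000000000000000000000000000000000007ffffffffffffffffffffffffffffffffffffffffff80000000000000000000000000000000000000000000000000000000000000000000000000000000000000000000000000000000000000000000000000000000000000000000000000000000000000000000000000000000000000000000000000000000000000000000000000000000000000000000000000000007ffff0000000000000000000000000000000000000000000fffffffffffffffffffffffffffffffffffffffffff0000000000000000000000000000000000000000000000000000000000000000000000000000000000000000000000000000000000000000000000000000000000000000000000000000000000000000000000000000000000000000000000000000000000000000000000000000000000000000000000000000000fffffffffffffffffffffffffffffffffffffffffff0000000000000000000000000000000000000000000000000000000000000000000000000000000000000000000000000000000000000000000000000000000000000000000000000000000000000000000000000000000000000000000000000000000000000000000000000000000000000000000000000000000fffffffffffffffffffffffffffffffffffffffffffffffffffffffffffffffffffffffffffffffffffffffffffffffffffffffffffffffffffffffffffffffffffffffffffffffffffffffffffffffffffffffffffffffffffffffffffffffffffffffffffffffffffffffffffffffffffffffffffffffffffffff0000000000000000000000000000000000000000000000000000000000000000000000000000000000000000000000000000000000000000000000000000000000000000000000000000000000000000000000000000000000000000000000000000000000000000000000000000000000000000000000000000000000000000000000000000000000000000000000000000000000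000000000000000000000000000000000000000000000000000000000000000000000000000000000000000000000000000000000000000000000000000000000000000000000000000000000000000000000000000000000000000000000000000000000000000000000000000000000000000000000000000000000000000000000000000000000000000000000000000000000000000000000000000000000000000000000000000000000000000000000000000000000000000000000000000000000000000000000000000000000000000000000000000000000000000000000000000000000000000000000000000000000000000000000000000000000000000000000000000000000000000000000000000000000000000000000000000000000000000000000000000000000000000000000000000000000000000000000000000000000000000000000000000000000000000000000000000000000000000000,
  0x8000100003ffff00000000000000000000000000000000000000200007fffe000000000000000000000000000000000000007fffe000000000000000000000000000000000000007fffffffffffffffffffffffffffffffffffffe000000000000000000000000000000000000000000000000000000000000000000000000000000000000000000000000000000000000000000000000000000000000000000000000000000000000000000000000000000000000000000000000000000000000000040000ffffc00000000000000000000000000000000000000ffffc00000000000000000000000000000000000000ffffffffffffffffffffffffffffffffffffffc0000000000000000000000000000000000000000000000000000000000000000000000000000000000000000000000000000000000000000000000000000000000000000000000000000000000000000000000000000000000000000000000000000000000000000ffffc00000000000000000000000000000000000000ffffffffffffffffffffffffffffffffffffffc0000000000000000000000000000000000000000000000000000000000000000000000000000000000000000000000000000000000000000000000000000000000000000000000000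000000000000000000000000000000000000000000000000000000000000000ffffffffffffffffffffffffffffffffffffffc0000000000000000000000000000000000000000000000000000000000000000000000000000000000000000000000000000000000000000000000000000000000000000000000000000000000000000000000000000000000000000000000000000000000000000ffffffffffffffffffffffffffffffffffffffffffffffffffffffffffffffffffffffffffffffffffffffffffffffffffffffffffffffffffffffffffffffffffffffffffffffffffffffffffffffffffffffffffffffffffffffffffffffffffffffffffffffffc00000000000000000000000000000000000000000000000000000000000000000000000000000000000000000000000000000000000000000000000000000000000000000000000000000000000000000000000000000000000000000000000000000000000000000000000000000000000000000000000000000000000000000000000000000000000000000000000000000000000000000000000000000000000000000000000000000000000000000000000000000000000000000000000000000000000000000000000000000000000000000000000000000000000000000000000000000000000000000000000000000000000000000000000000000000000000000000000000000000000000000000000000000000000000000000000000000000000000000000000000000000000000000000000000000000000000000000000000000000000000000000000000000000000000000000000000000000000000000000000000000000000000000000000000000000000000000000000000000000000000000000000000000000000,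
  0x40000800020000ffff80000000000000000000000000000000001000040001ffff000000000000000000000000000000000040001ffff00000000000000000000000000000000007fffc0000000000000000000000000000000001ffffffffffffffffffffffffffffffffff0000000000000000000000000000000000000000000000000000000000000000000000000000000000000000000000000000000000000000000000000000000000000000000000000000000000000000000000000000002000080003fffe000000000000000000000000000000000080003fffe0000000000000000000000000000000000ffff80000000000000000000000000000000003fffffffffffffffffffffffffffffffffe00000000000000000000000000000000000000000000000000000000000000000000000000000000000000000000000000000000000000000000000000000000000000000000000000000000000000000000000000000080003fffe0000000000000000000000000000000000ffff80000000000000000000000000000000003fffffffffffffffffffffffffffffffffe000000000000000000000000000000000000000000000000000000000000000000000000000000000000000000000000000000000000000000000000000000000000000000000000000000000000000000000000000000ffff80000000000000000000000000000000003fffffffffffffffffffffffffffffffffe000000000000000000000000000000000000000000000000000000000000000000000000000000000000000000000000000000000000000000000000000000000000000000000000000000000000000000000000000000ffffffffffffffffffffffffffffffffff8000000000000000000000000000000000000000000000000000000000000000000000000000000000000000000000000000000000000000000000000000000000000000000000000000000000000000000000000000003ffffffffffffffffffffffffffffffffffffffffffffffffffffffffffffffffffffffffffffffffffffffffffffffff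fffffffffffffffffffffffffffffffffffffffffffffffffffffffffffffffffffffffffffffe00000000000000000000000000000000000000000000000000000000000000000000000000000000000000000000000000000000000000000000000000000000000000000000000000000000000000000000000000000000000000000000000000000000000000000000000000000000000000000000000000000000000000000000000000000000000000000000000000000000000000000000000000000000000000000000000000000000000000000000000000000000000000000000000000000000000000000000000000000000000000000000000000000000000000000000000000000000000000000000000000000000000000000000000000000000000000000000000000000000000000000000000000000000000000000000000000000000000000000000000000000000000000000000000000000,
  0x2000040001000080007fff80000000000000000000000000000008000200010000ffff000000000000000000000000000000200010000ffff00000000000000000000000000000040003fffc000000000000000000000000000001fffe000000000000000000000000000000ffffffffffffffffffffffffffffff80000000000000000000000000000000000000000000000000000000000000000000000000000000000000000000000000000000000000000000000000000000000000000000000010000400020001fffe000000000000000000000000000000400020001fffe00000000000000000000000000000080007fff8000000000000000000000000000003fffc000000000000000000000000000001ffffffffffffffffffffffffffffff000000000000000000000000000000000000000000000000000000000000000000000000000000000000000000000000000000000000000000000000000000000000000000000000400020001fffe00000000000000000000000000000080007fff8000000000000000000000000000003fffc000000000000000000000000000001ffffffffffffffffffffffffffffff0000000000000000000000000000000000000000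0000000000000000000000000000000000000000000000000000000000000000000000000000000000000000000000000000000080007fff8000000000000000000000000000003fffc000000000000000000000000000001ffffffffffffffffffffffffffffff000000000000000000000000000000000000000000000000000000000000000000000000000000000000000000000000000000000000000000000000000000000000000000000000ffff0000000000000000000000000000007fffffffffffffffffffffffffffffc000000000000000000000000000000000000000000000000000000000000000000000000000000000000000000000000000000000000000000000000000000000000000000000003fffffffffffffffffffffffffffffe000000000000000000000000000000000000000000000000000000000000000000000000000000000000000000000000000000000000000000000000000000000000000000000001fffffffffffffffffffffffffffffffffffffffffffffffffffffffffffffffffffffffffffffffffffffffffffffffffffffffffffffffffffffffffffffffffffffffffffffffe00000000000000000000000000000000000000000000000000000000000000000000000000000000000000000000000000000000000000000000000000000000000000000000000000000000000000000000000000000000000000000000000000000000000000000000000000000000000000000000000000000000000000000000000000000000000000000000000000000000000000000000000000000000000000000000000000000000000000000000000000000000000000000000000000000000000000000000000000000000000000000000000000000000000000000000000000000000000000000000000000000,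
  0x10000200008000400040007fff00000000000000000000000000040001000080008000fffe000000000000000000000000001000080008000fffe00000000000000000000000000200020003fff8000000000000000000000000010001fffc00000000000000000000000000fffe000000000000000000000000007fffffffffffffffffffffffffe000000000000000000000000000000000000000000000000000000000000000000000000000000000000000000000000000000000000000000000080002000100010001fffc000000000000000000000000002000100010001fffc00000000000000000000000000400040007fff0000000000000000000000000020003fff800000000000000000000000001fffc00000000000000000000000000ffffffffffffffffffffffffffc0000000000000000000000000000000000000000000000000000000000000000000000000000000000000000000000000000000000000000000002000100010001fffc00000000000000000000000000400040007fff0000000000000000000000000020003fff800000000000000000000000001fffc00000000000000000000000000ffffffffffffffffffffffffffc000000000000000000000000000000000000000000000000000000000000000000000000000000000000000000000000000000000000000000000400040007fff0000000000000000000000000020003fff800000000000000000000000001fffc00000000000000000000000000ffffffffffffffffffffffffffc0000000000000000000000000000000000000000000000000000000000000000000000000000000000000000000000000000000000000000000008000fffe000000000000000000000000007fff000000000000000000000000003ffffffffffffffffffffffffff0000000000000000000000000000000000000000000000000000000000000000000000000000000000000000000000000000000000000000000003fff800000000000000000000000001ffffffffffffffffffffffffff8000000000000000000000000000000000000000000000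000000000000000000000000000000000000000000000000000000000000000000000001ffffffffffffffffffffffffff8000000000000000000000000000000000000000000000000000000000000000000000000000000000000000000000000000000000000000000001fffffffffffffffffffffffffffffffffffffffffffffffffffffffffffffffffffffffffffffffffffffffffffffffffffffffffffffffffffff80000000000000000000000000000000000000000000000000000000000000000000000000000000000000000000000000000000000000000000000000000000000000000000000000000000000000000000000000000000000000000000000000000000000000000000000000000000000000000000000000000000000000000000000000000000000000000000000000000000000000000000000000000000000000000000000000000000000000000000000000000000,
  0x8000100004000200020004000fffc00000000000000000000000200008000400040008001fff8000000000000000000000008000400040008001fff800000000000000000000001000100020007ffe0000000000000000000000080010003fff000000000000000000000008001fff800000000000000000000007ffe00000000000000000000001ffffffffffffffffffffffe00000000000000000000000000000000000000000000000000000000000000000000000000000000000000000000000400010000800080010003fff0000000000000000000000010000800080010003fff00000000000000000000000200020004000fffc0000000000000000000000100020007ffe000000000000000000000010003fff00000000000000000000000fffc00000000000000000000003ffffffffffffffffffffffc000000000000000000000000000000000000000000000000000000000000000000000000000000000000000000000010000800080010003fff00000000000000000000000200020004000fffc0000000000000000000000100020007ffe000000000000000000000010003fff00000000000000000000000fffc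00000000000000000000003ffffffffffffffffffffffc0000000000000000000000000000000000000000000000000000000000000000000000000000000000000000000000200020004000fffc0000000000000000000000100020007ffe000000000000000000000010003fff00000000000000000000000fffc00000000000000000000003ffffffffffffffffffffffc000000000000000000000000000000000000000000000000000000000000000000000000000000000000000000000040008001fff800000000000000000000004000fffc00000000000000000000003fff00000000000000000000000fffffffffffffffffffffff000000000000000000000000000000000000000000000000000000000000000000000000000000000000000000000020007ffe00000000000000000000001fff800000000000000000000007ffffffffffffffffffffff80000000000000000000000000000000000000000000000000000000000000000000000000000000000000000000001fff800000000000000000000007ffffffffffffffffffffff80000000000000000000000000000000000000000000000000000000000000000000000000000000000000000000001ffffffffffffffffffffffe00000000000000000000000000000000000000000000000000000000000000000000000000000000000000000000007fffffffffffffffffffffffffffffffffffffffffffffffffffffffffffffffffffffffffffffffffffffffffffffe000000000000000000000000000000000000000000000000000000000000000000000000000000000000000000000000000000000000000000000000000000000000000000000000000000000000000000000000000000000000000000000000000000000000000000000000000000000000000000000000000000000000000000000000000000000,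
  0x40000800020001000100020008003ffe000000000000000000001000040002000200040010007ffc0000000000000000000040002000200040010007ffc00000000000000000000800080010004001fff0000000000000000000040008002000fff8000000000000000000040010007ffc00000000000000000004001fff00000000000000000001fff00000000000000000001fffffffffffffffffffc000000000000000000000000000000000000000000000000000000000000000000000000000200008000400040008002000fff8000000000000000000008000400040008002000fff800000000000000000001000100020008003ffe0000000000000000000080010004001fff000000000000000000008002000fff800000000000000000008003ffe00000000000000000003ffe00000000000000000003fffffffffffffffffff80000000000000000000000000000000000000000000000000000000000000000000000000008000400040008002000fff800000000000000000001000100020008003ffe0000000000000000000080010004001fff000000000000000000008002000fff800000000000000000008003ffe00000000000000000003ffe00000000000000000003fffffffffffffffffff8000000000000000000000000000000000000000000000000000000000000000000000000001000100020008003ffe0000000000000000000080010004001fff000000000000000000008002000fff800000000000000000008003ffe00000000000000000003ffe00000000000000000003fffffffffffffffffff800000000000000000000000000000000000000000000000000000000000000000000000000200040010007ffc000000000000000000020008003ffe00000000000000000002000fff80000000000000000000fff80000000000000000000fffffffffffffffffffe0000000000000000000000000000000000000000000000000000000000000000000000000010004001fff000000000000000000010007ffc00000000000000000007ffc0000000000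0000000007fffffffffffffffffff0000000000000000000000000000000000000000000000000000000000000000000000000010007ffc00000000000000000007ffc00000000000000000007fffffffffffffffffff000000000000000000000000000000000000000000000000000000000000000000000000001fff00000000000000000001fffffffffffffffffffc000000000000000000000000000000000000000000000000000000000000000000000000007fffffffffffffffffff000000000000000000000000000000000000000000000000000000000000000000000000001ffffffffffffffffffffffffffffffffffffffffffffffffffffffffffffffffffffffffffc000000000000000000000000000000000000000000000000000000000000000000000000000000000000000000000000000000000000000000000000000000000000000000000000000000000000000000000000000000000000000000000000000000,
  0x20000400010000800080010004002001ffe000000000000000000800020001000100020008004003ffc0000000000000000020001000100020008004003ffc00000000000000000400040008002001000fff00000000000000000200040010008007ff8000000000000000020008004003ffc00000000000000002001000fff00000000000000001000fff00000000000000001ffe00000000000000003ffffffffffffffff800000000000000000000000000000000000000000000000000000000001000040002000200040010008007ff80000000000000000040002000200040010008007ff800000000000000000800080010004002001ffe0000000000000000040008002001000fff0000000000000000040010008007ff800000000000000004002001ffe00000000000000002001ffe00000000000000003ffc00000000000000007ffffffffffffffff0000000000000000000000000000000000000000000000000000000000040002000200040010008007ff800000000000000000800080010004002001ffe0000000000000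000040008002001000fff0000000000000000040010008007ff800000000000000004002001ffe00000000000000002001ffe00000000000000003ffc00000000000000007ffffffffffffffff00000000000000000000000000000000000000000000000000000000000800080010004002001ffe0000000000000000040008002001000fff0000000000000000040010008007ff800000000000000004002001ffe00000000000000002001ffe00000000000000003ffc00000000000000007ffffffffffffffff0000000000000000000000000000000000000000000000000000000000100020008004003ffc000000000000000010004002001ffe000000000000000010008007ff800000000000000008007ff80000000000000000fff00000000000000001ffffffffffffffffc00000000000000000000000000000000000000000000000000000000008002001000fff000000000000000008004003ffc00000000000000004003ffc00000000000000007ff80000000000000000ffffffffffffffffe00000000000000000000000000000000000000000000000000000000008004003ffc00000000000000004003ffc00000000000000007ff80000000000000000ffffffffffffffffe0000000000000000000000000000000000000000000000000000000001000fff00000000000000001ffe00000000000000003ffffffffffffffff80000000000000000000000000000000000000000000000000000000007ff80000000000000000ffffffffffffffffe0000000000000000000000000000000000000000000000000000000001ffffffffffffffffc0000000000000000000000000000000000000000000000000000000003fffffffffffffffffffffffffffffffffffffffffffffffffffffffffc00000000000000000000000000000000000000000000000000000000000000000000000000000000000000000000000000000000000000000000000000000000000000000000,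
  0x10000200008000400040008002001001001ffc000000000000000400010000800080010004002002003ff80000000000000010000800080010004002002003ff800000000000000200020004001000800800ffe00000000000000100020008004004007ff0000000000000010004002002003ff800000000000001000800800ffe00000000000000800800ffe00000000000001001ffc00000000000003ff800000000000007fffffffffffff8000000000000000000000000000000000000000000000800020001000100020008004004007ff00000000000000020001000100020008004004007ff000000000000000400040008002001001001ffc0000000000000020004001000800800ffe0000000000000020008004004007ff000000000000002001001001ffc00000000000001001001ffc00000000000002003ff800000000000007ff00000000000000ffffffffffffff00000000000000000000000000000000000000000000020001000100020008004004007ff000000000000000400040008002001001001ffc0000000000000020004001000800800ffe0000000000000020008004004007ff000000000000002001001001ffc00000000000001001001ffc00000000000002003ff800000000000007ff00000000000000ffffffffffffff000000000000000000000000000000000000000000000400040008002001001001ffc0000000000000020004001000800800ffe0000000000000020008004004007ff000000000000002001001001ffc00000000000001001001ffc00000000000002003ff800000000000007ff00000000000000ffffffffffffff00000000000000000000000000000000000000000000080010004002002003ff8000000000000008002001001001ffc000000000000008004004007ff000000000000004004007ff00000000000000800ffe00000000000001ffc00000000000003fffffffffffffc000000000000000000000000000000000000000000004001000800800ffe0000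00000000004002002003ff800000000000002002003ff800000000000004007ff00000000000000ffe00000000000001fffffffffffffe000000000000000000000000000000000000000000004002002003ff800000000000002002003ff800000000000004007ff00000000000000ffe00000000000001fffffffffffffe00000000000000000000000000000000000000000000800800ffe00000000000001001ffc00000000000003ff800000000000007fffffffffffff800000000000000000000000000000000000000000004007ff00000000000000ffe00000000000001fffffffffffffe00000000000000000000000000000000000000000001ffc00000000000003fffffffffffffc00000000000000000000000000000000000000000003fffffffffffffc00000000000000000000000000000000000000000003fffffffffffffffffffffffffffffffffffffffffffc000000000000000000000000000000000000000000000000000000000000000000000000000000000000000000000000,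
  0x8000100004000200020004001000800801003ff0000000000000200008000400040008002001001002007fe00000000000008000400040008002001001002007fe000000000000100010002000800400400801ff80000000000008001000400200200400ffc0000000000008002001001002007fe000000000000800400400801ff800000000000400400801ff800000000000801003ff000000000002007fe000000000007fe000000000007ffffffffffe000000000000000000000000000000000040001000080008001000400200200400ffc0000000000001000080008001000400200200400ffc000000000000200020004001000800801003ff00000000000010002000800400400801ff8000000000001000400200200400ffc000000000001000800801003ff000000000000800801003ff000000000001002007fe00000000000400ffc00000000000ffc00000000000fffffffffffc0000000000000000000000000000000001000080008001000400200200400ffc000000000000200020004001000800801003ff00000000000010002000800400400801ff8000000000001000400200200400ffc000000000001000800801003ff000000000000800801003ff000000000001002007fe00000000000400ffc00000000000ffc00000000000fffffffffffc000000000000000000000000000000000200020004001000800801003ff00000000000010002000800400400801ff8000000000001000400200200400ffc000000000001000800801003ff000000000000800801003ff000000000001002007fe00000000000400ffc00000000000ffc00000000000fffffffffffc00000000000000000000000000000000040008002001001002007fe0000000000004001000800801003ff000000000000400200200400ffc00000000000200200400ffc00000000000400801ff800000000001003ff000000000003ff000000000003fffffffffff0000000000000000000000000000000002000800400400801ff8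000000000002001001002007fe000000000001001002007fe00000000000200400ffc00000000000801ff800000000001ff800000000001fffffffffff8000000000000000000000000000000002001001002007fe000000000001001002007fe00000000000200400ffc00000000000801ff800000000001ff800000000001fffffffffff800000000000000000000000000000000400400801ff800000000000801003ff000000000002007fe000000000007fe000000000007ffffffffffe00000000000000000000000000000000200400ffc00000000000801ff800000000001ff800000000001fffffffffff800000000000000000000000000000001003ff000000000003ff000000000003fffffffffff000000000000000000000000000000003ff000000000003fffffffffff000000000000000000000000000000003fffffffffff000000000000000000000000000000003ffffffffffffffffffffffffffffffff0000000000000000000000000000000000000000000000000000000000000000,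
  0x400008000200010001000200080040040080200ff8000000000010000400020002000400100080080100401ff00000000000400020002000400100080080100401ff0000000000080008001000400200200401007fc00000000004000800200100100200803fe0000000000400100080080100401ff0000000000400200200401007fc000000000200200401007fc00000000040080200ff800000000100401ff000000000401ff0000000007fc000000001fffffffff000000000000000000000000020000800040004000800200100100200803fe00000000000800040004000800200100100200803fe000000000010001000200080040040080200ff800000000008001000400200200401007fc0000000000800200100100200803fe000000000080040040080200ff800000000040040080200ff800000000080100401ff000000000200803fe000000000803fe000000000ff8000000003ffffffffe0000000000000000000000000800040004000800200100100200803fe000000000010001000200080040040080200ff800000000008001000400200200401007fc0000000000800200100100200803fe000000000080040040080200ff800000000040040080200ff800000000080100401ff000000000200803fe000000000803fe000000000ff8000000003ffffffffe00000000000000000000000010001000200080040040080200ff800000000008001000400200200401007fc0000000000800200100100200803fe000000000080040040080200ff800000000040040080200ff800000000080100401ff000000000200803fe000000000803fe000000000ff8000000003ffffffffe0000000000000000000000002000400100080080100401ff0000000000200080040040080200ff8000000000200100100200803fe000000000100100200803fe000000000200401007fc00000000080200ff800000000200ff8000000003fe000000000fffffffff8000000000000000000000001000400200200401007fc0000000001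00080080100401ff000000000080080100401ff000000000100200803fe000000000401007fc000000001007fc000000001ff0000000007ffffffffc00000000000000000000000100080080100401ff000000000080080100401ff000000000100200803fe000000000401007fc000000001007fc000000001ff0000000007ffffffffc00000000000000000000000200200401007fc00000000040080200ff800000000100401ff000000000401ff0000000007fc000000001fffffffff00000000000000000000000100200803fe000000000401007fc000000001007fc000000001ff0000000007ffffffffc0000000000000000000000080200ff800000000200ff8000000003fe000000000fffffffff80000000000000000000000200ff8000000003fe000000000fffffffff800000000000000000000003fe000000000fffffffff800000000000000000000003ffffffffe00000000000000000000000fffffffffffffffffffffff80000000000000000000000000000000000000000,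
  0x200004000100008000800100040020020040100807f8000000000800020001000100020008004004008020100ff00000000020001000100020008004004008020100ff0000000004000400080020010010020080403fc00000000200040010008008010040201fe0000000020008004004008020100ff0000000020010010020080403fc000000010010020080403fc000000020040100807f800000008020100ff000000020100ff0000000403fc0000001fe0000000fffffff8000000000000000001000040002000200040010008008010040201fe00000000040002000200040010008008010040201fe0000000008000800100040020020040100807f800000000400080020010010020080403fc0000000040010008008010040201fe0000000040020020040100807f8000000020020040100807f800000004008020100ff000000010040201fe000000040201fe0000000807f80000003fc0000001fffffff00000000000000000040002000200040010008008010040201fe0000000008000800100040020020040100807f800000000400080020010010020080403fc0000000040010008008010040201fe0000000040020020040100807f8000000020020040100807f800000004008020100ff000000010040201fe000000040201fe0000000807f80000003fc0000001fffffff0000000000000000008000800100040020020040100807f800000000400080020010010020080403fc0000000040010008008010040201fe0000000040020020040100807f8000000020020040100807f800000004008020100ff000000010040201fe000000040201fe0000000807f80000003fc0000001fffffff00000000000000000100020008004004008020100ff00000000100040020020040100807f8000000010008008010040201fe000000008008010040201fe000000010020080403fc000000040100807f8000000100807f8000000201fe0000000ff00000007ffffffc0000000000000000080020010010020080403fc0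00000008004004008020100ff000000004004008020100ff000000008010040201fe000000020080403fc000000080403fc000000100ff00000007f80000003ffffffe000000000000000008004004008020100ff000000004004008020100ff000000008010040201fe000000020080403fc000000080403fc000000100ff00000007f80000003ffffffe000000000000000010010020080403fc000000020040100807f800000008020100ff000000020100ff0000000403fc0000001fe0000000fffffff800000000000000008010040201fe000000020080403fc000000080403fc000000100ff00000007f80000003ffffffe000000000000000040100807f8000000100807f8000000201fe0000000ff00000007ffffffc000000000000000100807f8000000201fe0000000ff00000007ffffffc000000000000000201fe0000000ff00000007ffffffc0000000000000003fc0000001fffffff0000000000000000fffffff80000000000000007fffffffffffffff8000000000000000000000000,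
  0x10000200008000400040008002001001002008040407f0000000040001000080008001000400200200401008080fe00000001000080008001000400200200401008080fe0000000200020004001000800801004020203f800000010002000800400400802010101fc0000001000400200200401008080fe0000001000800801004020203f8000000800801004020203f8000001002008040407f000000401008080fe000001008080fe0000020203f80000101fc00000fe000007ffffe000000000000080002000100010002000800400400802010101fc00000002000100010002000800400400802010101fc0000000400040008002001001002008040407f000000020004001000800801004020203f80000002000800400400802010101fc0000002001001002008040407f0000001001002008040407f000000200401008080fe000000802010101fc000002010101fc0000040407f00000203f800001fc00000fffffc0000000000002000100010002000800400400802010101fc0000000400040008002001001002008040407f000000020004001000800801004020203f80000002000800400400802010101fc0000002001001002008040407f0000001001002008040407f000000200401008080fe000000802010101fc000002010101fc0000040407f00000203f800001fc00000fffffc000000000000400040008002001001002008040407f000000020004001000800801004020203f80000002000800400400802010101fc0000002001001002008040407f0000001001002008040407f000000200401008080fe000000802010101fc000002010101fc0000040407f00000203f800001fc00000fffffc0000000000008001000400200200401008080fe00000008002001001002008040407f0000000800400400802010101fc000000400400802010101fc000000801004020203f8000002008040407f0000008040407f0000010101fc0000080fe000007f000003fffff0000000000004001000800801004020203f8000000400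200200401008080fe000000200200401008080fe000000400802010101fc000001004020203f8000004020203f8000008080fe00000407f000003f800001fffff800000000000400200200401008080fe000000200200401008080fe000000400802010101fc000001004020203f8000004020203f8000008080fe00000407f000003f800001fffff800000000000800801004020203f8000001002008040407f000000401008080fe000001008080fe0000020203f80000101fc00000fe000007ffffe00000000000400802010101fc000001004020203f8000004020203f8000008080fe00000407f000003f800001fffff800000000002008040407f0000008040407f0000010101fc0000080fe000007f000003fffff000000000008040407f0000010101fc0000080fe000007f000003fffff000000000010101fc0000080fe000007f000003fffff0000000000203f800001fc00000fffffc0000000000fe000007ffffe00000000007ffffe00000000007fffffffffe00000000000000,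
  0x80001000040002000200040010008008010040202040fc0000002000080004000400080020010010020080404081f800000080004000400080020010010020080404081f80000010001000200080040040080201010207e000000800100040020020040100808103f00000080020010010020080404081f80000080040040080201010207e0000040040080201010207e000008010040202040fc000020080404081f8000080404081f80001010207e00008103f000081f80007e0001fffe0000000004000100008000800100040020020040100808103f000000100008000800100040020020040100808103f0000002000200040010008008010040202040fc000001000200080040040080201010207e00000100040020020040100808103f0000010008008010040202040fc000008008010040202040fc000010020080404081f8000040100808103f0000100808103f0000202040fc00010207e000103f0000fc0003fffc00000000100008000800100040020020040100808103f0000002000200040010008008010040202040fc000001000200080040040080201010207e00000100040020020040100808103f0000010008008010040202040fc000008008010040202040fc000010020080404081f8000040100808103f0000100808103f0000202040fc00010207e000103f0000fc0003fffc000000002000200040010008008010040202040fc000001000200080040040080201010207e00000100040020020040100808103f0000010008008010040202040fc000008008010040202040fc000010020080404081f8000040100808103f0000100808103f0000202040fc00010207e000103f0000fc0003fffc00000000400080020010010020080404081f80000040010008008010040202040fc0000040020020040100808103f0000020020040100808103f0000040080201010207e000010040202040fc000040202040fc0000808103f00004081f800040fc0003f0000ffff00000000200080040040080201010207e0000020010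010020080404081f8000010010020080404081f8000020040100808103f0000080201010207e0000201010207e0000404081f80002040fc000207e0001f80007fff8000000020010010020080404081f8000010010020080404081f8000020040100808103f0000080201010207e0000201010207e0000404081f80002040fc000207e0001f80007fff8000000040040080201010207e000008010040202040fc000020080404081f8000080404081f80001010207e00008103f000081f80007e0001fffe000000020040100808103f0000080201010207e0000201010207e0000404081f80002040fc000207e0001f80007fff800000010040202040fc000040202040fc0000808103f00004081f800040fc0003f0000ffff000000040202040fc0000808103f00004081f800040fc0003f0000ffff0000000808103f00004081f800040fc0003f0000ffff00000010207e000103f0000fc0003fffc00000081f80007e0001fffe0000007e0001fffe0000007fff8000001ffffff80000000,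
  0x4000080002000100010002000800400400802010102083e00000100004000200020004001000800801004020204107c000004000200020004001000800801004020204107c0000080008001000400200200401008081041f000004000800200100100200804040820f800004001000800801004020204107c0000400200200401008081041f0000200200401008081041f0000400802010102083e0001004020204107c0004020204107c0008081041f00040820f8004107c0041f001f001ffc00000020000800040004000800200100100200804040820f800000800040004000800200100100200804040820f80000100010002000800400400802010102083e000008001000400200200401008081041f00000800200100100200804040820f80000800400400802010102083e0000400400802010102083e0000801004020204107c000200804040820f8000804040820f80010102083e00081041f000820f80083e003e003ff8000000800040004000800200100100200804040820f80000100010002000800400400802010102083e000008001000400200200401008081041f00000800200100100200804040820f80000800400400802010102083e0000400400802010102083e0000801004020204107c000200804040820f8000804040820f80010102083e00081041f000820f80083e003e003ff800000100010002000800400400802010102083e000008001000400200200401008081041f00000800200100100200804040820f80000800400400802010102083e0000400400802010102083e0000801004020204107c000200804040820f8000804040820f80010102083e00081041f000820f80083e003e003ff80000020004001000800801004020204107c00002000800400400802010102083e0000200100100200804040820f8000100100200804040820f8000200401008081041f0000802010102083e0002010102083e0004040820f800204107c002083e0020f800f800ffe000001000400200200401008081041f00001000800801004020204107c0000800801004020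204107c000100200804040820f8000401008081041f0001008081041f00020204107c00102083e001041f00107c007c007ff000001000800801004020204107c0000800801004020204107c000100200804040820f8000401008081041f0001008081041f00020204107c00102083e001041f00107c007c007ff00000200200401008081041f0000400802010102083e0001004020204107c0004020204107c0008081041f00040820f8004107c0041f001f001ffc0000100200804040820f8000401008081041f0001008081041f00020204107c00102083e001041f00107c007c007ff00000802010102083e0002010102083e0004040820f800204107c002083e0020f800f800ffe00002010102083e0004040820f800204107c002083e0020f800f800ffe00004040820f800204107c002083e0020f800f800ffe000081041f000820f80083e003e003ff80004107c0041f001f001ffc00041f001f001ffc0007c007ff0001ffc0007fff0000,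
  0x20000400010000800080010004002002004010080810421e00000800020001000100020008004004008020101020843c000020001000100020008004004008020101020843c0000400040008002001001002008040408210f0000200040010008008010040202041087800020008004004008020101020843c0002001001002008040408210f0001001002008040408210f0002004010080810421e0008020101020843c0020101020843c0040408210f0020410878020843c0210f010f01e03f800001000040002000200040010008008010040202041087800004000200020004001000800801004020204108780000800080010004002002004010080810421e000040008002001001002008040408210f00004001000800801004020204108780004002002004010080810421e0002002004010080810421e0004008020101020843c00100402020410878004020204108780080810421e00408210f004108780421e021e03c07f000004000200020004001000800801004020204108780000800080010004002002004010080810421e000040008002001001002008040408210f00004001000800801004020204108780004002002004010080810421e0002002004010080810421e0004008020101020843c00100402020410878004020204108780080810421e00408210f004108780421e021e03c07f00000800080010004002002004010080810421e000040008002001001002008040408210f00004001000800801004020204108780004002002004010080810421e0002002004010080810421e0004008020101020843c00100402020410878004020204108780080810421e00408210f004108780421e021e03c07f0000100020008004004008020101020843c00010004002002004010080810421e00010008008010040202041087800080080100402020410878001002008040408210f0004010080810421e0010080810421e00202041087801020843c010421e01087808780f01fc00008002001001002008040408210f00008004004008020101020843c0004004008020101020843c00080100402020410878002008040408210f0008040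408210f00101020843c00810421e008210f00843c043c0780fe00008004004008020101020843c0004004008020101020843c00080100402020410878002008040408210f0008040408210f00101020843c00810421e008210f00843c043c0780fe0001001002008040408210f0002004010080810421e0008020101020843c0020101020843c0040408210f0020410878020843c0210f010f01e03f800080100402020410878002008040408210f0008040408210f00101020843c00810421e008210f00843c043c0780fe0004010080810421e0010080810421e00202041087801020843c010421e01087808780f01fc0010080810421e00202041087801020843c010421e01087808780f01fc00202041087801020843c010421e01087808780f01fc00408210f004108780421e021e03c07f0020843c0210f010f01e03f80210f010f01e03f8043c0780fe01e03f807f00ff00,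
  0x100002000080004000400080020010010020080404082111c00004000100008000800100040020020040100808104223800010000800080010004002002004010080810422380002000200040010008008010040202041088e000100020008004004008020101020844700010004002002004010080810422380010008008010040202041088e0008008010040202041088e0010020080404082111c00401008081042238010080810422380202041088e010208447010422381088e088e11c387800008000200010001000200080040040080201010208447000020001000100020008004004008020101020844700004000400080020010010020080404082111c000200040010008008010040202041088e00020008004004008020101020844700020010010020080404082111c0010010020080404082111c0020040100808104223800802010102084470020101020844700404082111c02041088e020844702111c111c23870f000020001000100020008004004008020101020844700004000400080020010010020080404082111c000200040010008008010040202041088e00020008004004008020101020844700020010010020080404082111c0010010020080404082111c0020040100808104223800802010102084470020101020844700404082111c02041088e020844702111c111c23870f00004000400080020010010020080404082111c000200040010008008010040202041088e00020008004004008020101020844700020010010020080404082111c0010010020080404082111c0020040100808104223800802010102084470020101020844700404082111c02041088e020844702111c111c23870f0000800100040020020040100808104223800080020010010020080404082111c00080040040080201010208447000400400802010102084470008010040202041088e0020080404082111c0080404082111c010102084470081042238082111c08447044708e1c3c00040010008008010040202041088e0004002002004010080810422380020020040100808104223800400802010102084470010040202041088e0040202041088e00808104223804082111c041088e0422382238470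e1e0004002002004010080810422380020020040100808104223800400802010102084470010040202041088e0040202041088e00808104223804082111c041088e0422382238470e1e0008008010040202041088e0010020080404082111c00401008081042238010080810422380202041088e010208447010422381088e088e11c387800400802010102084470010040202041088e0040202041088e00808104223804082111c041088e0422382238470e1e0020080404082111c0080404082111c010102084470081042238082111c08447044708e1c3c0080404082111c010102084470081042238082111c08447044708e1c3c010102084470081042238082111c08447044708e1c3c02041088e020844702111c111c23870f010422381088e088e11c38781088e088e11c38782238470e1e11c387870f0f0f0,
  0x8000100004000200020004001000800801004020204108930000200008000400040008002001001002008040408211260000800040004000800200100100200804040821126000100010002000800400400802010102084498000800100040020020040100808104224c000800200100100200804040821126000800400400802010102084498004004008020101020844980080100402020410893002008040408211260080404082112601010208449808104224c0821126084498449893266600004000100008000800100040020020040100808104224c000100008000800100040020020040100808104224c000200020004001000800801004020204108930001000200080040040080201010208449800100040020020040100808104224c0010008008010040202041089300080080100402020410893001002008040408211260040100808104224c0100808104224c020204108930102084498104224c1089308931264ccc000100008000800100040020020040100808104224c000200020004001000800801004020204108930001000200080040040080201010208449800100040020020040100808104224c0010008008010040202041089300080080100402020410893001002008040408211260040100808104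224c0100808104224c020204108930102084498104224c1089308931264ccc000200020004001000800801004020204108930001000200080040040080201010208449800100040020020040100808104224c0010008008010040202041089300080080100402020410893001002008040408211260040100808104224c0100808104224c020204108930102084498104224c1089308931264ccc000400080020010010020080404082112600040010008008010040202041089300040020020040100808104224c0020020040100808104224c0040080201010208449801004020204108930040202041089300808104224c040821126041089304224c224c499333000200080040040080201010208449800200100100200804040821126001001002008040408211260020040100808104224c0080201010208449802010102084498040408211260204108930208449821126112624c999800200100100200804040821126001001002008040408211260020040100808104224c0080201010208449802010102084498040408211260204108930208449821126112624c9998004004008020101020844980080100402020410893002008040408211260080404082112601010208449808104224c082112608449844989326660020040100808104224c0080201010208449802010102084498040408211260204108930208449821126112624c999801004020204108930040202041089300808104224c040821126041089304224c224c4993330040202041089300808104224c040821126041089304224c224c49933300808104224c040821126041089304224c224c4993330102084498104224c1089308931264ccc082112608449844989326660844984498932666112624c99989326664ccccccc,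
  0x40000800020001000100020008004004008020101020844a8000100004000200020004001000800801004020204108950000400020002000400100080080100402020410895000080008001000400200200401008081042254000400080020010010020080404082112a00040010008008010040202041089500040020020040100808104225400200200401008081042254004008020101020844a801004020204108950040202041089500808104225404082112a041089504225422544a955500002000080004000400080020010010020080404082112a000080004000400080020010010020080404082112a0001000100020008004004008020101020844a8000800100040020020040100808104225400080020010010020080404082112a0008004004008020101020844a8004004008020101020844a800801004020204108950020080404082112a0080404082112a0101020844a8081042254082112a0844a844a8952aaa000080004000400080020010010020080404082112a0001000100020008004004008020101020844a8000800100040020020040100808104225400080020010010020080404082112a0008004004008020101020844a8004004008020101020844a800801004020204108950020080404082112a0080404082112a0101020844a8081042254082112a0844a844a8952aaa0001000100020008004004008020101020844a8000800100040020020040100808104225400080020010010020080404082112a0008004004008020101020844a8004004008020101020844a800801004020204108950020080404082112a0080404082112a0101020844a8081042254082112a0844a844a8952aaa000200040010008008010040202041089500020008004004008020101020844a80020010010020080404082112a0010010020080404082112a00200401008081042254008020101020844a8020101020844a80404082112a020410895020844a82112a112a254aaa800100040020020040100808104225400100080080100402020410895000800801004020204108950010020080404082112a0040100808104225401008081042254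0202041089501020844a8104225410895089512a555400100080080100402020410895000800801004020204108950010020080404082112a00401008081042254010080810422540202041089501020844a8104225410895089512a555400200200401008081042254004008020101020844a801004020204108950040202041089500808104225404082112a041089504225422544a95550010020080404082112a00401008081042254010080810422540202041089501020844a8104225410895089512a5554008020101020844a8020101020844a80404082112a020410895020844a82112a112a254aaa8020101020844a80404082112a020410895020844a82112a112a254aaa80404082112a020410895020844a82112a112a254aaa8081042254082112a0844a844a8952aaa041089504225422544a955504225422544a9555089512a55544a95552aaaaaaa]

/-- Batch 0 of the codes. -/
def D0 : List Dat := [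
  ⟨[2514300, 1270309, 4049965, 3305624, 3298015, 584478, 2077687, 4102091, 857830, 3352268,
  3536805, 3080486, 1402333, 1604647, 2541251, 1987249, 471259, 3251316, 80953, 3911205, 922692,
  884792], 792671, 57, [15599589654531, 289104986140, 14345190768864, 423322714881, 15654,
  6906307462208, 2766764312640, 3316789477376, 1138169480232, 9434436734976, 12781823852552,
  2233928278026, 2543703032321, 5021090709504, 11841060864, 224428990464, 384399736836,
  4554864230400, 4954244861953, 5772436309138, 146668520000, 8805400184832], 44⟩,
  ⟨[2516827, 502580, 2140942, 330327, 3903542, 1426229, 3141188, 112525, 1593171, 3645391,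
  1351198, 2129451, 1054701, 2829035, 3497207, 620557, 4001923, 179837, 224492, 1918488, 2807208,
  2941172], 762445, 43, [5497558138943, 8796093030336, 566935806017, 352188235906, 2336469573633,
  154627252996, 2963544212488, 1099630182448, 2834679597072, 2233416831056, 8865259192448,
  8799993757728, 10188266406464, 5124974444544, 837518627849, 860872519680, 3352758912000,
  2207667718304, 13470094328322, 15300986884, 6012954476552, 4466919620612], 122⟩,
  ⟨[3509266, 2179721, 3058561, 2628182, 3054280, 3044572, 218302, 4007473, 2723256, 1112555,
  3612571, 233516, 2362282, 3242743, 4147317, 4183681, 2411851, 3383134, 2190718, 3339656,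
  1731262, 1419320], 3461673, 30, [8830452760639, 12249246728640, 6605659708929, 4552665391744,
  9425305797634, 412854714880, 97713653760, 313537007617, 9938562723844, 13830877085696,
  39745626120, 515431464960, 279778951189, 6603109564440, 4960687317248, 3438125516930,
  343874224658, 549978652800, 2202047479816, 1668798251008, 4604742371584, 1143813963808], 200⟩,
  ⟨[1523549, 3484798, 2219432, 3508581, 3809592, 1980775, 1947362, 3112516, 3606495, 1796924,
  2150209, 3753270, 4038203, 4091372, 2582072, 3494842, 1477560, 2845746, 178413, 991669,
  1786019, 1078872], 3180274, 105, [1101122240543, 4406636447712, 9083855837280, 10462540390401,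
  3367254564994, 413927752448, 14295800283168, 214754920450, 4398105329676, 587345297544,
  9081777563648, 351248056352, 8950804644096, 554626452480, 2577248825345, 1100120867336,
  13194140635408, 108884656128, 11687159660560, 2394446364736, 4458176579136, 8265672949888],
  272⟩,
  ⟨[1846271, 3031568, 3298359, 242740, 1888898, 2759305, 2085228, 430965, 3690089, 834824,
  1471082, 557238, 4193336, 3880875, 1486309, 2869452, 2379680, 3283175, 1531122, 2439925,
  1461868, 3288106], 2966136, 46, [4262755041283, 157840048157, 2758442745962, 6950599262336,
  635655163650, 10997800644744, 5639292305408, 12163617652736, 47515439120, 9898293215616,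
  609911046656, 236323897344, 13232795551232, 5498163243008, 1104281077760, 13504182618112,
  1993007563008, 310853500961, 4406771225152, 4605480009920, 23641276432, 17188332810], 278⟩,
  ⟨[3630052, 2982497, 3165309, 4005057, 218302, 2892668, 3187305, 2001678, 3591395, 1800241,
  3377747, 4125940, 1465682, 2362282, 2004040, 2179784, 1685185, 1921940, 4176843, 144383,
  1525710, 2781377], 3957059, 27, [56371445775, 15531138613360, 77309415297, 4544075412352,
  8877697418384, 8800389005568, 2477659291696, 9930504486912, 5777268015170, 199728566272,
  3612068611072, 4486093508624, 11787537743936, 636750006272, 5239960764419, 2200534515968,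
  3848609472513, 4363403844, 207523676162, 14854153306112, 593049421832, 293167726596], 350⟩,
  ⟨[3780509, 3943075, 3211919, 623351, 1816132, 2397823, 1373176, 1314164, 2147791, 2960215,
  3573592, 1298380, 3690556, 1545678, 1905250, 193115, 1478651, 3415198, 4134590, 2674234,
  3528102, 2439566], 1080036, 57, [2272037699615, 2491081032161, 21474868736, 1275605386752,
  11032698159104, 12888178702, 7696588734498, 1471026300992, 5231279640576, 2305323696336,
  8933551186176, 13745002647712, 4408251253253, 8830553449488, 628151681032, 17179871412224,
  8798794696960, 1128368455680, 10171153712160, 5188320526466, 4742260457473, 2358206267396],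
  356⟩,
  ⟨[448746, 2563492, 3186411, 2872244, 773369, 3656306, 203372, 1446628, 1955921, 2221149,
  2234744, 3433183, 1597514, 913274, 1883449, 1043720, 2911312, 3364301, 1853603, 4176196,
  3966378, 44183], 3099900, 306, [8942524563463, 95563022393, 3097208291520, 620085905160,
  3298669164544, 7421971929344, 1649268424770, 13748458824192, 15445776146944, 8970040246339,
  8886427975680, 560493496454, 296361181264, 9357676774404, 2205231874304, 3332980883456,
  5671506413576, 1237688778804, 77447839920, 309578957824, 140157654016, 4690142069120], 422⟩,
  ⟨[1952613, 2106411, 1863227, 3813369, 218302, 2265362, 325090, 3948915, 3327124, 737387,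
  1092305, 3031052, 2602315, 3361893, 2121698, 3757686, 1759112, 1841378, 3764456, 2161982,
  319021, 2892359], 2791173, 141, [6734508720159, 2208955367904, 277159611969, 700079681542,
  6621900046337, 2217142697992, 141868335745, 673236386048, 9405979164674, 13280308461568,
  9346388361732, 8874749854720, 4400487927808, 14293660076052, 618511073488, 5978762248200,
  1555331810304, 3307124830544, 4712686714880, 1099622786304, 831680159872, 9930586195968], 428⟩,
  ⟨[3793283, 852346, 2511376, 240085, 1717261, 602451, 1192238, 326110, 658838, 7644, 3613112,
  3594112, 2058189, 3463243, 3046900, 3834255, 479925, 2129571, 625765, 1695962, 4071224,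
  1495923], 3408882, 30, [2477256605703, 2752033849369, 13400297964000, 1168499555840,
  1159775404545, 4473812419592, 8830788419648, 1933943635968, 85968063488, 1376649792,
  2762203992064, 10103642128512, 10050227961872, 1924708438016, 5227021336577, 4400303316994,
  174348927232, 2886358597696, 55904831504, 2478233886740, 7018530275328, 8994754134016], 434⟩,
  ⟨[3317315, 1562068, 1106776, 1671241, 4016161, 2752188, 2866413, 924617, 323149, 3225659,
  1232692, 3550660, 653380, 3986532, 577936, 1092209, 542515, 1998118, 1901565, 3914402, 248263,
  3010314], 3117078, 46, [5097052438531, 1203127713852, 4674535031236, 2199023271496,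
  4415226495121, 3985730569216, 343598831632, 4690120278016, 9072068263940, 2239875792904,
  5017067112448, 137508204577, 9943386226720, 8831620939776, 9346323056640, 429765730560,
  2228047839424, 1655710957578, 11558293873664, 23892328451, 4512131579910, 1316441031808], 500⟩,
  ⟨[3509268, 857369, 2018896, 195601, 3879666, 1356679, 2774357, 2688583, 3941762, 1143201,
  2988013, 974903, 1506853, 3131246, 1341203, 206292, 1278225, 2302589, 325850, 1582525, 3193480,
  723490], 1086363, 39, [2611340115999, 9917616357473, 2612145422467, 11616275923712,
  1125281463296, 4398315438212, 17183573121, 309506152458, 10101767995392, 11812212000,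
  5262419165184, 4958019657792, 2852936221200, 4677815009280, 9365210537984, 1305671641152,
  13203065012492, 564842725392, 2343984693312, 1155346370592, 11137118781444, 6700285313032],
  506⟩]

theorem D0_chk : D0.all (chk ones22 E22) = true := by decide +kernel

/-- Batch 1 of the codes. -/
def D1 : List Dat := [
  ⟨[741394, 1106776, 3753226, 3029585, 2201723, 3907488, 227519, 1703017, 445601, 3549638,
  1651536, 2289399, 3281147, 4102205, 1379289, 508111, 874788, 3788368, 2342492, 669666, 3098491,
  1348162], 337382, 51, [3350074490895, 8805219827954, 536887056, 2423972184096, 4818953535744,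
  4674002092544, 8836899668996, 5978602881280, 8934086166592, 854740439040, 1170388025478,
  6992987136, 1926293684736, 11008103940128, 2200099250244, 847215894528, 108682809344,
  6055903889944, 2272729767936, 4985400332288, 11029694646272, 154954531848], 512⟩,
  ⟨[575529, 1044102, 360694, 831583, 3341227, 2528063, 3227934, 3527762, 3160769, 2119023,
  2267615, 2372948, 3475731, 3681336, 721337, 1943263, 770504, 1150093, 3245881, 2179923,
  3923900, 1901530], 1801574, 78, [17280532511, 13241988153376, 318163124418, 6634113860416,
  13197763415040, 10307988647936, 2202278264836, 552038334498, 5231271218208, 224949178376,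
  9896681037832, 5657612812288, 2302107795460, 7284300185984, 9414710919256, 4690288837248,
  9423166641168, 1460960493570, 3312225355776, 2204398405632, 8974604697856, 824953540864], 572⟩,
  ⟨[1786072, 2179721, 1863490, 1859083, 2988148, 1868118, 3237286, 4007473, 3416854, 835755,
  1692497, 1800242, 706400, 2078269, 4183681, 4019262, 3732491, 1921940, 900607, 3067080, 414718,
  1419320], 3461921, 90, [9091372023815, 5540507811960, 2220498093953, 6597069830272,
  3027952142592, 35974287360, 380645933312, 561580089344, 318902439952, 706035581440,
  625539022848, 10997297405984, 8869243847696, 14297956630544, 14465449855009, 5510846349312,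
  1237758021633, 283673494018, 2972117500480, 11338848141380, 8985088362562, 2201472992292], 578⟩,
  ⟨[3139406, 3327124, 3031568, 2423303, 4125141, 3516089, 325090, 3710815, 1023559, 1486309,
  2262778, 1336085, 1618443, 2321255, 3641929, 1025137, 1759112, 1841378, 1016559, 1969772,
  1445689, 3288106], 2505506, 45, [14310831030287, 7080253587504, 2791728743360, 2314987373712,
  1178968537089, 8950711900416, 5519033174528, 7011534127392, 8967893615616, 2201202196610,
  11817484801, 190087958532, 554126574600, 13301513789696, 8796294906883, 9964609343508,
  1946694057992, 402677938, 9071391410184, 276832845824, 2757960400928, 585294675972], 584⟩,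
  ⟨[1686154, 3583620, 291099, 93738, 707223, 2472449, 3376746, 2640891, 1764393, 519788, 1156816,
  540216, 2400987, 1367176, 1087165, 3355323, 943981, 146288, 4147572, 1432504, 1716959, 718129],
  2076332, 86, [2199023255679, 11272141669249, 568546298886, 1099511755784, 1531156238336,
  9139694084112, 13340709490690, 9487591145634, 1520980590592, 1107598786560, 13115729,
  4505487835712, 15534896710192, 1151186764808, 132070377472, 9080907767808, 2785320960128,
  1766372409344, 9554157895936, 7146959864868, 2416253441, 4974127876096], 590⟩,
  ⟨[2975127, 3205142, 3666550, 1643626, 3401895, 917203, 1706567, 1631036, 2213293, 2793058,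
  3545804, 624236, 3715290, 1147797, 3917522, 1352887, 3413722, 1493440, 1977771, 40160, 3389057,
  861688], 419931, 45, [292191993887, 4432406251488, 13196555466753, 9918019026944, 13556023394,
  4543270092868, 1185411432577, 11957189542144, 309238336128, 1650612764738, 2201855459332,
  618760524808, 19901977616, 2483720028176, 7225208864776, 3442417410048, 43528488978,
  9191230083076, 283472331528, 13881403507713, 4514011160832, 1581638746240], 620⟩,
  ⟨[376791, 1633749, 704458, 1993354, 326204, 2218406, 22227, 458461, 3622984, 2399919, 3033443,
  1539708, 2764095, 952476, 3846370, 3040217, 3281081, 780778, 1563393, 1663662, 560170,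
  3188895], 242502, 43, [4716410961927, 1073742329, 1155346206210, 11562588860416, 268931592,
  5028332994576, 1101660758064, 8830993432580, 7834586578944, 139859141696, 3590894650496,
  6631704494081, 2349355499809, 1134148715138, 11544922435840, 699609907264, 642098659424,
  4471153231880, 4811739136008, 6053823528976, 9158078235264, 9148352724992], 650⟩,
  ⟨[3733217, 3576587, 2762337, 1372932, 3800699, 3063019, 2908372, 3811432, 2105294, 4141208,
  243187, 1346106, 3085862, 3370490, 840391, 1018436, 3334034, 2053955, 1560352, 581945, 3457727,
  2036459], 3902685, 23, [293131517983, 14379550507232, 8804682960673, 6604585963778,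
  10995116339268, 8924942107144, 2149458178, 9929979069568, 139603656720, 2337538705440,
  4561256317280, 280351474184, 2063867068416, 1805232898048, 2304275644480, 389097201664,
  8796145668096, 5021521412224, 2787574284416, 425201860626, 6050879111168, 588003328], 656⟩,
  ⟨[926063, 2496224, 1016730, 2089505, 1242650, 1734253, 3141188, 2278113, 3150829, 2160911,
  543149, 1995717, 2269989, 3079683, 3839581, 576390, 3340096, 3583441, 3129827, 2824088,
  2987830, 1560242], 3603682, 23, [9006546419727, 8798240506353, 4401267740208, 4458712952832,
  95563255808, 53695217664, 6092419506176, 2203368555090, 3229882548352, 1654099345541,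
  1409152713728, 9689447317508, 34915496196, 10172638691712, 2277544837128, 1512164032771,
  23759298560, 10597294931968, 6743132537344, 13195817273360, 4553739112488, 8247478125568], 662⟩,
  ⟨[4037858, 680837, 92944, 3008918, 2961445, 2749131, 3985289, 3438981, 2602495, 873385, 709122,
  2057574, 3048551, 4010642, 1448675, 329805, 2164334, 1140729, 943856, 3092318, 2465176,
  2340404], 199035, 78, [8830452760639, 1143535043009, 1168231112195, 2269890339840,
  4561255661636, 850404058240, 11407436300296, 15401756936208, 1757724278784, 224428818632,
  7149083164672, 8843337793810, 402952353, 13196440242176, 9208413028644, 300110849024,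
  4398337294368, 8798540431360, 625186897920, 6236359626752, 3170826731520, 1395998851078], 668⟩,
  ⟨[2962202, 1851543, 2990900, 3535243, 2913724, 1928721, 3139523, 1275102, 3749281, 1474894,
  2370263, 3630348, 1452253, 4119195, 1665529, 3979106, 612447, 785826, 171234, 1880756, 585318,
  4121689], 2540186, 51, [4294967423, 8804682957703, 2201170754696, 537378945, 559421079810,
  9484361581058, 2302641963028, 5239865410560, 9077413447968, 10801842749444, 5815394238528,
  2353648111616, 8934630920224, 1169556505088, 1152160759824, 687300183040, 5055780487232,
  3338062004240, 4563805667328, 13194680805376, 277045334048, 3386718028288], 698⟩,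
  ⟨[4030161, 1508945, 3867041, 3173485, 1238963, 4177174, 3161943, 2476475, 388736, 3603210,
  3219792, 334902, 231956, 931433, 3614695, 1454846, 2154899, 1473698, 306764, 1885023, 2901193,
  1012633], 4033494, 105, [13684034240513, 154954366991, 11563192811568, 7293055795264,
  6633576990592, 11149869320210, 2751492226, 1236951077120, 1104749789184, 1654099806400,
  112755515392, 1611686224, 73032306756, 11272679064065, 824634458152, 550863210880,
  1417607906312, 1100754262016, 345780650020, 13774094336512, 13235017220097, 13315749183488],
  728⟩]

theorem D1_chk : D1.all (chk ones22 E22) = true := by decide +kernel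

/-- Batch 2 of the codes. -/
def D2 : List Dat := [
  ⟨[3139406, 3031568, 3298359, 242740, 3087923, 3516089, 2085228, 752549, 1650501, 4163780,
  1471082, 557238, 4193336, 3880875, 1486309, 1637632, 2379680, 1445689, 77099, 2386238, 1461868,
  3288106], 2474232, 30, [1237219016735, 6878658560096, 1188632199553, 6689411564160,
  1374657973441, 13744969150464, 416612810754, 2774549927424, 11244761317376, 11682850144260,
  1262732976136, 5344029835264, 8796093078152, 550294045200, 721590167568, 13196019171344,
  1726614732804, 312559599872, 4435226935360, 30098334984, 142078642176, 139755527], 734⟩,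
  ⟨[744041, 1296361, 635090, 3948604, 360698, 2954591, 2919877, 3735026, 2508619, 1584681,
  4012009, 1831477, 3221582, 1069659, 993776, 3567729, 1970912, 1087068, 2591631, 2615312,
  3763798, 1667420], 2046526, 45, [69256347711, 4466765991872, 7318624284736, 558346256512,
  8950980808961, 139856453638, 2218353254528, 8797735092226, 245351055680, 5536217137664,
  834331001856, 275424348184, 13198535491592, 2784351158272, 10179072754212, 16410214464,
  9228290883586, 4142630174736, 1220047536161, 2474991830048, 9906711166980, 5708011571201], 740⟩,
  ⟨[2700044, 2544445, 384163, 423655, 3404851, 2423767, 3152442, 834928, 871426, 3669322,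
  3889588, 2969757, 4132271, 3447108, 75985, 2191008, 2163583, 3317756, 1679804, 339364, 3114776,
  4186204], 2663515, 15, [2407329169423, 9554423185425, 2199560128480, 16499653738498,
  8590063632, 44023810084, 14294456991768, 4405028978880, 6734781350720, 2512824316416,
  128850202625, 1689264328708, 4537104482818, 9698036678661, 343882866880, 283577204736,
  274887050272, 1666617213952, 10059889246216, 36708821008, 9368399593472, 21652242432], 746⟩,
  ⟨[704133, 53626, 1760378, 2379938, 1947400, 2945022, 1998300, 1423948, 1251201, 332013, 776008,
  1661830, 3836449, 242702, 1204763, 3256630, 2373394, 3160631, 289765, 3639662, 2048314,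
  1526666], 619302, 86, [619280597007, 206695301361, 417148698738, 8799314251648, 111669178404,
  9347996553217, 6598143870464, 68721352800, 7716714184704, 6747662581888, 274878318152,
  5524416364544, 9900187516928, 1964427444224, 661729050626, 13198507901568, 10333692366848,
  8813625347072, 174248171528, 9630425055232, 3489799340032, 2238898503684], 776⟩,
  ⟨[2602442, 2192445, 112875, 341731, 1270843, 3599317, 3855808, 1431104, 10967, 730412, 2495090,
  24333, 2043320, 4039784, 154950, 3508102, 2454496, 3903330, 3542362, 469628, 838136, 2899878],
  2252673, 45, [4452807344135, 348160786552, 4467034427264, 689610698888, 4398315061552,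
  2216471712257, 8942659567936, 3332901998592, 2493497082944, 9909571815424, 1700824911872,
  692345372673, 13262869496360, 9281961590784, 215390095360, 2244258840578, 826311778304,
  12386685682760, 4398199145474, 1665507786756, 13246756552704, 11029543125542], 800⟩,
  ⟨[322852, 1562068, 3789429, 167360, 1341708, 1790974, 3532318, 1410982, 2829579, 3556111,
  611163, 3775324, 1205291, 1508729, 1265151, 2423016, 3420880, 3550660, 81772, 2048584, 1434953,
  3024591], 2693207, 27, [5497558138943, 143344534464, 9072178904064, 4711847608384,
  560493298755, 9483422400524, 2345992194048, 2562085355520, 15549933289476, 2474171175056,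
  8836358472960, 9141863063560, 4433752627216, 1726820122624, 148499595264, 42976937474,
  3317325365892, 6051610001418, 2293514699296, 8848170092576, 1116894400640, 9418892640512], 806⟩,
  ⟨[3780509, 2060254, 3943075, 2617254, 875373, 2397823, 1373176, 1314164, 2124401, 2147791,
  3917438, 1298380, 3690556, 786251, 2290103, 96487, 193115, 1478651, 4134590, 2674234, 2308239,
  3396775], 2120178, 51, [8813541326879, 7975754268896, 690214667008, 709810455584,
  9079560879105, 36507342850, 2267742912771, 6700686196736, 5635064218692, 244276822016,
  837790203912, 620623102340, 4574341627936, 51619956736, 11039294881792, 13471198740504,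
  12103230687232, 9922850856960, 2203990360896, 277295928338, 1254298878464, 620106948608], 812⟩,
  ⟨[3902430, 2662306, 2293199, 3459306, 2508081, 3880660, 805156, 854614, 1094085, 3367732,
  970900, 2028066, 1174703, 1628813, 1777568, 500006, 1481270, 3782077, 3104966, 1916268,
  3763798, 2394789], 3708336, 30, [14332305866759, 137438954488, 12147241257984, 4720169062403,
  1122060218380, 824633966640, 2544769957889, 13194145842256, 8878779533440, 5506198441986,
  1245607714824, 9346000355664, 35435648260, 2449305763840, 11630796603904, 689611768096,
  842233545728, 175858786304, 2751003133952, 402116315136, 4398120059072, 6185615360], 818⟩,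
  ⟨[3439417, 3780324, 3783092, 347053, 1528541, 3826736, 3460594, 1025231, 1202974, 322718,
  87473, 3288532, 2349205, 1848890, 1696324, 740259, 3249100, 1234168, 3842854, 1887280, 539268,
  1908192], 541943, 39, [8854075080711, 38654706168, 1120986465817, 1410896771073, 4537633062946,
  206159348416, 2757372282884, 4477516038144, 575575949412, 11347374915584, 294343740416,
  12129004421142, 208607908480, 1383047794688, 3303376421120, 9906618901504, 4952132159552,
  7353001181184, 4441281401888, 9638580322304, 2338140012560, 9350827540480], 848⟩,
  ⟨[1583615, 4108385, 747726, 2621885, 2973456, 1515863, 3895784, 1151481, 3238204, 295708,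
  2453746, 3522499, 393935, 1178411, 825791, 182010, 355852, 3783473, 3509228, 2356591, 1197521,
  3079323], 1536073, 54, [8934605717535, 9148280340705, 1122060207874, 4741643909380,
  11819750049824, 73551794176, 3334505828352, 13377213562880, 5508302897408, 2491139768328,
  3453237592104, 1797445911072, 23655908672, 5498570014720, 4758823837713, 2749452812416,
  584120143360, 5637833224, 15566103379968, 906255007808, 586431070274, 9552548348032], 854⟩,
  ⟨[2030992, 2002938, 3397273, 2169688, 2754527, 583187, 65485, 1869452, 2791518, 765411,
  4104372, 2253431, 472231, 2577534, 2586511, 1637623, 653630, 497683, 467137, 1001636, 1670716,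
  3060594], 3875581, 29, [8870718078983, 9347996319865, 14328547770754, 2891049864704,
  5566814500352, 335007694848, 1786707234816, 13817983533569, 4428114448384, 7147912953864,
  9079561191824, 4417386449032, 68774142980, 326420693128, 139075256368, 11029543190625,
  2358071265348, 1133947388482, 285918625808, 1580617334784, 10181354455296, 2219428618242], 866⟩,
  ⟨[704133, 3964636, 1947400, 890866, 3349290, 332013, 3908726, 3512818, 4087394, 3732399,
  2487328, 1142287, 3067325, 2110310, 859792, 824721, 1376134, 289765, 2147046, 3374234, 2354844,
  3977124], 4056552, 60, [11064372625423, 974957576304, 23622322064, 280246630448, 9002251567169,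
  4691715293312, 10995117867778, 6597073438726, 9345854734360, 5669902090273, 5755258306560,
  1178448822272, 9511741948928, 12931563840, 6666930098272, 2234003776512, 1102884208640,
  827326480900, 571271544840, 10222290600452, 10215848214528, 141882819712], 878⟩]

theorem D2_chk : D2.all (chk ones22 E22) = true := by decide +kernel

/-- Batch 3 of the codes. -/
def D3 : List Dat := [
  ⟨[3780509, 3943075, 3211919, 1703092, 772103, 2397823, 1373176, 1314164, 3573592, 2960215,
  3807948, 1298380, 2264895, 2054290, 47275, 1433406, 1361163, 3561070, 3645270, 2786506,
  2439566, 4021326], 2841340, 114, [6597069766719, 14294188032195, 1154004026112, 13207024442432,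
  283467965696, 8801999519808, 4744060863492, 1375733833856, 2162264072, 4458176086192,
  1701880799489, 246977527816, 1255207616512, 177737957888, 5929740271616, 9423225366530,
  2203586663960, 826396901376, 11544951783937, 798897473568, 6670377816064, 2542788493316], 884⟩,
  ⟨[959324, 1549183, 1133835, 1176930, 1738703, 2287635, 835994, 2765628, 3199562, 2862999,
  326202, 1489118, 646428, 1917628, 544405, 920029, 3793693, 2787947, 3147704, 4180920, 3081092,
  1088492], 1395060, 89, [8589934719, 21474840449, 2619930112000, 7146825777286, 2199027188104,
  1408812191744, 9088155058832, 4570046595360, 4505488719872, 2199083294728, 4535888381456,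
  13486197328400, 6949793974272, 3900736514, 2439558240256, 9899904877632, 10458312486912,
  1735504953344, 2784223166468, 1333989998592, 8797201432844, 4978672926720], 890⟩,
  ⟨[1362049, 2932861, 1918837, 3492684, 2870158, 2497634, 2398201, 2971995, 1225526, 3244130,
  4043805, 1929934, 244996, 3661222, 98623, 1449041, 3761039, 1325361, 3801822, 3074064, 2880231,
  1681576], 2874612, 113, [8865080934431, 32212254946, 3410740904704, 9586903878656,
  4398046572588, 1245541502976, 5812165607424, 2218356900048, 6683237556484, 292068658176,
  10451266044164, 2886272550400, 1380832117328, 14366733766656, 47852814976, 1247890112512,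
  824919017480, 2340356653056, 8813574885650, 860369256480, 6632772763680, 8881997622272], 896⟩,
  ⟨[2169223, 1871764, 4137185, 2280156, 296719, 3820367, 1273317, 2707393, 4149676, 562907,
  3094492, 302361, 1269730, 1863342, 1462719, 2951721, 2525154, 316136, 731385, 920481, 2663439,
  3979392], 3864945, 27, [2611340115999, 8847632630752, 13331578493955, 8901319721188,
  2478196252704, 1178968656928, 4544076194112, 11545948980232, 1929526640648, 859047985680,
  5600704725012, 37598846976, 150525714560, 4492607227904, 1959587250177, 86203695296,
  30735990794, 11614668456192, 4449623871745, 2891335106560, 4400764487172, 14295932862994], 920⟩,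
  ⟨[718905, 2227691, 242405, 2699744, 811309, 1955102, 1806938, 3953717, 3449158, 364930,
  3026511, 3437215, 4148371, 1780493, 2397667, 3800209, 3877065, 3434313, 3816930, 2961963,
  1682873, 1803388], 1350968, 54, [6159117320193, 9075265896510, 11066117455939, 11274291076,
  324270031042, 5575136000000, 11275363008512, 1138703599744, 4965788025092, 4432413593864,
  2216472231939, 3436384890880, 37071486977, 3849406906880, 4416975413264, 8933617975872,
  705750370336, 3027951943788, 563177884672, 2422361698336, 9142039511040, 9209483952768], 926⟩,
  ⟨[3868126, 226040, 3948604, 3870341, 3600805, 743830, 3325582, 360698, 3200355, 1584681,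
  2798761, 4113529, 3678302, 2287447, 2926572, 449165, 3075350, 998797, 2242349, 4085984,
  3687361, 236866], 3373781, 39, [5145370820611, 5641439543324, 345744868320, 5223753989120,
  1516123505696, 4410931611660, 1111324688384, 4466781065216, 2932388923392, 8864831914176,
  8796328427617, 552175931660, 1378986525186, 9363573997700, 11012632772624, 38671696960,
  9346421358617, 5550171816960, 11106944811008, 2354817531905, 359014400, 6942818836608], 932⟩,
  ⟨[445409, 3937129, 1300999, 1533828, 656933, 1651699, 3568169, 4135477, 2070040, 3367216,
  3779436, 3382170, 4117908, 4170346, 932255, 1015475, 1375051, 2258199, 1741799, 3510082,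
  3843864, 1967571], 360096, 78, [1551556935683, 6674379178044, 137438954445, 2508260932608,
  6048387792901, 13812615220224, 9365176782864, 12886082602, 550894567488, 1121189896320,
  4403214041120, 419839344704, 1100862718146, 2285476909056, 2302316396544, 1151464374400,
  9045268236296, 148180648704, 826799304704, 8824011359492, 2474085714464, 14294725500929], 944⟩,
  ⟨[4165999, 1967892, 3276144, 1130212, 1040834, 2873167, 3712206, 1120757, 3063346, 1280960,
  2309309, 330694, 3375482, 3722175, 3496455, 832385, 878995, 300190, 557924, 2762947, 2401552,
  1405910], 2789126, 15, [4682051223567, 2243046670576, 13286548439296, 4432406281728,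
  8830452859248, 8796630288001, 1240038115328, 1100585564160, 919391961344, 3376180920320,
  2892157157378, 68890919056, 5773040550404, 10995921718400, 8955413659656, 6096706084864,
  8970173743616, 567707705344, 484299505672, 433829707778, 568026218546, 10995189710944], 950⟩,
  ⟨[765953, 611717, 277484, 1244434, 2417078, 964397, 3373274, 25461, 704019, 834824, 3236992,
  4138940, 2133561, 4191796, 3419077, 2307856, 1286606, 4189979, 2331834, 2999593, 589784,
  1594832], 3314402, 27, [10172630040591, 13353053323376, 2826088482688, 5773509793936,
  11135776481282, 4408784420992, 619550630144, 3006479728640, 4399126054916, 51570082048,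
  5635104051200, 139721318448, 10209139359768, 2209894941440, 8903745078272, 1101734871592,
  8887639998464, 2801665081344, 1551556939778, 4428111675426, 627618898432, 344469930176], 956⟩,
  ⟨[2588813, 2139873, 755048, 3493901, 2621293, 3194365, 2908372, 3369966, 2512288, 2688370,
  3549732, 1885087, 2419320, 1287339, 2053955, 785494, 599809, 107199, 1560352, 3812988, 4030777,
  1113128], 2674527, 30, [13194407968799, 623844000224, 4544075406880, 1309965049921,
  1116691996674, 3310349713408, 3093455962112, 11085855883264, 1409825193986, 545293252,
  9073137287194, 6769673765952, 2482795187200, 569687163912, 5678752075776, 9971303583744,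
  558514045092, 558949794068, 2806765330432, 39758073856, 13331612469248, 10187932436480], 962⟩,
  ⟨[3991788, 3829709, 1973613, 1271493, 3079540, 2810594, 292939, 2464514, 2068565, 1496042,
  3126459, 2041399, 3706241, 666132, 1646578, 1745264, 4171520, 1288601, 3120527, 1819314,
  1628001, 1683784], 2153157, 54, [8800387989567, 53687092161, 1404454306882, 824633736324,
  688805495040, 4406636839950, 2200635459588, 4419527676928, 1135490376193, 2207632728080,
  380742140160, 8935693139968, 5235565135944, 17351901744, 9967553740833, 3926405423104,
  13817983549696, 2440625127424, 102767144, 1565532618752, 13194146938946, 12232352206848], 968⟩,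
  ⟨[1184749, 2068558, 352724, 3167358, 3894966, 1612289, 1015231, 2347502, 667421, 1950610,
  2465241, 2996895, 4059190, 1036545, 3356171, 2683201, 1305967, 2300513, 1095159, 3385531,
  3557830, 1810208], 963780, 53, [14058501701633, 11272410103815, 138781131000, 1211717650176,
  2218350639112, 15837921280, 9633611907078, 3337193259010, 9117146284032, 69798986001,
  77855261200, 4581294136, 7198390355968, 13331964366848, 1719096313858, 481237672992,
  773140250688, 4415931302400, 2192396, 5636071884992, 54224225152, 3302981501184], 998⟩]

theorem D3_chk : D3.all (chk ones22 E22) = true := by decide +kernel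

/-- Batch 4 of the codes. -/
def D4 : List Dat := [
  ⟨[2464412, 2249906, 3562427, 2955662, 3948532, 1923953, 3713351, 3521023, 672168, 2212279,
  2038677, 910695, 1159960, 2217934, 1368299, 781848, 3577375, 619761, 4074803, 4026920, 1954510,
  3701802], 1391778, 46, [8799045812239, 5102421147888, 5592047419665, 9487582760450,
  2241167626272, 123476, 8864947111176, 884899053568, 4681651331072, 1100317213193,
  4556960344096, 9279290474496, 10999679750660, 1143287578880, 2205465904320, 7460358717504,
  6598185977984, 1650375000116, 5619025182976, 346898300936, 174533398528, 9355178020864], 1004⟩,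
  ⟨[2052963, 808391, 3674426, 3874644, 3340070, 152810, 3390164, 2170033, 2038406, 876967,
  2846047, 3330755, 2916170, 2096671, 425918, 4190419, 3609063, 1696519, 2414188, 3313824,
  2635779, 1881142], 78077, 27, [4535485464639, 39460012992, 13797045567489, 4443412106242,
  3335042110532, 11023033589761, 2207881668744, 180388843521, 5365756329988, 274881904904,
  8964133666816, 277323186196, 635689173504, 3384434492048, 10189814112272, 549798675968,
  4401838194784, 12163350532160, 4764226060288, 1099598275584, 689212227586, 9454300954626],
  1010⟩,
  ⟨[1693906, 146729, 727358, 1242513, 2892608, 640513, 3711679, 2341581, 1613690, 107363,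
  2362707, 1071141, 2423062, 2742040, 3743326, 1585643, 14582, 2788543, 2616728, 4025722, 351627,
  3607148], 477122, 46, [841813590047, 3607772529120, 3573412793889, 2351763042304,
  4433480040994, 138379460608, 9899902764044, 11132555238468, 652848693312, 565073414152,
  5222681313329, 121920159744, 4707284549770, 8824161837056, 9896699375680, 208507535616,
  1242857218064, 10999958601857, 7226550911232, 4407106339088, 13214750343168, 6683514634752],
  1016⟩,
  ⟨[1438120, 2807490, 3256622, 1127133, 799259, 3868320, 3611589, 307631, 290268, 3342973,
  2277802, 2325731, 246837, 3172678, 3538468, 3969865, 108145, 671078, 2631693, 2624819, 3990696,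
  2067904], 621680, 30, [1237487452191, 276220085216, 4810363378721, 4400328270016, 105226895682,
  2272039542816, 2834747884544, 482363396, 5774651163776, 1960652603650, 580495867906,
  11580104245760, 8961466565632, 10999412506656, 9934291264, 14310900891648, 9352442348032,
  4398060417032, 383963365376, 235153661952, 8839984316432, 3437055971464], 1022⟩,
  ⟨[734399, 3747555, 2184579, 1147971, 1736277, 1782093, 1749090, 1171951, 1188638, 3297325,
  3468158, 1408088, 3637154, 1858500, 3676310, 2677607, 2462515, 236084, 1560352, 2503088,
  3646448, 2981139], 3851223, 23, [541165879299, 8869107466364, 9912784521092, 343597414409,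
  4434553843840, 5506148499728, 137442754691, 14577131716608, 3994341081088, 9440396836864,
  64626098178, 3309339934992, 623181332482, 2818642468, 11547057324352, 1943476896320,
  6734593916936, 13506061541504, 554464444928, 241625579520, 6598681448464, 2203353875560], 1028⟩,
  ⟨[1814382, 1562068, 1336277, 1953674, 2846874, 266679, 3532317, 433320, 3546501, 706031,
  1462171, 3775324, 2960117, 2884385, 2796436, 3607022, 1341708, 2715534, 1998118, 3914402,
  4148956, 928347], 1023722, 89, [14156212207623, 9896141521144, 6752762331905, 9898020576264,
  7148436217872, 352455983106, 2218888266753, 4410934821152, 13212128935938, 2376199307776,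
  2201171363860, 51566084162, 418805448708, 8952943247392, 9346923234832, 661458543104,
  5566686568448, 1992866992256, 2238894326016, 283755347969, 1106496192608, 111719481736], 1034⟩,
  ⟨[1666435, 1058655, 1490507, 3875469, 4017865, 1806938, 2526035, 4183347, 3449158, 3437215,
  1338110, 3403398, 2086724, 128107, 265780, 926712, 2302967, 1803388, 31059, 2226095, 3665229,
  3749486], 2432788, 29, [68987912255, 988110913728, 579820585731, 5018669288513, 284004725004,
  1926292946960, 1428076773504, 19329193472, 4398583392533, 275689508944, 2235020886016,
  8808986315304, 227633529154, 13229611286560, 4054784704512, 13231856287744, 15947230625792,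
  142816281088, 3445776056320, 13194715210752, 8798391507080, 3402016882720], 1040⟩,
  ⟨[2633328, 1811110, 2872778, 2271345, 1084862, 1096946, 2899899, 1414544, 3994461, 3638243,
  1443681, 2718252, 3296536, 3947552, 3978473, 2498619, 3558032, 3000728, 1661065, 1059919,
  1963534, 1276972], 1963661, 45, [2268145385487, 6668473598064, 9347191014273, 1374389542022,
  155155719185, 2268145492224, 301989937280, 7696649420832, 4845261078528, 4541998170128,
  9494094413888, 552453799972, 4475372831520, 5540939784, 1151084857872, 52881857024,
  5828288446464, 3302897877056, 9629786963968, 202400334912, 9759914721280, 11066528497669],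
  1046⟩,
  ⟨[3975736, 4029133, 435260, 3690337, 1454458, 2620451, 3195323, 3852024, 4024576, 1872782,
  282430, 1421842, 2340972, 1648943, 1462659, 65476, 1372081, 203502, 1654613, 2799000, 1089661,
  1304836], 3492260, 27, [6940935585799, 563714457657, 35433482184, 7039451400192, 5772704493574,
  9077413431312, 13400298045536, 550562037784, 285616488450, 9386653188224, 2370851311872,
  3367292111362, 8813877297156, 9947683258372, 1152135471168, 3368202276864, 2360235524097,
  550930743968, 9552007463041, 4412005957664, 998253568, 10745544960], 1052⟩,
  ⟨[2477228, 1755911, 2470430, 670376, 3960428, 2073590, 2304679, 2789591, 586259, 488735,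
  446830, 1220748, 3175740, 3699825, 3026566, 81478, 2400306, 3385180, 2750693, 681230, 2922989,
  2220803], 4096792, 30, [60934848519, 10584141594633, 550863110386, 552003961618, 9009230774312,
  9037349388544, 6598143523856, 1523169902592, 6609954767888, 2216237107264, 5574968737796,
  10054787940352, 9106411229184, 9090300526624, 4399158012168, 2689052180481, 1720143446144,
  13469155987712, 34447824388, 21475133958, 2204274524169, 584249868896], 1070⟩,
  ⟨[3115374, 3411049, 2527467, 2834747, 1568128, 1060308, 2950915, 1841837, 1671513, 2741697,
  55122, 3520399, 1846555, 2879, 1829149, 2256138, 2017400, 1280667, 912318, 2448528, 1664675,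
  226250], 583011, 57, [4879082848271, 1374389535217, 8873402449408, 85899396614, 2757369479170,
  3161097568258, 42951903768, 9019435520096, 549814669360, 13469028451332, 11003725120008,
  8985272918048, 1177089818752, 172403724312, 4536190697473, 1444182753729, 4438848743552,
  3867622506752, 2890785628416, 8797376514052, 3318685368320, 13233872306240], 1076⟩,
  ⟨[32402, 940153, 2165147, 1328367, 1251681, 454643, 3429212, 1177807, 3895789, 3178323,
  3148196, 1600213, 3216420, 3451208, 2325565, 3084731, 1510006, 3001713, 1308848, 909261,
  2768966, 1102968], 2286229, 23, [155021475855, 9380208574960, 549755829808, 1113470386688,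
  86570583041, 7905155743745, 687195686978, 4677219425408, 10480525771008, 687464317068,
  12891197768, 10314364747776, 1486071300096, 4449636483090, 89255969792, 10997448319008,
  2354851364864, 13208098767360, 4417961070608, 13401640206464, 11347941130240, 6915434758144],
  1082⟩]

theorem D4_chk : D4.all (chk ones22 E22) = true := by decide +kernel

/-- Batch 5 of the codes. -/
def D5 : List Dat := [
  ⟨[631428, 577482, 2835670, 2244192, 3181090, 1251991, 3192623, 2719806, 3063346, 1280960,
  4091405, 1029957, 1373405, 497378, 1125852, 2627221, 3204435, 886954, 1251961, 3464460, 878995,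
  3946864], 171976, 46, [1683627180063, 12370579554402, 10685878632580, 23622323976,
  3445637525760, 4612794990624, 1658931511376, 4672940687360, 4466816844672, 85984935968,
  11553596507200, 277965094912, 9077449556096, 4432445057088, 39460062210, 3574759161896,
  8953933340676, 2760017936, 4677823430792, 8835184984080, 8890651517952, 2903417028864], 1094⟩,
  ⟨[3867353, 2377341, 1848481, 2700878, 1065819, 3488059, 3517762, 3358319, 3597902, 2344238,
  147909, 1498267, 243487, 648537, 657755, 4072077, 3479464, 1308457, 1358191, 3710595, 2931026,
  3139944], 2513204, 39, [9964592562191, 4433479991792, 11888536585728, 9865017360,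
  1120046958593, 30131978246, 7731746570752, 4866186240, 11032898568224, 2228685406208,
  4604208873536, 73117237378, 9071109350688, 722393628674, 414472759312, 365072220812,
  5703725482080, 9354736566273, 137743106692, 2834729009153, 4961232618496, 1411047751952], 1100⟩,
  ⟨[2787379, 3583620, 760470, 3300499, 3799085, 2472450, 2503965, 3960292, 2981863, 519788,
  2903945, 2596982, 3467023, 1544289, 3325529, 1367176, 4121159, 1431890, 4147572, 2687631,
  1043340, 718130], 1962929, 51, [2748779069503, 2495375999171, 45097158405, 5498095024392,
  1700807165952, 98785181696, 9896679555584, 4472141023232, 2687635522, 1460314439680,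
  4573636854272, 4405127577600, 137883820160, 2478196392145, 11691102307328, 5738613178632,
  10859027890176, 824767940786, 12923244576, 11023033566468, 9071064391680, 662566354944], 1106⟩,
  ⟨[3369929, 2770089, 2553410, 2742665, 1757431, 2829819, 375302, 2936798, 1541774, 3596420,
  3681497, 2174180, 1304422, 831641, 2954428, 584617, 781923, 3762661, 968016, 361701, 3903089,
  3272991], 4143699, 54, [4536156553231, 3539321487408, 11545945833936, 9381550752352,
  11137387076608, 2199828571360, 8806830557440, 1376671387649, 5370856865793, 2221572397056,
  369367851010, 5384470784, 4967147667456, 10170518208561, 8944707698688, 35970372228,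
  2800403873792, 244818640904, 4758958571522, 82049105920, 5498162202628, 9934930510848], 1112⟩,
  ⟨[2628303, 1369129, 1474887, 955128, 2330571, 1158954, 894997, 919723, 1386106, 1460446,
  2771828, 2358868, 3161436, 1270125, 2974597, 3112907, 3442267, 3207402, 3124141, 1856074,
  3922986, 875134], 3705046, 78, [4952097292319, 10996190019811, 314606356256, 275951663428,
  9914932051977, 4398048545024, 2336464308112, 2413775896640, 4535548510272, 1408816644628,
  1125358501896, 4952122982424, 11640435118080, 3288604707, 41004573184, 7767448453122,
  279476177920, 9932118228996, 576733584384, 636200960128, 9217289240576, 9037418594432], 1118⟩,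
  ⟨[1107213, 475860, 3561855, 634809, 1089001, 2908945, 1292378, 548710, 624908, 4068587,
  2883528, 2685684, 2239372, 419915, 4111573, 1152051, 1026936, 737521, 2091570, 1046917,
  2159390, 3887102], 3127851, 54, [3758096415, 2285459472609, 3302829852450, 1928440346624,
  4554812915972, 15951508701186, 9905269114888, 1797444861962, 4518311886913, 44083185664,
  10170574836224, 155156185092, 13641924476928, 7157567717888, 88189444129, 4467001458704,
  275314131296, 10999411381384, 1238846415872, 1009321639936, 71538123792, 8834823488256], 1136⟩,
  ⟨[2568981, 3551151, 3540801, 3774488, 2841455, 1686431, 349309, 2835062, 4180671, 356248,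
  1361436, 3564505, 1991013, 2368918, 3717886, 3765609, 3917489, 1466290, 4104101, 2935680,
  1738574, 3885833], 765196, 75, [602100727815, 10737418744, 2346125889032, 4473208451081,
  8921720864768, 283669237808, 1245944086528, 9912919801922, 4570389414016, 2476048655041,
  10183703003140, 4468938638864, 9123886268418, 618519728128, 6879463931912, 10995854606356,
  757025996801, 1787125827616, 1104159443200, 5257041027232, 2199786883072, 8882532941824], 1148⟩,
  ⟨[3633907, 985178, 2055445, 397762, 1605035, 277381, 2121275, 1730001, 1751897, 765762, 521908,
  2158484, 2225051, 2269092, 4150674, 3779870, 2160678, 3308342, 1314687, 2908355, 882013,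
  2929724], 2086198, 85, [8813541326879, 9073118413281, 4398583389702, 4554947092480,
  1203194822753, 928014926344, 11001592348802, 138043130404, 180994441216, 3299776675968,
  78989819904, 6622854512640, 574586388480, 9174087925776, 3298870576192, 78385842192,
  1379103932800, 8950728640524, 7156498696192, 38932185168, 1928473907202, 5087526125824], 1154⟩,
  ⟨[3532504, 578374, 2069301, 1320832, 1072623, 2911045, 124595, 3439165, 3311295, 2798104,
  2865710, 620376, 3246278, 137972, 1878624, 1017724, 2912731, 1908690, 3810623, 3337035, 556082,
  2838080], 4192151, 54, [549755814015, 377957123969, 4406636452227, 8796093276292,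
  4815732883456, 2097555701760, 111683862656, 4406638854402, 6598160353793, 2221135626252,
  1443142861072, 6758198149124, 10076666462208, 9347326281760, 8902666092576, 150333036544,
  17458266200, 9092986961922, 3367271203864, 569352128064, 1685909014016, 2339347890272], 1160⟩,
  ⟨[1703678, 3668281, 3496256, 458369, 2014196, 3686998, 1365516, 224015, 23832, 2439781,
  1970978, 2383658, 2395775, 1734826, 967181, 3467329, 106804, 1057535, 48992, 4042457, 3559303,
  1192257], 1365093, 27, [12232066859023, 1202590843121, 1101659119376, 7052336324608,
  13348758585376, 13470091485186, 6665792995328, 1649280418112, 549806145878, 1683632160928,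
  13499082473984, 43054678080, 550972170884, 11138997690408, 14019850142208, 4496858112,
  1181384443914, 468294107136, 97777614872, 12242804408324, 412325331329, 89659576320], 1166⟩,
  ⟨[3984575, 2171185, 1980593, 1516012, 2859495, 1439878, 2608965, 2442563, 642430, 2274480,
  4066766, 4157140, 3544742, 1226073, 2675051, 2033302, 1650224, 1858294, 2032956, 887682,
  1088237, 2741768], 2820048, 29, [4406636445759, 412316862401, 193541970048, 4398046771200,
  1770600278016, 69257150471, 13784698589184, 11562059300872, 270582939672, 6051617310864,
  3775234304, 277604237826, 4408867816964, 9930251698448, 2277142184448, 2336699188228,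
  9931055497344, 276497473568, 4196317396992, 12391249084672, 9641127845890, 146303881248], 1172⟩,
  ⟨[582210, 3790551, 3451053, 1099315, 3867425, 1124912, 2084258, 3355112, 1872358, 3978067,
  3254027, 3215478, 2454647, 2631624, 3409181, 1818758, 2368382, 3837130, 3151618, 945532,
  3438802, 3858011], 588376, 15, [8881992368159, 9038758674656, 3024999155456, 2199560140838,
  7151120599296, 1006096285696, 5774584320512, 13748191543296, 8946419237896, 8807908376658,
  3333456663040, 209144774752, 146868798720, 11013380423680, 1168769034260, 4949958986240,
  1220039155724, 5789683421184, 18673205250, 6893428802560, 869999312968, 4677292786048], 1178⟩]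

theorem D5_chk : D5.all (chk ones22 E22) = true := by decide +kernel

/-- Batch 6 of the codes. -/
def D6 : List Dat := [
  ⟨[1844683, 3436114, 3362241, 436088, 2609785, 3436644, 298571, 3306511, 4134327, 1178421,
  4058019, 566458, 3373402, 3680372, 4034002, 633643, 3791949, 2064640, 1291474, 1913457,
  2694868, 2233840], 2194032, 27, [3036541878279, 8254927142937, 571230651360, 1649267457058,
  68720508936, 4574147510336, 1101685325849, 1297114727424, 13504518045760, 8847641057408,
  1100728042784, 2480393978368, 69827248640, 9183715917888, 11134971707393, 1313734656,
  1288494389264, 550628503556, 350040359174, 6665806029066, 8847708144656, 13411303817344], 1184⟩,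
  ⟨[912466, 2300808, 3831209, 2735569, 1996931, 333033, 142669, 2268506, 1422375, 2263915,
  3229240, 3589038, 2328287, 3312864, 3178006, 1647970, 1978573, 1437628, 4030778, 793790,
  4117634, 3498438], 48238, 89, [9242769621007, 7147899322608, 16131, 69793465088, 4432414392320,
  3229910033, 1430274441218, 6660554789, 13280055658562, 824969871376, 619565891968,
  5027260270656, 1660038549536, 8888469422336, 4278324822016, 11304396136448, 8808989466628,
  705314295808, 12103754743944, 1275605815816, 4407714579072, 2336864871436], 1190⟩,
  ⟨[3638957, 420485, 3862680, 566101, 2378699, 3800771, 167880, 2406978, 3733439, 1315253,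
  1838323, 1047873, 732975, 2848805, 4148846, 700439, 2149787, 1427160, 3627235, 3452970,
  2531241, 3998320], 3972043, 54, [240518168607, 6598680379872, 306016423424, 2338609721857,
  9909563523072, 852551275008, 34900279331, 5120150474752, 139607966752, 11063937466436,
  14854148620288, 1142645850184, 2478733002252, 962611126400, 14346415505408, 1666480914692,
  73082013698, 277295017986, 11068432711944, 4424026294272, 2475245447184, 4466766250465], 1196⟩,
  ⟨[1474339, 3409857, 2601853, 3389941, 1667014, 2199228, 2175716, 1824505, 3296338, 2752885,
  386781, 3349327, 1383956, 2042274, 990062, 3582531, 840377, 2359290, 729231, 379808, 641648,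
  4108992], 1990483, 43, [687194767423, 8830452762561, 8589998086, 4410931480776, 2207614177536,
  12098922947328, 171831328768, 2826123100176, 841880834082, 5437428760576, 3848360951820,
  18123882512, 13490627018816, 1219783296512, 6597363392544, 1409890156549, 8796128679297,
  4604356215808, 22011781792, 10245779226624, 11070295769088, 456878194704], 1214⟩,
  ⟨[642865, 2025689, 109019, 4114885, 1282404, 3127242, 1623464, 730100, 2305799, 3645996,
  1811343, 1725791, 4051474, 1527204, 3201019, 569241, 1823394, 2379022, 152312, 3198914,
  3961857, 954947], 3542106, 77, [6597069766719, 8901319721920, 559419497537, 687194825090,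
  6073083822085, 35435455488, 357562335232, 691498147850, 8890584399960, 5499756087312,
  7164016197633, 730884, 3584351535120, 8869225955840, 9215126011904, 138531065888,
  3625095004672, 6633644624896, 5531993573376, 8882831261704, 555661656386, 9243310784512], 1220⟩,
  ⟨[166767, 1986090, 1315737, 1399628, 2834781, 3155883, 3063346, 4164693, 93817, 1280960,
  3676009, 2697276, 101652, 2191648, 3254657, 1913803, 3462930, 1371646, 1034438, 1510449,
  3144008, 3185983], 3721924, 83, [9098888216583, 4466765988344, 1168231120392, 4948876312592,
  657130783264, 1722283199488, 2207620007425, 292082962512, 4415262048394, 12234281451780,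
  9036780013568, 13537741635872, 2474178019335, 2489504038912, 1262796013632, 10446434215976,
  4711579750400, 1245540713280, 3459604549632, 13779484016640, 3357819009, 35438067860], 1226⟩,
  ⟨[3846389, 1742407, 2786573, 1607017, 3006793, 3495435, 2535981, 49853, 1125288, 2404539,
  678459, 222076, 1510240, 3751282, 2060254, 2189650, 1671890, 18015, 3185110, 3099755, 2949553,
  1350832], 3928461, 204, [11132823666703, 1342178288, 7911329760272, 5510979914784,
  8796093149249, 1099513594050, 77852585988, 277034188944, 2538610884608, 151433251072,
  2528696074240, 567271264296, 4984327504384, 568684775424, 9071310676226, 129016791328,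
  14504138113028, 569628983304, 5499705754137, 3301220843521, 722896700032, 9144052817920], 1232⟩,
  ⟨[3784000, 2224516, 2482328, 2402804, 794623, 4105679, 3035410, 3523995, 736151, 2203154,
  1766767, 1812817, 1889578, 2223613, 3078992, 1673454, 2499862, 441935, 1576472, 2771889,
  158266, 4117238], 1262534, 23, [576062488591, 447347687473, 164349608144, 4969344272128,
  11236037101568, 3367522824448, 9105599594496, 10034117873856, 8798911635490, 3448859795457,
  4468111327744, 859601666052, 158992433664, 549777376386, 9964886818816, 4962851491968,
  1126959415304, 4468126056456, 2233554962696, 9074196351520, 6612110544898, 826915981313], 1244⟩,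
  ⟨[1832416, 3951058, 3814415, 1802897, 2198423, 3103180, 628928, 2916206, 1309429, 2860212,
  2792717, 3422771, 3343208, 2191163, 3251939, 3794969, 971124, 3965156, 1197598, 2772476,
  3998931, 1670609], 3043369, 45, [17179869311, 11005853696897, 219043347456, 1503238569985,
  5413806276610, 8799314478208, 1685776515072, 9779646824448, 4578462402560, 1378722267142,
  6047385292808, 9002285563921, 7999443697664, 2239163793408, 118538258, 6597750292520,
  9690117308436, 11016624670732, 4398466009472, 2200902443296, 8805763580416, 70606922816], 1250⟩,
  ⟨[1877443, 3601908, 1028543, 2152595, 3423073, 3699525, 3459306, 2072527, 3880660, 1852685,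
  3382087, 1428684, 4042840, 2028066, 3499531, 266159, 2688376, 3546940, 3104966, 2688781,
  3952681, 2882511], 3868552, 120, [1941325217807, 144418275441, 9208678318992, 4544612277376,
  5523327951968, 13503377203968, 549756061954, 1169308811264, 11220870496260, 103108902913,
  10997364949124, 59089551360, 7289901679104, 3404835324544, 7253001232, 11308648910850,
  706119468064, 215285239881, 15689549086722, 43130322944, 4948624476224, 1108172079144], 1256⟩,
  ⟨[2949652, 2863320, 2776635, 1716338, 236136, 2639330, 2092334, 1485266, 1914472, 1221390,
  2649096, 1753761, 3718377, 3576539, 3686731, 3270343, 781353, 1115151, 1501084, 1460580,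
  2535840, 3013891], 3996220, 60, [1239634935823, 278233350384, 8815420376850, 13265006500608,
  5261603381280, 1650743894016, 572036153376, 105226976256, 7773891338244, 1676917342208,
  4432420931848, 6811839103488, 11136854656512, 5950677188616, 3573547581504, 8959855427608,
  652877430784, 2199627399362, 20939014244, 11000099111042, 284843579396, 9346034172032], 1262⟩,
  ⟨[3581420, 14520, 3032857, 3629065, 621089, 1642438, 1519877, 1863826, 2839981, 1778911,
  1029124, 973717, 340010, 1466217, 3074812, 2501471, 3576139, 1053285, 2335387, 3745058, 824145,
  1136142], 3715033, 29, [2767032680463, 1389421920368, 841813590915, 549755845761,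
  1103269724460, 1116691729412, 8903467479552, 4468913520682, 4964983866368, 13340175368192,
  11000512512000, 12271291990016, 4413146006624, 9938693324800, 3299748118529, 1254131108104,
  2233951322116, 278912827650, 7078777208832, 8907787346048, 7439991701504, 494055465472], 1268⟩]

theorem D6_chk : D6.all (chk ones22 E22) = true := by decide +kernel

/-- Batch 7 of the codes. -/
def D7 : List Dat := [
  ⟨[2312444, 1277170, 1764674, 2842838, 3633021, 3986292, 459126, 1338139, 1980250, 1835774,
  834690, 1821141, 1571305, 4068277, 2272734, 2379323, 3559567, 2266553, 2206947, 3018150, 6964,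
  501260], 2125170, 27, [13211453620239, 4416300122608, 2488665112577, 12099996615186,
  73282886752, 4675071926412, 5085241318404, 3300682834944, 11289323110408, 9114055344388,
  579418456064, 2337269680144, 1855440552448, 8841208020993, 365074360320, 9899937501216,
  558790606912, 1306223714832, 240531832840, 1650880676480, 584489107488, 4707435217153], 1274⟩,
  ⟨[2560330, 1777096, 939891, 170774, 3686666, 3064492, 2239571, 4171135, 708186, 1565407,
  2518909, 3743152, 3025894, 556154, 3455552, 2016581, 1770004, 155627, 3626118, 25983, 1737576,
  4107309], 3297485, 170, [7718056230919, 2682207076408, 9405978378688, 17179885121,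
  13194139779082, 1924682579972, 8831528076928, 3302836144146, 625465098241, 11273232220672,
  171916658704, 11409597530144, 1453309886464, 15711997952, 5076651409536, 13752487116864,
  3390071375872, 1383518445840, 2476050743821, 18422472706, 4535553102980, 4569917817856], 1286⟩,
  ⟨[3351785, 1733206, 3320817, 2556671, 1454665, 768705, 631541, 2961652, 472627, 3714308,
  2697305, 2286926, 1684834, 1892464, 832362, 3231670, 2118553, 3378947, 2062239, 2986703,
  4030523, 2776280], 894492, 23, [1108101562431, 8873402433735, 7713761267456, 549756334080,
  257698574592, 4398053900297, 26231378, 395145450496, 1649300997528, 5222730630656,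
  4819190284288, 8830788307075, 2389616754688, 11340995371012, 1252553392160, 13225294825472,
  10224172269568, 4403419513120, 9351486668800, 550092169220, 2276466884824, 17179936292928],
  1292⟩,
  ⟨[1898572, 2936089, 261698, 88398, 765088, 161922, 1914701, 3231171, 2429656, 13160, 2729330,
  1141701, 2834548, 3110338, 1285226, 1883584, 1031996, 3077165, 2003923, 3820870, 2210733,
  1709624], 3551576, 23, [1100585369663, 120795955271, 1120986468224, 4400194056328,
  9140764348480, 18255446275, 9142009876, 7699316080641, 8839045382212, 2338681127488,
  11175504928896, 5227528982528, 16801912070272, 992540098560, 1655709906432, 704388270112,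
  4502333751320, 13690357776, 1496527667200, 8864981876738, 2751478106112, 8968296497160], 1298⟩,
  ⟨[2275761, 2290015, 1924465, 3410268, 1930221, 3855350, 3469372, 2307209, 1455718, 337164,
  297422, 2778849, 436128, 3048009, 3082646, 3367384, 420933, 282242, 2218519, 1459168, 1642580,
  236820], 2700430, 29, [420906795039, 1650341183969, 11201274715648, 5789616037888,
  8847633555968, 13238163996678, 2888365524064, 124554185224, 5516350980224, 2205470426384,
  559430270977, 11888486785024, 3573465235584, 9560622367744, 8849252679682, 4698694289538,
  1651952128256, 143009005616, 144955147028, 2853306464, 9140629934084, 4505555968008], 1304⟩,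
  ⟨[3004516, 2645667, 3609295, 240671, 1113037, 1960742, 381137, 2207386, 1479898, 1252724,
  2661877, 3355817, 3905431, 3180635, 303850, 48239, 3625248, 2248607, 1467250, 859315, 3576509,
  949040], 1270900, 45, [9107478151183, 9247064588400, 2216337346432, 4403683684480,
  4398718615552, 13743902720001, 2001991630866, 2304526782480, 159200116992, 863296823840,
  9142376857606, 103219725572, 10247793016872, 5509118689280, 2336755942416, 1125566668928,
  2354757763077, 6597241930240, 1118908448777, 9484931989568, 1208879488, 13757921624064], 1310⟩,
  ⟨[227145, 3017229, 4157650, 2394605, 3877367, 2976545, 4047188, 3991943, 2346558, 2204767,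
  3448501, 3840238, 3441155, 485642, 3824743, 2897534, 2991601, 2474815, 2391001, 69545, 1001436,
  1419721], 2092422, 27, [13812614823951, 10995116278768, 16513075512320, 3302829882368,
  584652652592, 551366723776, 206160335104, 1516129751041, 1239645429762, 9897773106194,
  4458210164752, 7146893738501, 10334765920, 103349027200, 4421738071040, 4750267514892,
  731486619680, 293869640, 5829346459648, 284022210562, 2344251039744, 9156920623108], 1316⟩,
  ⟨[2540810, 2284658, 665118, 3108805, 3407384, 3325061, 1922684, 777481, 1590346, 3782183,
  3984800, 989809, 2063521, 1203015, 2133963, 3439219, 3332585, 4010522, 764329, 3481514,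
  2182726, 1213152], 1675861, 29, [9637906612239, 11141145166064, 4638564681488, 1138166396928,
  4629974941697, 605591240706, 193274841120, 2817513230592, 6597122196016, 47311757586,
  6605827490050, 2612145427008, 9621938897412, 1683764052992, 1169611620352, 9210024820864,
  292595050560, 142003700737, 1101197742212, 13202796708040, 4441131516960, 3919426109448], 1322⟩,
  ⟨[446121, 3507640, 3073587, 704477, 3425862, 3974062, 3202154, 2254667, 385669, 688535,
  3342160, 1917254, 2934819, 4113248, 339001, 3918384, 2850584, 1788041, 1079397, 3947408,
  1028106, 2967529], 3628852, 27, [3543348019203, 1305670058045, 8821862826948, 5911485615104,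
  696858505216, 8808441131008, 14914273939464, 8848169959440, 10480793953282, 331786764304,
  4410934626368, 293131682000, 3923452625184, 64503816, 10995188761090, 2233928385033,
  4466923275392, 2224960833572, 4678562087104, 4398533644288, 7295539085312, 277411536896], 1328⟩,
  ⟨[3064587, 2139873, 3937163, 181998, 3800699, 3063019, 2908372, 3811432, 3085862, 2688370,
  3549732, 1409049, 2419320, 3370490, 1763117, 180176, 599809, 2053955, 1560352, 581945, 3457727,
  1687470], 1722066, 23, [4398314946623, 10730975789248, 2241972930369, 4987799209986,
  2473901420544, 2765959205636, 1444183302146, 9096748077056, 11477226455040, 2955935944,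
  69806358576, 4984863457344, 68762638336, 146870632448, 1667596552208, 2762469277956,
  9895747788936, 6773700493312, 1267049955840, 1106021188650, 4573334866944, 11082089455616],
  1334⟩,
  ⟨[1075877, 310688, 242294, 3834813, 1777295, 1082776, 2607658, 2034259, 3405670, 2373349,
  2429995, 3939715, 1552833, 3093909, 2174296, 3563382, 3626124, 1667661, 3290257, 1230916,
  3304224, 3984698], 3433499, 142, [4402341478463, 3161632801216, 5567351365120, 11544872215040,
  11272142086144, 3299073459201, 2422364702721, 9228274370560, 34372432896, 74144809024,
  839129235462, 13753559056898, 5538431696896, 9500603973641, 1136102769280, 42959388696,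
  17767203204, 10179642918914, 4514211954704, 157034766528, 2284939641184, 10175853559808], 1340⟩,
  ⟨[2616409, 1266515, 3906676, 2237682, 986709, 477465, 362696, 734529, 2818350, 980210, 4192976,
  1846, 354153, 2773270, 3625702, 2733059, 646154, 1152879, 2955376, 2849149, 3701215, 1673633],
  2614189, 46, [2281701439, 10102299951552, 11622517047808, 103079230467, 3990158884864,
  8657241116, 4501931819009, 22014853194, 3591804813344, 111669676178, 15840913133568,
  979396214784, 971200562176, 3629137936, 10094246952960, 4515168552, 4401553485824,
  14504104558912, 23689576992, 4400227721536, 11596512428032, 10755403415680], 1364⟩]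

theorem D7_chk : D7.all (chk ones22 E22) = true := by decide +kernel

/-- Batch 8 of the codes. -/
def D8 : List Dat := [
  ⟨[356547, 4172660, 903998, 2493389, 3134065, 2599658, 2583622, 1809017, 1308468, 2157402,
  2694757, 1957124, 292497, 2310967, 1923539, 1814684, 3811139, 442020, 2784927, 1317067,
  2907056, 1232378], 2642357, 166, [2276332666911, 623307129057, 13194676412160, 2336462267168,
  1100586352898, 19343148032, 13305826516992, 8879845023746, 8796671050240, 1547331176448,
  275952224321, 8050932973568, 8933733832708, 4726619918336, 551274184712, 893899505824,
  142426243584, 9932148048896, 190056583168, 6047649497170, 3053721748608, 2357937086529], 1370⟩,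
  ⟨[4168458, 1430939, 2816885, 685986, 2070327, 2040170, 137919, 1813483, 4075843, 2255322,
  1734185, 374887, 398772, 3055086, 1404939, 1722052, 2868185, 323432, 3551202, 2507859, 3935584,
  743570], 4050947, 43, [277562261535, 549755817952, 4413078908961, 38117949442, 107911446720,
  4691181699328, 9902051430464, 3728032137222, 18313380360, 11132568080392, 206177330180,
  3579320467712, 11557828558848, 4987665022992, 4587067017217, 347959468180, 17750696456,
  4741797020672, 11004176039968, 10591393677314, 9941104525312, 5016597300544], 1376⟩,
  ⟨[1333591, 3316763, 627630, 1918702, 3664212, 3161894, 22229, 1654353, 2387220, 1045346,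
  1543617, 3975473, 894194, 3734152, 1107287, 3409825, 4081147, 3376375, 4041411, 3217578,
  1175178, 1231584], 3048280, 23, [148713242639, 8801461731569, 657129998082, 7186017163264,
  9895873208336, 653908781824, 10738352164, 4836133178432, 3367526039552, 13470632386560,
  9071265660928, 1520997240832, 567280009218, 22687252752, 7181187421192, 2233735317509,
  12170360258560, 11203423764608, 843224973328, 12889886912, 5504168362498, 8950729146465], 1382⟩,
  ⟨[722831, 3928341, 1634402, 2875470, 1116307, 4142934, 2874497, 804084, 1958993, 2178673,
  4097395, 2507740, 1636306, 3957343, 1994812, 3188132, 3415941, 2689146, 2383034, 93274,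
  2658028, 740240], 2798726, 46, [44023414815, 2612413857891, 337154933121, 14919105773568,
  8800388021760, 618475521156, 4580582883364, 21478545408, 4836851724, 11836938266624,
  11632919019520, 1376554868744, 5669457494274, 2267923105792, 4467311652864, 6606801141792,
  13195381113920, 1104635101184, 1547332222976, 9346796752912, 2345123709057, 17197842640], 1394⟩,
  ⟨[2429469, 308709, 2127511, 3454312, 2730015, 441786, 3021550, 225235, 1431816, 967914, 713237,
  2841638, 1583126, 1924505, 2901157, 1047748, 734088, 3666662, 974151, 3717562, 3887795,
  2450047], 4056545, 101, [420906795039, 143076098528, 242665652743, 13220983080032,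
  4544075413569, 413659089024, 2233383453442, 349503554560, 10170490044416, 4537658118280,
  6099432374272, 1651952861698, 8796445368388, 9139693289732, 279978248321, 2796162383872,
  6101002158080, 11004814688512, 89003134976, 8882277879808, 12094666179592, 2753087144464],
  1400⟩,
  ⟨[1807058, 3613669, 951339, 1372932, 1214773, 1192257, 379813, 3811432, 747648, 767084,
  2908372, 243187, 1579556, 2598281, 4193652, 1018436, 3334034, 2053955, 1099759, 2332279,
  3457727, 3979518], 2083998, 39, [1385126952975, 1650341183984, 11173894291968, 34896641025,
  10243497001072, 13194140027904, 10995117916802, 10344428732548, 4398061392896, 163259637760,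
  863292620825, 1770675765248, 6667005657120, 1795296592138, 2283312513536, 35437681684,
  13263397068864, 846158905408, 144175005960, 4416905543680, 164048404480, 2345052152358], 1406⟩,
  ⟨[295767, 637362, 3104234, 698299, 847847, 2809569, 2709346, 962793, 1557978, 2202557, 1100699,
  1966832, 2852261, 1935018, 534123, 3206711, 1569424, 2810646, 3027619, 1605517, 3339763,
  1645762], 2673449, 58, [51539607615, 8804682960832, 5497558200323, 8796093481164, 188980138004,
  3506847088641, 9144044101632, 2342971834632, 5259722816, 2767032697474, 8796227372372,
  9212982198304, 4595617104032, 5978863964160, 284021753360, 1735169542144, 3795927296,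
  8334384168960, 2204597522432, 578747926528, 5265682333696, 584255063040], 1412⟩,
  ⟨[2778826, 2683994, 2426331, 2439543, 3291817, 1647936, 3797143, 321175, 437010, 102471,
  128637, 3569238, 2561589, 367761, 2971053, 1257143, 2837788, 1842988, 1956746, 780393, 1601513,
  4070608], 1371464, 77, [1236950581311, 9895604651969, 2998155610112, 274878033986,
  2854542770304, 4468378439680, 537139347460, 4733861363712, 9898825900168, 1354899720,
  4747013128708, 4453900095488, 9906375642112, 2203656552448, 8796161179770, 1675171529232,
  138227515648, 4982465628160, 2620492087328, 2206539486240, 569763692672, 13262861175312], 1418⟩,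
  ⟨[1786212, 443683, 1866469, 573655, 3832755, 1169978, 460661, 2222091, 3744961, 1974450,
  841188, 3967416, 3286205, 2166604, 1798747, 977817, 812926, 3869087, 4087701, 1979206, 1385577,
  2638650], 3400591, 23, [1400159338511, 8933531976688, 7715908750352, 8813272904928,
  5499705739265, 15395311191040, 562656444448, 8802586984704, 2250766290946, 8882225408,
  13821238575168, 8937910960644, 2512560064518, 1856231456768, 4776582463488, 11613592236032,
  2062667513856, 34628178825, 4450156642312, 4683661844505, 172268456068, 3097749389312], 1424⟩,
  ⟨[1687322, 2819766, 2272226, 877435, 1350033, 1701249, 3244123, 1111195, 4125134, 3696426,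
  2051754, 555936, 4052118, 4155041, 2562429, 4013711, 3526109, 411610, 1214302, 3400691, 136407,
  1530444], 1080409, 30, [285615325215, 6116033429984, 13212393152000, 790274105344,
  3298535809057, 687197913286, 1168244105216, 4420076175368, 329672295936, 8820269008896,
  13263630762496, 2239831744520, 7151120550210, 8864888094800, 2345054505248, 9943923032067,
  498769985792, 2929444552704, 284812705824, 5498669633680, 275583336964, 8806981436436], 1436⟩,
  ⟨[594390, 2683533, 3564002, 1078828, 246142, 1438679, 514712, 1754939, 3135031, 1887701,
  4094922, 1765282, 1675451, 1631335, 3781415, 2028988, 641804, 4002440, 3706776, 4131548,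
  1957652, 2890361], 1788553, 45, [9367323672591, 11544939200625, 4812510857088, 4412273604608,
  1254801653760, 11549234167953, 515396093970, 627067207680, 566936109280, 1375062749184,
  4403012567828, 44091113568, 7774160289800, 311860133888, 4418587070464, 162676082688,
  45105548322, 1443427909633, 16698849886208, 641799172, 8797194289224, 2237946438152], 1442⟩,
  ⟨[3944282, 2485451, 1618727, 1439799, 3398576, 848138, 3641844, 2999989, 1749356, 1996596,
  1392000, 3541746, 36299, 3672016, 1166048, 890959, 3117916, 3264798, 1775026, 1901185, 631379,
  1889337], 1144571, 89, [1788317007879, 4415226380537, 103616093952, 915364929536,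
  8798240759816, 4408784748816, 8830456242688, 213687206912, 11038083516416, 8815156138016,
  2338978792512, 13194189901872, 3036608987266, 1821372317700, 1444191277312, 867658891552,
  8865621491712, 2340783128640, 13222090375192, 4535638556683, 1395868590592, 3937679704064],
  1448⟩]

theorem D8_chk : D8.all (chk ones22 E22) = true := by decide +kernel

/-- Batch 9 of the codes. -/
def D9 : List Dat := [
  ⟨[4000177, 3999502, 2879717, 232302, 3529406, 3207775, 146069, 3896758, 3184880, 1205971,
  3104390, 3591059, 411077, 2313320, 1627777, 452474, 1921625, 3242699, 516160, 3286793, 978672,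
  3981122], 3865956, 23, [4398046511231, 37580964739, 10239738907776, 550561149956, 505732403200,
  3298803425537, 2448131491844, 2762738630656, 1099781171201, 9487597699072, 11082374840320,
  5775160246272, 17181229578, 13299376717832, 13650479810560, 2233451184274, 10044317909248,
  4398089569808, 723656736, 854698492256, 30132408416, 550045880324], 1454⟩,
  ⟨[82507, 866716, 792740, 2539967, 183000, 3121179, 1991665, 3540322, 436568, 1666156, 3581648,
  2070511, 2351564, 1289493, 700558, 3461904, 2149892, 771239, 2184118, 4156792, 104191,
  1059005], 3197400, 89, [551903297599, 4949949808846, 4569845206848, 3109556350976,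
  2208150163970, 2405718949908, 9905538342912, 9109900378112, 68720166056, 82703294496,
  215286812688, 4405671755808, 446678845444, 442650087424, 4399388820618, 14860622757888,
  12395409842176, 1136593535488, 4557232144384, 11544901978112, 14293727773184, 1137902354432],
  1460⟩,
  ⟨[330861, 2293194, 2935002, 2825165, 2174963, 1215056, 3013566, 247394, 2518813, 4148496,
  1622712, 2993936, 2021746, 3144776, 1202725, 2147785, 2184933, 2449417, 2096719, 3189636,
  3791372, 4131176], 849371, 39, [9440338116615, 2218350608505, 5568961970568, 8969502330368,
  458756198400, 284541706752, 1548604276864, 2209762513152, 8814352941080, 34922070274,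
  9045201257216, 558356856834, 4418452586512, 4484050714660, 1099517924373, 2203586808000,
  7426032009856, 14298886701056, 75767087106, 2766260932613, 13744166930440, 1516173853696],
  1466⟩,
  ⟨[3962301, 3153363, 3339920, 143486, 473956, 969912, 2781735, 1755840, 2036804, 3087096,
  2162480, 546484, 1798593, 4173798, 4172325, 4123134, 801711, 1972885, 3687520, 4038988, 377513,
  1385023], 1174408, 46, [11287174053903, 4952097292784, 592705502720, 5160403255296,
  6734508917265, 9141838152288, 642099183648, 278106996800, 1271369318400, 2268884172806,
  34418525193, 2303176280194, 9947144392707, 150736994560, 695935699204, 8809351225344,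
  8809046122560, 11166915395592, 5518498201604, 1374392685216, 5842296635520, 571235389456],
  1472⟩,
  ⟨[3821896, 1016414, 2243319, 3086151, 1664722, 249080, 2898311, 1752932, 649574, 80879,
  2186573, 4007912, 3922748, 1160125, 3657292, 3005808, 1098025, 1645432, 1482282, 1461664,
  2735130, 3099584], 584333, 29, [1030792151055, 6672768565296, 2611608551873, 6672500130306,
  6631429512257, 1126355198980, 4673192954048, 1258962444288, 9913325322240, 34632728834,
  111938111505, 8817579429888, 2955524702336, 8939173339136, 4948424131200, 1159860236,
  8805622497808, 835473899552, 5369103416, 1136027566146, 10051297873920, 1969250959360], 1478⟩,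
  ⟨[1906714, 3777767, 802564, 941747, 3166904, 3213841, 2444688, 4137014, 726779, 2947086,
  3810994, 2421757, 1170240, 3560071, 3599244, 2497146, 741684, 1582026, 2524574, 2049989,
  3185222, 1474258], 3887455, 114, [4595615006727, 8814346633337, 693637219202, 1169304861824,
  2070174285832, 4416300319768, 85900263714, 2510409435456, 348966359076, 10995181289480,
  2680060643856, 13787918762113, 10997471903744, 862214701376, 13748467138594, 5497560547968,
  1239100689412, 2817561461248, 8818457052160, 1115618410500, 8831157420112, 26659037184], 1484⟩,
  ⟨[1476001, 617678, 454602, 3460373, 3433311, 2482094, 2031401, 324633, 2173031, 1590624,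
  155733, 3656327, 2736988, 3211768, 3651674, 1137863, 821521, 480563, 3611017, 3488515, 1857466,
  4115312], 3172757, 54, [609885356047, 13264469622896, 13958647680, 4468108177537,
  7220108460416, 43486561030, 9930501488648, 284005548040, 34629239345, 9071254048784,
  551954939907, 1926330843140, 12030471831552, 493929628688, 1377108033538, 5652181942336,
  8847699881992, 7834020482304, 2206674782208, 2218493346848, 11000494489632, 13898518398976],
  1496⟩,
  ⟨[1687741, 2577962, 983211, 1192178, 1072570, 3414203, 2534961, 2076306, 3824075, 4009850,
  1104511, 3928559, 3171399, 2649305, 521011, 2572060, 2094366, 1002946, 720747, 3818860,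
  2888976, 1675976], 2153868, 51, [11272141668367, 2273648312432, 4948876068737, 34359769234,
  537886880, 9964331565056, 10187687592193, 5532992799488, 137674098756, 2290324877312,
  6517949032, 10997398241318, 556743525889, 996499527684, 5583492222976, 2364381618176,
  3034931527744, 4578439872640, 1959664812032, 161066009600, 8804969807888, 13271987912728],
  1502⟩,
  ⟨[3825339, 1708503, 3235599, 3085067, 1276950, 2782004, 1247829, 3536475, 3212939, 2574962,
  3441080, 1932945, 698231, 3729203, 319201, 4094249, 1389384, 779394, 3956977, 3968452, 4139454,
  542886], 245060, 39, [1491427393537, 70866960510, 1238024327040, 7215545085954, 8040178876420,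
  4417374814216, 592705728512, 13743903014912, 3474636931456, 4967146471442, 10033144336896,
  1383113704484, 11545150259200, 8813677649985, 11029480743440, 6594625601, 19346507780,
  9209718505504, 97710508041, 8848706895984, 416725074944, 13488888066], 1514⟩,
  ⟨[877569, 1002765, 1628788, 2707785, 3062455, 1180460, 1296930, 113110, 298946, 1216361,
  3163015, 1109367, 2648829, 2437849, 2984117, 2151285, 2357062, 1263259, 2401813, 2644398,
  3711840, 1103640], 3480904, 29, [10995116277823, 14705968021574, 25769807808, 16106156040,
  13778255188096, 6184753823748, 4690644344832, 2422390931456, 11751303413760, 4410940596288,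
  324271341584, 552540836112, 296891728640, 9964894553248, 8796798780432, 2423435331592,
  4404155515392, 4441071686272, 9107884998664, 586749575424, 3437332824096, 1169625710624], 1520⟩,
  ⟨[1195970, 1512805, 1723507, 1040474, 2163435, 3174148, 3047439, 1766222, 1920469, 1048316,
  3682284, 1352767, 4162733, 2852150, 2461693, 2999114, 1128777, 1613392, 339892, 3903264,
  1675276, 427400], 202736, 43, [1108101562431, 1649871421889, 11339250535936, 2611340128834,
  4614942380036, 2363641331712, 35836592136, 3372086919168, 11090947739648, 3440403611776,
  8800186695688, 9620726760048, 584119025808, 867050717184, 13194151085088, 6665923603456,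
  1874753241092, 5525478572048, 38797836419, 315952732160, 5497776374018, 9371721400576], 1526⟩,
  ⟨[2290760, 163517, 1063288, 3248687, 2520341, 4021397, 1335270, 639379, 1488175, 3990755,
  4054998, 3081940, 2695845, 2777471, 789030, 3662360, 167888, 1014535, 486801, 3720230, 2114008,
  2774586], 735207, 78, [9007083290631, 4673998160120, 12646128550144, 1102330201603,
  85899409920, 13334263037960, 13196287804433, 9433761447936, 1389423036416, 2207616610306,
  4983240655104, 2411758616578, 2485720711264, 1134152384912, 12935319584, 4553202271752,
  10995418273028, 1710743355392, 433926209537, 309277501456, 34469847172, 2817766998240], 1532⟩]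

theorem D9_chk : D9.all (chk ones22 E22) = true := by decide +kernel

/-- Batch 10 of the codes. -/
def D10 : List Dat := [
  ⟨[2088592, 1631146, 1482746, 1771835, 1184124, 970105, 2774677, 974879, 1720430, 102453,
  2891206, 1579757, 3748838, 352744, 3637412, 605642, 3773231, 1865632, 1797644, 2863867,
  1042214, 3856837], 3240241, 27, [1650341183519, 146028890080, 1375463290883, 2220498206816,
  482112045056, 1099517970468, 15672337760392, 6116037636224, 584128268545, 197619089424,
  8888510332928, 2752000366596, 8813416316992, 4818986860594, 13374796595720, 4473814581248,
  9003997331712, 2204123571328, 6081686339600, 9079596253440, 2253014434304, 11033234128960],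
  1544⟩,
  ⟨[3016003, 40774, 3114419, 2022100, 4176728, 190497, 4162157, 2954830, 21915, 1492970, 801271,
  1531611, 3462732, 357504, 775057, 3562400, 2468524, 2333232, 2886555, 2747996, 3701502,
  3509698], 657231, 43, [3401614098447, 2750926553584, 274877922819, 9485435387908,
  4453881479682, 13213468475904, 1168234644488, 3577739214848, 10857710913536, 172000154128,
  6605693534304, 1138502041728, 28466741284, 4408263901504, 760477681728, 3096671420562,
  13246224401416, 1786941284480, 94489295108, 6605696467200, 4413106159648, 9105733325832], 1550⟩,
  ⟨[3402740, 2323474, 2599181, 1176687, 3024599, 4022182, 688419, 1669352, 2119468, 1697157,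
  2540929, 233379, 1985731, 3063183, 3888021, 1337758, 2488297, 457196, 1484986, 469904, 3327172,
  1755110], 3818778, 46, [5000415674375, 8993661517849, 1246614258144, 623575567872,
  4799089082368, 147102642218, 2080832, 5016792334882, 11495480000512, 156780986512,
  16492697550848, 4398055044192, 1928977189504, 2199032009024, 49694122000, 45735219200,
  14294502604800, 9139692833792, 8841526247426, 602369204236, 2474053468676, 3303002865665],
  1556⟩,
  ⟨[236868, 4123664, 3356529, 2022072, 2568749, 3305590, 1724845, 2541925, 3970787, 2041442,
  1174599, 1715496, 1912773, 1230577, 3667363, 2450374, 290750, 2756667, 2524592, 1567645,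
  1074100, 3982674], 1513741, 23, [7146825580575, 7168300417248, 12369505814273, 111669213184,
  1288490649600, 4419522998272, 1279915065344, 481156399104, 550696403202, 3573433762564,
  2199274947592, 4436705148960, 420907125761, 8801763721490, 10240342885384, 78421082112,
  13784697606144, 34771337732, 1305672155241, 9397523726340, 4950495076432, 26306689154], 1562⟩,
  ⟨[368038, 3930784, 1230007, 2064700, 2336796, 904938, 2907662, 2320364, 1035598, 4160868,
  4093791, 616549, 373394, 3031938, 445227, 283607, 3505271, 1583606, 1195783, 2973328, 634650,
  1630102], 2112946, 114, [636728901647, 345744867383, 8886824206784, 6597069782592,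
  559419539593, 2894808155648, 1108103415824, 9917081845896, 1374402314288, 2336581878272,
  278636009730, 2251238410240, 4947955958272, 5089545191428, 5682782797824, 11038737301512,
  72779563328, 4638904432, 5944771616896, 20737818656, 8798251556865, 9174066926848], 1574⟩,
  ⟨[2180792, 1976695, 729950, 2260148, 428874, 1740359, 1355920, 2537693, 1527143, 897179,
  782816, 3125193, 4042840, 968369, 3335797, 948284, 3900593, 3546940, 1415015, 360139, 203638,
  2678968], 3031443, 53, [43503321103, 687278653463, 15394270085344, 7159727260416,
  5518059897856, 838323935232, 103112892672, 343782326304, 5506216755217, 39080443904,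
  9966874395648, 3626631170, 326589513984, 11088003334144, 10188870518784, 558413185856,
  13338029330464, 2680881676320, 2339751657476, 9244111864832, 4553204306112, 1649268230157],
  1586⟩,
  ⟨[4130836, 2836742, 2996974, 1320150, 1205302, 482804, 1689432, 1862103, 4074429, 3156593,
  214730, 3840915, 3196227, 3781141, 3655754, 3801123, 2955049, 3576789, 1575598, 3776356,
  3412108, 4183432], 3022523, 120, [8968898347009, 1116691497023, 4722316542144, 5516885493568,
  4949949815680, 2238214955008, 2310827024384, 5774584073216, 4484484333570, 4960824590338,
  687530999812, 240790933512, 2277683236868, 13263533244424, 3441879416850, 9345941225472,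
  3441476829200, 328570505216, 9484361609220, 1374458743376, 11005090332704, 292133536416], 1592⟩,
  ⟨[3399625, 1092514, 3872518, 1144577, 765081, 642494, 26318, 429191, 347114, 3511402, 3681716,
  3369080, 699231, 694152, 2192340, 3037899, 1353292, 1762997, 1896847, 880249, 2901194,
  3503292], 4174058, 45, [2542620639263, 188978562016, 1110249061377, 9022652564480, 38654952450,
  150324644896, 163216130112, 4398055358597, 51590463784, 1478610649096, 11269994199076,
  17113305579520, 584266580560, 10176925026432, 39091109890, 559117570048, 4535756784384,
  558463451712, 9233105944704, 7150046818308, 13263400214529, 3304181465104], 1598⟩,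
  ⟨[813532, 2635208, 2004976, 2929362, 4025109, 3835956, 1339992, 4093414, 2147144, 2307884,
  1671478, 2655843, 147323, 1338284, 1787371, 2039176, 1876556, 3466934, 20174, 3255793, 922251,
  3352733], 2055286, 108, [77309411391, 6734508721089, 8589966528, 3298534982915, 8800392054784,
  6734521696320, 4157578674688, 6425271603200, 1007683590, 8883200337924, 9534831624704,
  642382823432, 57982631952, 139183916320, 15949629751296, 9226797776900, 8633212992, 562041736,
  146574165121, 14403172892672, 304961617936, 12373803040768], 1604⟩,
  ⟨[579139, 1081675, 3168676, 1162821, 410458, 2354766, 1788357, 2955225, 3716715, 3026618,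
  3639169, 301014, 1923628, 2730326, 1346968, 1903606, 3847133, 2537004, 1139422, 669031,
  3374460, 3763896], 2147253, 71, [2495375998991, 69256348145, 5540507815456, 4416300183584,
  8830454792256, 824648597505, 175559147584, 5498649195008, 4334899202, 1100803506188,
  7739799503876, 9558986592256, 622809055752, 11034307985537, 1657899362304, 8933868896320,
  499290473480, 11822434355456, 5506458992640, 4425980608896, 381245456516, 2354044748832], 1616⟩,
  ⟨[3017353, 383429, 766683, 101283, 2198942, 2584103, 3864591, 1076393, 580398, 485268, 895769,
  3705620, 4078711, 2318730, 3100276, 1227253, 2335775, 950000, 1635301, 413864, 3566037,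
  2966632], 3598573, 45, [4468108165135, 1122060206131, 1926292833216, 2475243355136,
  1445793383425, 2208150165520, 11957189115936, 13542837452800, 191126831296, 3849632885760,
  4443145240582, 9968887533592, 11020887293968, 623845049380, 4537647694080, 8839162232896,
  584116134656, 23089647625, 13194696589320, 4544243696384, 9517748191362, 2353652703744], 1622⟩,
  ⟨[3248253, 2329500, 2975149, 3508485, 3584444, 2494939, 2024327, 1629307, 726354, 3957170,
  3591710, 3961109, 2077946, 3479796, 134873, 948797, 111245, 2882712, 443822, 2787444, 418412,
  3728783], 3917276, 71, [279172874303, 1455993913792, 278099136065, 722091405440, 6601901641986,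
  10737877509, 1670206980096, 6734510892034, 13195213382152, 226035761152, 12197724028944,
  834351939584, 10995158384898, 4372890656, 1453980647808, 1151470796864, 7770132713488,
  723903594496, 11029534736404, 13417612578816, 14312240324608, 558349158409], 1628⟩]

theorem D10_chk : D10.all (chk ones22 E22) = true := by decide +kernel

/-- Batch 11 of the codes. -/
def D11 : List Dat := [
  ⟨[2015214, 2152024, 890451, 274418, 1609650, 1044254, 522469, 516559, 894901, 350844, 1610191,
  3335774, 1484466, 2806934, 4085731, 1077531, 3685220, 761262, 4086484, 2151107, 1370894,
  1461561], 952771, 53, [297426485263, 8888569036848, 4480590413888, 1136555721601, 51539623041,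
  5086315266048, 6609015422976, 7730941952064, 4989142434816, 4879353383936, 154631931970,
  10033063526480, 2783243669760, 12094669890048, 9648779296768, 1445795464194, 8864867099136,
  5772453412869, 9626363969536, 8943464120360, 2758107856896, 350240778], 1634⟩,
  ⟨[3921256, 2618854, 1511631, 3532188, 3164826, 3455953, 553432, 468911, 3158828, 3827219,
  3972587, 3295513, 3075672, 2762728, 801677, 4066460, 86213, 1289103, 352127, 3371192, 1541910,
  762345], 137721, 90, [6744172396551, 11137655504920, 13194139534305, 277025422368,
  309238137920, 4553202735232, 103350796362, 68733214976, 609891647752, 4675089358848,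
  1119147786240, 2205768482817, 9368934285348, 15944596324356, 5231286976608, 151414439941,
  1255606848000, 8847674720384, 3305014038528, 2001454792722, 9002788455448, 1761007960064],
  1640⟩,
  ⟨[3757819, 381346, 2164348, 913917, 883403, 639617, 4022112, 2236177, 953573, 1234044, 495506,
  657301, 3225669, 1847263, 2252258, 3727518, 423633, 3104653, 678800, 2345538, 1256163, 106249],
  2889942, 27, [10997800632335, 166429982832, 4947802333056, 3315714777219, 7705708306432,
  826782154756, 11166914970504, 343613374480, 5017075458305, 11064943052036, 139671371832,
  555797749760, 10248328904706, 14306536112640, 173191202880, 10192058122240, 3478924575232,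
  5021974401024, 34498943008, 303064679488, 10084583227521, 279987093514], 1646⟩,
  ⟨[705796, 1907889, 2379556, 966857, 298821, 821147, 3103374, 2120308, 2712598, 941325, 1972096,
  91753, 1872663, 2721185, 553388, 2226549, 1689718, 936134, 2140158, 3628296, 4042218, 1876146],
  2551260, 15, [2284922601503, 10313894199296, 1106625167584, 2200365434630, 34762393898,
  4417910765568, 2201238081600, 1138235277440, 5159331561536, 2267881177364, 15413572337664,
  1786977722368, 9277414850560, 4413081551360, 5094385385536, 747392471040, 10003154993152,
  2199124053004, 1994217488384, 10995531579904, 9647100788736, 9663726755840], 1664⟩,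
  ⟨[3916770, 1337139, 3087427, 1185214, 1616548, 4043025, 734518, 1955436, 2327901, 806493,
  2736661, 155768, 1075287, 4016220, 3077050, 1646055, 3696001, 2629161, 3041469, 3047691,
  1647835, 637890], 1021073, 147, [8589934719, 2774817309057, 9277666233856, 2199023284870,
  9914932101384, 591095005232, 103348449344, 6598146655250, 10519985553408, 14190576142336,
  115972507716, 311435625472, 4570457834496, 2216410219008, 1103976595744, 13473313259528,
  5774046707720, 576868843904, 2277675384960, 689411459105, 807542865, 1256454160384], 1670⟩,
  ⟨[3567705, 1052943, 3264247, 4127597, 3840624, 4029561, 488256, 2217156, 257183, 2650986,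
  1099309, 3376938, 2723478, 1253316, 1604926, 1151806, 3901909, 1681331, 3121056, 4050197,
  2414264, 1630581], 1000904, 29, [8971112939527, 2147484664, 1651414928496, 15534359842816,
  43889254400, 8886555967489, 11377636810752, 1102734688386, 549905039362, 549779407248,
  3626026270752, 4621561102336, 4410939821072, 4987128201216, 2504368717824, 2680244142592,
  293200760864, 1649277665412, 8942663303172, 14379617656832, 10247792005184, 554873915648],
  1676⟩,
  ⟨[3118948, 3284486, 1885222, 1754250, 1825394, 1927240, 4193064, 2632055, 2200634, 1057927,
  2026831, 3733703, 3021627, 3091158, 3676845, 2994342, 4108304, 2446493, 1115609, 3950763,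
  1652462, 1685398], 3488063, 114, [2629056856071, 8956080554040, 9395241417, 1105148773968,
  6769942214656, 2216203370499, 9079561144330, 4683665768448, 625190371712, 2276609493632,
  10239219339296, 9363566985216, 419330785281, 4982179651584, 1116796485652, 9347493060608,
  1652790658560, 554050848672, 2576999254020, 4638632972288, 5508432527360, 5806934200352], 1688⟩,
  ⟨[1667723, 2495911, 2763123, 153703, 1940195, 644992, 3368905, 3883256, 70372, 326668, 3745150,
  3841502, 1979599, 2039485, 3526293, 2355596, 722196, 1950117, 349884, 1507510, 1101393,
  3251292], 1595000, 83, [6631563722767, 2353642078704, 14332574302721, 1718523792912,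
  34762396710, 10247791994880, 4398851940864, 9627303444481, 2201440092226, 4466769133598,
  6737730994560, 219056963648, 4554949132672, 9917098361408, 345241845768, 6065030766608,
  413461922080, 1960652612608, 13173788672, 11589432379392, 18287499296, 425348579328], 1694⟩,
  ⟨[3965990, 2444698, 2711236, 1203718, 1810920, 1667720, 3583271, 1905618, 2880374, 3072215,
  1973546, 1717487, 1723053, 1859943, 2675355, 1753355, 2713862, 2573469, 1115609, 1812374,
  4042574, 3701168], 887401, 108, [40265318415, 275951649265, 7237019894288, 9491877731360,
  2356326490112, 8850317058050, 2509335035909, 2757907448848, 154633592832, 4432459399168,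
  1111528308800, 10187672914432, 5583457750528, 13198452424832, 622854684704, 893639458856,
  8811192525440, 939819273, 6940709094528, 1237287964672, 1273497649154, 1109309657154], 1700⟩,
  ⟨[4087933, 1250535, 3178379, 2793322, 3791012, 3867940, 1719863, 2191032, 1516626, 3139620,
  2027923, 3515833, 3457639, 2411917, 1163203, 4009895, 317548, 1225586, 41207, 2839327, 3870059,
  1602756], 4017517, 39, [90194313247, 9698036154592, 154618838784, 4295999489, 15427525689345,
  2233445908768, 6322394234882, 8938095168, 9909027471492, 2370828435968, 9529754116,
  73018720270, 2233920996360, 5501987717216, 2889439381506, 8969502330889, 4450668254240,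
  13215623020624, 1728741122176, 1514059866128, 285917847808, 9844081819904], 1706⟩,
  ⟨[2432289, 2918913, 3175274, 2246582, 2378690, 3961915, 1983457, 4007912, 4177848, 2183864,
  2654068, 3634336, 2988109, 153084, 799633, 3398871, 845952, 417735, 4163639, 1142724, 1311472,
  4100500], 411569, 29, [9622941335559, 2542754857080, 1117496805248, 34896623761, 9381013929986,
  4454417959170, 4406905098752, 4518574294018, 3324308619264, 299645796352, 14920720581120,
  8942601109504, 2295660085296, 293200732304, 5498635094272, 6602977448960, 2337554305088,
  9382892962305, 3301219320836, 700293578752, 9277305651200, 3165533503492], 1712⟩,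
  ⟨[2315128, 823980, 2009111, 3273054, 1902969, 743579, 2192751, 2985829, 2586866, 3661584,
  1480801, 802258, 1110241, 328644, 305805, 233245, 1052625, 2603556, 2092196, 2585717, 1836245,
  3027359], 4020170, 77, [279776854031, 1855425872112, 249510757120, 86302006288, 11279120998496,
  14316468191232, 335774992, 7699266551808, 269607425, 395271211266, 1677186826274,
  1697317392384, 7732017234432, 11270073909280, 1275592845, 11001625952256, 137497937988,
  7186570805252, 13764833316864, 3239968776, 489802432528, 13881603270656], 1718⟩]

theorem D11_chk : D11.all (chk ones22 E22) = true := by decide +kernel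

/-- Batch 12 of the codes. -/
def D12 : List Dat := [
  ⟨[2260465, 2345022, 927893, 3859426, 1410414, 1201746, 722555, 3375601, 204350, 1359634,
  1493197, 403343, 3271496, 1233707, 2525072, 1697810, 3514564, 1682821, 3803815, 350403,
  3150183, 885308], 3784749, 102, [2207613190207, 5222680233920, 8796093151296, 9367324590081,
  103094945794, 8280698126340, 8985088622784, 103297288, 2199983751696, 3299646767105,
  347019952384, 347089176576, 10779399296, 2912558252048, 4827677525056, 8873411395592,
  1396132815888, 9389335445664, 13335873585190, 3474695913504, 7718525992960, 13262868453378],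
  1736⟩,
  ⟨[1123174, 2130901, 4043414, 2364726, 3790270, 3033587, 563826, 2891471, 638537, 2763592,
  388765, 2109265, 3282080, 1339407, 1473172, 1591747, 991033, 1510307, 1230790, 2682790,
  1738299, 3299816], 634607, 30, [8801998602255, 3917010174192, 10488310138624, 4416836999425,
  14053133049856, 2199024263170, 7464654217216, 1649269541428, 11145444328192, 90257227777,
  11201279967296, 17811144832, 1376939738176, 1382981698572, 171803955218, 4490390732800,
  13197898186753, 10241350041640, 172973131792, 151498264580, 621816864, 19596443976], 1742⟩,
  ⟨[642505, 39341, 179851, 868523, 2487484, 1146677, 793337, 2045419, 3170287, 2083597, 1490161,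
  3401744, 3838021, 3378764, 3515506, 1424182, 522698, 2916839, 20821, 2880335, 25033, 4033424],
  106042, 23, [481036337183, 1426466013408, 8808977927937, 12236630265858, 671604736,
  4424219500800, 13779865699072, 34696381472, 8847699939332, 569620040032, 1377210466432,
  5876593197058, 2268887826440, 4950085339264, 2753076138506, 8804885008384, 983549609992,
  1249031225408, 2267839365120, 424128020549, 2267795161140, 4421937276032], 1748⟩,
  ⟨[3965990, 2997017, 2711236, 1502121, 1810920, 1667720, 2226229, 3061217, 330516, 1594693,
  3131220, 2724572, 1918692, 2747550, 2675355, 2713400, 2713862, 2573469, 778115, 2270186,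
  4042574, 2621861], 337579, 142, [8849243242503, 75698798712, 3848559134592, 13194944845953,
  15530601768962, 9365444853760, 425202552836, 4410933280896, 2251101833221, 9208409954316,
  5531923513346, 2276609499904, 12111824716800, 1650379465216, 215830495282, 861209296896,
  288870105648, 4475691470913, 4610110529600, 6048409206784, 9125748539400, 2618392608], 1754⟩,
  ⟨[3262472, 51659, 1348018, 2680319, 3732164, 109498, 620195, 3914879, 818434, 2060511, 4123613,
  1193260, 276291, 1170237, 1769796, 3051925, 4064354, 831316, 3373466, 3203542, 2456146,
  3342200], 343430, 150, [13280038879247, 4522600562800, 9002519888770, 2281733248,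
  15719848771584, 1791001429252, 551368392720, 6610223499264, 140809077760, 28203028488,
  4430438688, 3258712080, 2890651927552, 9244413788288, 1202691506288, 9139707183944,
  2749995491840, 1239939022976, 2500207839298, 9106421235716, 1127966838816, 6055914639360],
  1772⟩,
  ⟨[2765235, 3551036, 3816153, 662754, 4114160, 2848075, 2610681, 3704671, 2890843, 386596,
  2775500, 3880334, 990046, 1085937, 3897642, 1726622, 3371759, 1711609, 553133, 3784343, 681800,
  908564], 1473214, 60, [4449586118687, 11132555232224, 4410931428384, 20401143815,
  10531259875520, 240520134657, 14989437961216, 8276402044928, 11117523042304, 10344432927744,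
  4398057078858, 8707768332, 11063974172928, 3853390971024, 207249476352, 6484541445,
  826080755728, 9428852744, 22548580530, 3610192646144, 825909838112, 10239338353152], 1778⟩,
  ⟨[135482, 3661584, 3002606, 1094428, 1902969, 4188757, 14125, 2985829, 408240, 3660323,
  2759385, 802258, 1110241, 233245, 2376070, 2484431, 1052625, 2585717, 2092196, 456806, 4015767,
  3027359], 3642318, 27, [34896609343, 16106127810, 12884917764, 1173599863360, 14705968103432,
  7516587140, 17718346432, 1030806847488, 11269996938256, 8641317186, 13743964620816,
  11332287987712, 2063736111112, 6838127427584, 6821347590144, 10243543072, 34633752580,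
  1168344416288, 13778322464776, 12801166802944, 1173918581248, 7438891753488], 1784⟩,
  ⟨[2585252, 3505241, 694877, 2518742, 1167753, 621871, 4108527, 2504746, 3079026, 3397378,
  4115418, 1085330, 2129733, 2184202, 2419944, 3342315, 3619972, 1843717, 3753264, 1457268,
  3559100, 1530087], 3442874, 101, [2818572319, 4950151135267, 13333725970884, 7247764992,
  2200231272488, 12240723968008, 11227044651008, 2827430985728, 9077414953536, 4432476046344,
  10256383083008, 559620866112, 1529545623552, 584398684161, 4814658341924, 6150393432192,
  2259438272528, 13470661673216, 8939437565056, 90480058624, 1108109988418, 3333104369665], 1790⟩,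
  ⟨[2059403, 3395102, 3814218, 2251580, 1726394, 895882, 1677464, 451660, 4175473, 1527993,
  172585, 1736861, 408529, 3560773, 3785206, 1538762, 2751308, 896573, 1206367, 648932, 4046478,
  3129704], 248019, 149, [7284264534031, 14156346425392, 14295798645200, 551903305408,
  14057427959841, 276891230208, 18790949376, 7153402774528, 361858334752, 11069339730176,
  7730949521730, 11064959895552, 326702858273, 5974933508, 1108135392768, 12096775919624,
  154971275284, 249980518402, 1692221309122, 165359656960, 279177905152, 78282492160], 1796⟩,
  ⟨[1474555, 1404129, 3114470, 3520808, 1366192, 3728881, 1368538, 1175871, 1264843, 4039764,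
  3584933, 3947830, 2078104, 357504, 3425043, 3562432, 2333280, 1624799, 1152197, 2843520,
  4133579, 915321], 2055349, 57, [2615635083279, 687194768368, 1967095028736, 11072425746448,
  17180860449, 141741261830, 4398072793098, 13228542410752, 9981571399744, 652972462080,
  13228767840640, 60800729104, 3725884129281, 4955654062592, 1801738798080, 5222951288962,
  68890001672, 1220341170192, 311661953188, 2216320836608, 2201258823685, 9904735918080], 1808⟩,
  ⟨[1399278, 434515, 1656143, 1929753, 3258175, 2880743, 2440341, 693851, 756246, 1842892,
  2307361, 3438238, 914401, 2264957, 3869906, 1551580, 3415376, 1951497, 3431175, 3881508,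
  1223329, 2802478], 1162499, 77, [90194313247, 3445637513313, 2147491744, 274878029958,
  8830453686344, 6064493822233, 118112665664, 2276347478032, 5497675842056, 1658041943040,
  8885215952898, 2621999104, 8933613242368, 4673680441856, 9076341735555, 5119634571556,
  5128727822608, 8869384359940, 3042464236544, 8832873037952, 2478475083840, 3454898544640],
  1814⟩,
  ⟨[582210, 308613, 3451053, 3867425, 2991457, 2273008, 2902370, 3355112, 1872358, 3978067,
  2454647, 3215478, 520088, 2631624, 836697, 616015, 2368382, 2532308, 881744, 3345966, 3438802,
  3858011], 294474, 23, [309237645375, 2448131359168, 3851511926272, 12103217853952, 507974,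
  13752486875136, 1814087335936, 10239204237312, 159456956424, 348974645250, 2337051513344,
  249125011648, 13743908471808, 351180726272, 4417577304080, 4724464287796, 4709700337676,
  9900773081216, 2200268964114, 11545413159296, 1672889829384, 9350152260352], 1820⟩]

theorem D12_chk : D12.all (chk ones22 E22) = true := by decide +kernel

/-- Batch 13 of the codes. -/
def D13 : List Dat := [
  ⟨[1353489, 1861283, 3199269, 567357, 3784150, 375306, 2999590, 3042386, 648191, 2023430,
  1356646, 2627684, 2060009, 1158165, 1489445, 1655498, 3976395, 735140, 3537323, 1282386,
  2358894, 2651885], 2728493, 15, [240518168607, 1196148392160, 3372623069953, 4991825746944,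
  183609876512, 9127044352, 4965519302656, 13778255348769, 34367605250, 11826201100288,
  4957700160, 3028086685701, 10104984305856, 2235548569608, 8802317369408, 137440029190,
  1117037559824, 14714557956144, 843969986820, 11029499166720, 8873404613648, 4690981027840],
  1826⟩,
  ⟨[2630948, 2840366, 881324, 2932648, 4162530, 1525659, 3394448, 2544787, 153201, 3518716,
  2292572, 3384764, 3025586, 1786490, 2194769, 3542263, 1588793, 3697181, 175021, 412503,
  2123950, 2156280], 1085242, 54, [6631966375951, 9118215569520, 11626476470416, 5905583904,
  18253625216, 593242411024, 1110249521408, 4605280264224, 6599223550018, 416637061632,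
  551909671042, 5568971014144, 739809165380, 4575264244736, 8830553983008, 9500484993536,
  8796278653960, 9139824887832, 1110586949696, 3590865305604, 3923989626880, 1391909146880],
  1838⟩,
  ⟨[201673, 1584284, 2686443, 606625, 3845139, 989936, 3393235, 1129207, 1953948, 3247999,
  2973334, 1925009, 488791, 847324, 3929720, 2568439, 146475, 2408294, 1739425, 2800346, 2185600,
  3071089], 3128515, 43, [73249325063, 2375653785656, 550024251336, 4398197536832, 2212008820755,
  603459780736, 3316587331584, 6769942462488, 9829032657153, 172420038912, 8801076908096,
  320278102144, 1177901080580, 13216151241312, 1101190005776, 8796233803264, 6675620823040,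
  1924145943553, 14104689442816, 1400427774086, 8936765800456, 37883510788], 1850⟩,
  ⟨[2538830, 1108358, 3650177, 2458690, 1510243, 260924, 770771, 1006081, 2155358, 2788383,
  2821628, 3620145, 3457815, 3874384, 3980328, 4111162, 2210087, 379380, 1750784, 2804218,
  2943535, 2659494], 3935395, 23, [207232172063, 5120137887968, 861140944672, 9079560894465,
  1170378817794, 8816494936065, 1722285097472, 4535758094438, 4467898449932, 10342281252888,
  829542113280, 11012321574992, 2229130362880, 13332669054992, 2218755358850, 22951776256,
  43490744064, 2751195709952, 1458143495168, 2757975613440, 5531939930120, 5086046586048], 1862⟩,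
  ⟨[3305486, 4191805, 4013949, 2178355, 2346504, 1247596, 1190744, 1102809, 980730, 645190,
  3427779, 799610, 3667366, 2468161, 2059501, 500188, 3431249, 1745396, 1401624, 1443222, 652437,
  912650], 795255, 51, [41070624783, 9414568313328, 369367188080, 7835228308481, 2349615548930,
  3333968375937, 9148280360996, 5222948897024, 2229088321602, 5507223388424, 8799857934344,
  14020922048576, 1924959076608, 68881026048, 2253146554370, 8969571534848, 103108706436,
  159014462976, 551921729568, 4552810046464, 1246346381312, 1138870984712], 1868⟩,
  ⟨[1775057, 2645744, 3358051, 3342176, 3572829, 1917822, 556526, 2254675, 1129658, 3791149,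
  1636209, 3586575, 3216195, 2194158, 2585401, 2494816, 2040744, 893701, 3378106, 1524888,
  1956672, 3185809], 3047020, 83, [4758823763983, 296621178931, 25769805764, 146028951616,
  3350611429504, 9128775808, 2895347318784, 206431072265, 830002577425, 12717943422976,
  4434570608928, 3389542891520, 5224865989120, 9898560586752, 13203870910464, 4471195173146,
  1199570972, 173411140608, 13753592594436, 449918796800, 8798542500226, 3332963049504], 1880⟩,
  ⟨[3248253, 2142617, 2909677, 3443013, 3584444, 1890754, 2436062, 2077946, 1828478, 601879,
  3591710, 3961109, 4086775, 3479796, 45773, 200345, 3858378, 802936, 443822, 2732657, 2672285,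
  483884], 2151518, 39, [255, 4681514360576, 1101189374209, 5018937819648, 3303299744768,
  40668758016, 22616743939, 8798248124418, 4958550263808, 9909026463748, 13675176919064,
  2337204666400, 1959981484032, 2226965709376, 4810632007688, 24763187218, 17205837829,
  240552771888, 9004420038664, 15994458472576, 1994072981504, 12142409449472], 1892⟩,
  ⟨[1306616, 1052148, 3444353, 1750121, 2925461, 1580890, 2854137, 3364785, 2416504, 320083,
  4087447, 3007600, 2752021, 1410774, 2800142, 510430, 2727830, 112352, 590053, 950594, 4016206,
  928988], 234438, 54, [7696581394463, 1273457803744, 2356863304288, 2836825902081,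
  11012296159330, 13341242216448, 9929964470405, 146565813504, 283468761097, 2834679466500,
  16645095688, 5226989887488, 1136070361096, 11034911834384, 4398656881664, 190056502288,
  896055115776, 9912822366224, 4465238080, 352464144516, 77319373442, 5227587568128], 1898⟩,
  ⟨[941750, 2899213, 1127813, 1853629, 1551832, 727358, 2461422, 2128601, 1613690, 3847210,
  2497478, 1348331, 2041158, 2356172, 958770, 2742040, 2610543, 839686, 2857474, 1126772,
  2191366, 3308905], 2908501, 60, [1101659111487, 765577920960, 2200097005121, 2552284372992,
  3457448869890, 13219911180288, 55834780164, 997506157576, 2241979485184, 1687930601601,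
  13213484187792, 1102732870592, 637844848672, 13273613762560, 13262961508352, 2753076232197,
  1409853423616, 8796566995976, 2611344441666, 102895920, 4540587837456, 275969515530], 1904⟩,
  ⟨[1311197, 2723544, 2167015, 834676, 583120, 1913008, 1299128, 3296201, 2541198, 2538264,
  208290, 3934451, 1484882, 958716, 568212, 1803515, 2486482, 2311440, 610285, 2726167, 3782230,
  3160592], 1365045, 45, [9762460663815, 343597384184, 38654713353, 11046655942672,
  5497559122464, 549763359744, 13305817073665, 6601389918272, 6124624412705, 1125533089920,
  275783942178, 554321708036, 292326555908, 9002821910788, 2345054771202, 2383711043602,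
  6648630345864, 5223758430400, 13490559401992, 4641133056, 1237522063632, 1858244452352], 1934⟩,
  ⟨[4105434, 355336, 3338372, 2679090, 535961, 2772783, 113733, 2276808, 1865380, 3089781,
  2386532, 2500415, 2421532, 1709785, 3524260, 647865, 1656207, 604607, 2295074, 851167, 2467895,
  3585800], 134781, 83, [9628242935811, 120259084412, 9915468874113, 5511516784136,
  2199560157208, 1238561227360, 830002627600, 3848292533376, 8972201426944, 1649285005602,
  5033735618688, 150877538368, 4639707693056, 14038268379136, 14304527122432, 2491081301248,
  8977565876226, 2267776905216, 11182031360, 3092510674961, 4574142269960, 10995729695104], 1940⟩,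
  ⟨[2966378, 855142, 2435068, 2400267, 3027567, 2054194, 2056542, 1275105, 3736289, 632777,
  1939037, 572841, 1368556, 115298, 1395816, 202682, 3131105, 1289913, 2742560, 2634206, 3529228,
  910540], 476502, 54, [12884901951, 4950755115456, 122406571584, 3303098298371, 9964861055488,
  15414638084096, 9913054593028, 11484743073800, 3849903554560, 174009090049, 1056562480128,
  4709461001216, 963222192128, 152584242, 4960687366304, 9922716762624, 9969158094852,
  15823733260296, 4432407365928, 642097873216, 4408524939264, 34460502276], 1952⟩]

theorem D13_chk : D13.all (chk ones22 E22) = true := by decide +kernel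

/-- Batch 14 of the codes. -/
def D14 : List Dat := [
  ⟨[2465238, 3724377, 3828096, 2895341, 3813746, 2335568, 3891128, 1139577, 511211, 1833419,
  1972645, 507770, 3968441, 1851566, 3185451, 1604455, 3826756, 233734, 2910482, 2540199, 828854,
  3479835], 373037, 15, [425201762319, 4672924418545, 5222680239632, 8933532230144,
  1125282226224, 3373698121792, 7182265352194, 12238518747136, 1383030341760, 631362290188,
  140752486656, 2801402904580, 860592, 123481358339, 11032093392896, 6701356942340, 184715528,
  5506701746304, 9706626093152, 2337608434688, 10191999336960, 9346157379648], 1964⟩,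
  ⟨[2924480, 978047, 1666311, 212096, 2856787, 943256, 2559318, 1253610, 776535, 3733194,
  2594912, 1586341, 2431417, 401175, 4148299, 4089811, 926334, 632547, 3133928, 290829, 3908634,
  3091644], 2379696, 51, [566130376707, 2216471560316, 9077950251141, 3332894625544,
  550292746257, 1074212897, 1520422092928, 13366208233984, 5568429314064, 16234984768512,
  4505445892608, 9150461968384, 34473639938, 6054026969088, 11184430384128, 9491886121092,
  4260607559760, 568546297870, 1215563825152, 18924898312, 9006613537312, 1645613088], 1970⟩,
  ⟨[4156747, 342336, 1893224, 224046, 819184, 2094254, 3313886, 733889, 114907, 3295952, 1406407,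
  3694141, 1126798, 1080745, 2734956, 3190421, 1227558, 4011199, 348969, 2090578, 2395982,
  2574192], 810896, 39, [365072220175, 13219909337328, 4400193996641, 137439017248, 824635752450,
  3298549565700, 9929983269376, 62310646788, 2495443239425, 1786845077505, 9449213264002,
  4413700177920, 35802587272, 5636741923200, 2486857368068, 4969277816904, 2269908320288,
  2201749688384, 14432834946048, 940598886408, 413391427584, 8864982466562], 1982⟩,
  ⟨[2561484, 2861947, 3573470, 3103880, 3266275, 3072963, 1248697, 1584206, 2480380, 2603752,
  269938, 2147661, 1705890, 400473, 1193818, 2587179, 2433370, 3440366, 3966242, 2026715,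
  3836450, 3726343], 1425332, 29, [13212393144335, 275481887216, 2440615167489, 13202796582930,
  1382979528720, 458085105696, 700817932288, 2767301247492, 207299608609, 3848560975872,
  4976392798208, 4951027941380, 2252735517184, 4707357557824, 3438126055552, 9904866758656,
  9917884793104, 8904612249601, 137749873216, 8865080991756, 4677403937024, 74356753544], 1988⟩,
  ⟨[2413708, 3625836, 2677955, 1555728, 2561481, 1712346, 1169460, 3343919, 2734203, 2630592,
  1675117, 169336, 3917850, 2335766, 783362, 3248203, 3952887, 2445035, 3048480, 2389605,
  3457888, 1266710], 3403107, 45, [313532612639, 2757905875169, 4672924426016, 14865955561472,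
  1942398976258, 9074729059840, 4466766449156, 3300146020874, 13297221967872, 11889010540545,
  7150055194720, 1858119139328, 4440996189460, 8946467213320, 8839127696384, 154622570496,
  378099779584, 7995090010112, 69122269253, 12251394244616, 2899639795842, 236339216], 2006⟩,
  ⟨[3847275, 2305478, 266977, 2633180, 378156, 1324715, 3879624, 1253113, 484202, 2054256,
  1081879, 2358689, 1583431, 2999918, 2774201, 2097026, 769346, 1067932, 980599, 3479015, 225025,
  3931176], 3815569, 71, [9484227313667, 2749987029052, 3298601994176, 5512590530564,
  9142173442176, 6652904390912, 1721275254792, 4819490263040, 2544029941768, 4716411125768,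
  26978682880, 141741785616, 4417382875264, 8899265568768, 13340311556096, 1855467816064,
  107407739952, 30064889857, 9924595810305, 11854664433664, 2199981654544, 412607381506], 2012⟩,
  ⟨[464436, 1222604, 916887, 1346087, 2770823, 1795843, 1989142, 307088, 3965696, 3660779,
  2856654, 3484119, 1812987, 229317, 177487, 637049, 3590201, 3076979, 570212, 2180427, 639838,
  2547316], 2895497, 23, [13374528159751, 4402341478649, 309237653256, 1786706649088,
  2482492940304, 1168237658912, 4400252716296, 288233111552, 12645121949696, 4020156514816,
  281329801232, 4419548677120, 9416044716096, 8952876171281, 1168512125120, 11651172532288,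
  4451767291905, 8950779641858, 30367420416, 2207782019586, 3231967084576, 17182084100], 2018⟩,
  ⟨[385144, 3126184, 1226498, 380462, 2298518, 3617139, 2832123, 2106810, 1231412, 2343998,
  4021924, 3577345, 2124161, 4086217, 3641560, 3858798, 2567741, 1159148, 1141978, 2755833,
  2550957, 2060201], 1289655, 53, [833894744071, 9947144257656, 4436701217673, 224680483840,
  215822134272, 1110786147328, 9148817473539, 4570113679504, 5499843510288, 2869042352160,
  13196560179216, 2220502287170, 5497701794313, 9073923809280, 2338627027104, 10492605120544,
  3092963672064, 555345772544, 2613489894400, 9346995191812, 275381356548, 13216755220552], 2024⟩,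
  ⟨[2999480, 1053391, 1251162, 3005288, 3233490, 2439441, 3642864, 2721554, 3815708, 2889024,
  3663111, 2248326, 443102, 630062, 3780168, 695241, 1580661, 2073546, 289030, 2926805, 3990449,
  1764074], 3280106, 46, [17179869311, 733365666176, 1099511635463, 7713761321088, 4404489028488,
  2243046867201, 9055938543626, 1752346984458, 8832601033732, 11613594977280, 9076345937936,
  2405242519552, 13473379516468, 300651925600, 687255619584, 5440700448, 11021959835776,
  3298963095552, 275632883008, 5028333551616, 4897340653584, 1121422704641], 2036⟩,
  ⟨[2592047, 279783, 2231991, 3953158, 1623766, 3919381, 645490, 235169, 1399193, 3554655,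
  2233876, 2574144, 956393, 796285, 530380, 3342906, 601139, 4171184, 952132, 3276578, 1140395,
  2894632], 3135659, 30, [877515505667, 4548370366493, 627333660900, 9243306493696, 275414841600,
  549757845507, 4555349756416, 11029482320384, 627066144776, 7700877480448, 619557421416,
  4468930266118, 8796196962496, 3444563806352, 412484903937, 4470255649802, 1427275513872,
  5511789428736, 8813491519808, 10056670118016, 3333432582160, 12101607297024], 2042⟩,
  ⟨[3065318, 2540149, 1132491, 3886142, 2037135, 2667130, 1885159, 1502828, 1550574, 1335099,
  1678608, 2832214, 2937856, 196447, 593816, 1940068, 619925, 3204666, 2971279, 2206260, 446633,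
  1582442], 3952601, 57, [619347705863, 5090811314177, 1103806595576, 2482759540224,
  9414836773378, 8796093514776, 2216874213422, 2199964353600, 34433673280, 9113995051008,
  1411995697152, 13744566509576, 2476350769280, 425280405504, 13263479767553, 1299235995904,
  1185415233712, 2210029506688, 6618544620290, 4622458564864, 53292892192, 2069100527616], 2048⟩,
  ⟨[3656191, 1220770, 2341538, 908263, 3413598, 2630541, 998936, 3416287, 2591434, 1391776,
  1799829, 2613349, 3834212, 3578046, 2801655, 3844819, 617486, 1358732, 640858, 692895, 421820,
  1645932], 1177121, 57, [1653562408991, 343597385696, 2405718571072, 5188857366529,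
  8808978169858, 140664111232, 7701950119941, 9086003413248, 2508265385984, 11030014460417,
  4967188922368, 1675108550912, 287775457920, 8934070952984, 18731827204, 378363978752,
  1657949782018, 5524470906880, 5122285633552, 8815439250450, 7215579529216, 2337839120896],
  2054⟩]

theorem D14_chk : D14.all (chk ones22 E22) = true := by decide +kernel

/-- Batch 15 of the codes. -/
def D15 : List Dat := [
  ⟨[2213954, 1222604, 3089358, 208265, 4055081, 2760411, 1727033, 1727862, 2257382, 282639,
  2128965, 3590201, 2805795, 229317, 3394711, 3944800, 3106319, 2067115, 570212, 3597029,
  1991920, 3242458], 3142828, 23, [3382286745603, 687463202940, 275951656832, 3367254614016,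
  11134703501444, 3762392408064, 4423822607112, 15415711384576, 827075100672, 838945040,
  9978349912064, 4698709426176, 4987010679824, 68787841028, 601832300648, 138382671900,
  15712064114688, 206168130594, 552335572992, 10310070042754, 10016937492512, 4969814033216],
  2078⟩,
  ⟨[729882, 1758851, 109359, 2195311, 944237, 1824973, 3776514, 253756, 4076780, 2468372,
  3373905, 3440146, 2319947, 3498668, 3596122, 3238045, 1691349, 3889624, 3226689, 3203524,
  2504049, 2705114], 984993, 135, [6734508720159, 44023415776, 4485288037408, 2285996356609,
  15548855369730, 1112665198592, 457951150144, 88585277568, 9365176729729, 8906153132032,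
  1924696932352, 11338730438918, 3298637652288, 9502480924672, 13538022131720, 150458077729,
  1662957748224, 5497598116356, 2473943154698, 727997481488, 8851928647840, 5772538806544], 2084⟩,
  ⟨[4082882, 3242020, 715844, 711665, 3566843, 850754, 206800, 4132867, 2517990, 2196287,
  1685503, 796528, 3938534, 1674426, 874788, 3444117, 990813, 43452, 3125492, 2655864, 2025000,
  3015480], 3100110, 89, [8589934719, 5368713089, 413390729216, 6762963009536, 70330483074,
  13507673718788, 6760281149440, 449365680128, 109522718744, 13473878638592, 11038603092096,
  51642368524, 7836302180384, 14568688451600, 550964086272, 1671288127488, 1718523808064,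
  1719077584912, 88047882309, 550208897536, 1670742345920, 11004045991936], 2090⟩,
  ⟨[3905586, 3835280, 4099227, 1399793, 673829, 872571, 1480766, 1309880, 1376799, 2362124,
  1149863, 3438930, 971468, 4023040, 1743850, 3011692, 907162, 1801699, 2069704, 2235799,
  1124089, 4024732], 2220430, 30, [377957122079, 34762392033, 536878816, 3439195119616,
  14302375518208, 5531918287616, 85901058054, 7217693065984, 6610089411592, 275153683524,
  8937853419536, 552314374400, 3436561334272, 603782645760, 157848461313, 9767829409792,
  12447352094728, 9368414195840, 275716770945, 8886825254936, 6152675393536, 701233102848], 2096⟩,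
  ⟨[107782, 2128928, 636332, 3693056, 1530888, 1681997, 1611278, 1169400, 4137925, 1360043,
  1292859, 4168547, 223095, 2628878, 1270020, 3216334, 2230422, 975258, 3746106, 1904397,
  3846634, 1362578], 3160016, 29, [13019119647, 154618824672, 313532618946, 1117765296448,
  15395713122304, 2751262360068, 1117900029960, 766383243264, 9534894509056, 13238767976448,
  3370005890048, 9509126801408, 5018742686208, 2473908144128, 4436860731408, 998043041856,
  348211122304, 11065985336456, 4479936172032, 9896343175172, 8521756180992, 9967550595080],
  2120⟩,
  ⟨[3430266, 142677, 674874, 3374158, 967067, 1936869, 2910396, 358788, 2273834, 2135171, 730863,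
  601873, 1910626, 3935771, 3845515, 1997954, 1997311, 2438241, 2814672, 112012, 1124190,
  922201], 2837935, 53, [68719476863, 2561947992449, 2246267899394, 4810363432961,
  11072425767424, 12171937321476, 4966056853512, 687202108440, 9390954399744, 9907474530304,
  839674512384, 2252743901318, 4553806577672, 5772604383232, 13233063739424, 1685105672448,
  1941862744320, 223875301443, 8801328564256, 8801499553796, 607453264, 138783851520], 2126⟩,
  ⟨[178869, 3272840, 2066065, 1644154, 1332691, 561581, 2943269, 3013052, 2153950, 2393894,
  3291375, 3624683, 1012936, 2292723, 2050438, 3315540, 3559446, 3275719, 1849015, 2576889,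
  727590, 2185826], 3999522, 101, [2205465706527, 2268816474593, 2938294502912, 4415763265542,
  15453829201922, 4569845318176, 69794138148, 688271790082, 1615078080, 9227749826560,
  13753043124288, 5501854695940, 8840118534529, 1101759791384, 11142235693184, 9623019978752,
  852597145600, 1104041515008, 34494760193, 3371566694464, 1443511731216, 348194439184], 2132⟩,
  ⟨[620708, 2093530, 1479175, 3409302, 2522186, 2922205, 2190672, 3158839, 516957, 2452475,
  2905384, 3871510, 3744905, 1009075, 2411034, 1388799, 3602644, 1133104, 3487440, 1627688,
  773775, 2341940], 1701229, 45, [171798691903, 2491081032641, 85899353282, 94489338884,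
  13202729935872, 9934260994056, 1992866939152, 4436713850880, 2611394641985, 1099513748520,
  2551428677760, 13198544109568, 1134677721138, 11785390293504, 9002591191046, 1924416405776,
  4429185167360, 4405030420481, 138549657760, 11553864679940, 4416870746112, 2783760089344],
  2138⟩,
  ⟨[1807268, 1015033, 2601569, 929102, 3093955, 1881204, 2250912, 1452049, 3431514, 3808847,
  2288570, 2060320, 2232185, 4045508, 4082088, 2535887, 1314879, 3701948, 3892109, 2237510,
  1914006, 1701120], 2600464, 15, [2630130597891, 9969155964956, 6816784187392, 13228532826592,
  8797166767660, 7198365216768, 1101726711872, 9074596380672, 9174453846528, 5085344108544,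
  2353642091525, 1413048565794, 687305924624, 2348407718912, 4402945720544, 3103382308864,
  9897854902288, 4423958922249, 758070182416, 1099563073984, 27648868362, 2796296339458], 2156⟩,
  ⟨[3108931, 3302328, 3753219, 634748, 3948727, 1151672, 2450081, 9727, 2093668, 2795675,
  3083096, 4089872, 2625771, 2398082, 425176, 2589910, 3676302, 310074, 3682004, 4003791,
  1757762, 3185943], 1128812, 57, [17179869311, 9552007267201, 7020124048384, 1378684563584,
  6951404635136, 11098195898368, 13246753406982, 1361504698624, 15035940864, 13211323601176,
  4947832209504, 6677465216, 4598040066, 2365461692416, 558447738888, 6254554513536,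
  2277750472704, 9381953929248, 584656628032, 275431558225, 1100722274820, 1374411591696], 2162⟩,
  ⟨[4025205, 1737423, 3540463, 215465, 1308794, 2252351, 2006517, 3953667, 2655738, 2814904,
  4141922, 2299726, 2620203, 3938124, 2989510, 3063454, 3524895, 456024, 3904064, 312798,
  4039336, 614800], 345788, 60, [5368709183, 3372086198465, 3369938714946, 6649683119616,
  558882648704, 4881230365700, 8813273874696, 3459059286032, 10054519494656, 13477613674560,
  4958550245380, 35484009480, 51607601153, 6631446579712, 3438658191634, 567573230080,
  10243497007232, 831210397762, 523998625792, 549893701928, 8804683628720, 1447378944], 2186⟩,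
  ⟨[1669236, 2120899, 2668314, 3311372, 3803179, 3949984, 1357296, 3400792, 1049311, 3878717,
  3464840, 1844907, 3381474, 1324665, 3865474, 2269807, 88834, 1093826, 989431, 1364801, 2530746,
  2975750], 3948858, 78, [6908454895623, 9913858261112, 8865886242696, 590558017537,
  1126355224704, 9672266416138, 85900312832, 3345779530240, 4627828310032, 2201172978689,
  9929970679920, 274936824192, 2273178686464, 275041763336, 1658026217472, 5108864647170,
  2213251383840, 4398667866116, 11203426394116, 695784767589, 1108271464578, 15807633424384],
  2192⟩]

theorem D15_chk : D15.all (chk ones22 E22) = true := by decide +kernel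

/-- Batch 16 of the codes. -/
def D16 : List Dat := [
  ⟨[2950534, 3383727, 1454385, 1353911, 3647721, 1670024, 617989, 3253919, 485182, 3129737,
  1082460, 3104632, 1674098, 104227, 990125, 944116, 3335898, 1282965, 3655854, 1893826, 4004570,
  820937], 3531223, 45, [2279822327811, 12884902013, 11820286870400, 2311497712644,
  4403415250952, 13746042929296, 4420595092225, 206160400416, 278642458624, 9934259749904,
  89397395714, 2061601082112, 120897150976, 9388951633920, 6332929278096, 137613345792,
  2237746130948, 1683778275328, 369643585, 18187034628, 11957205730306, 14450419630080], 2210⟩,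
  ⟨[260052, 1167996, 2836128, 1303049, 1897166, 2948586, 1511172, 2154419, 854980, 3968858,
  2216733, 20377, 1196524, 2503085, 1429011, 405205, 3927545, 2577877, 1646819, 2100222, 2249306,
  2287771], 1514461, 27, [550829555775, 1102195982787, 13060995547648, 322122562560,
  9088150913216, 8796093956620, 4415233900544, 4622466941953, 9364103495764, 12270738341904,
  1099530993920, 2587759738880, 2276970203138, 32363254784, 243742016512, 709136392,
  13229858238464, 7224671863328, 8796366373000, 824835057732, 2342974390288, 6048119261697],
  2228⟩,
  ⟨[2415694, 2180208, 2078737, 2827842, 1602796, 2505500, 3061301, 2155547, 1090814, 1607446,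
  1095628, 1469219, 1745202, 1181175, 830061, 4006616, 1394684, 492881, 2462080, 2150336,
  3797531, 2578893], 3871432, 23, [2542889074703, 414464344179, 2200097005440, 415001239585,
  137439191488, 12164152721920, 4960688029697, 9385041462784, 8797441558656, 10484023820800,
  8933550983428, 10995116550532, 198113787936, 107411952640, 3026442518528, 4961844854848,
  4485355147266, 5858604351496, 4692403306496, 7739598209026, 1130147876864, 2752033858568],
  2234⟩,
  ⟨[2823463, 4191351, 2378891, 769275, 1963302, 1547560, 875970, 3490926, 3082261, 315175,
  3151184, 1151770, 2452392, 685297, 2547673, 4112144, 1075391, 3154751, 2569142, 2323310,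
  3382390, 1849019], 3967254, 57, [4887672782855, 536871928, 2752000302088, 5368833032,
  13469017574448, 1526861004801, 9091909158912, 6820409640960, 9368934285377, 2405196366208,
  9620743791648, 11033234116609, 6544048128, 1733052891136, 4406670086210, 1271311442050,
  1202798461184, 575735595072, 6614520823812, 2233665061122, 1236965851648, 9111236255748], 2252⟩,
  ⟨[3003970, 3832397, 575301, 1881588, 3563539, 2267492, 3238101, 2020625, 750529, 2292907,
  100466, 1600646, 1145258, 3128313, 1246174, 2906608, 2580838, 3207805, 3989701, 3741220,
  374046, 2180853], 666174, 58, [37580963871, 9002519888352, 4454417958401, 309506112000,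
  13812615055360, 9367323969537, 558886551584, 317856944130, 1382992057348, 3437097975816,
  558413389905, 2476451325952, 415672500352, 3506840928392, 223376310786, 2755758440464,
  5539434070532, 206192248160, 4415773245472, 10997146324992, 8951001317504, 5510453527556],
  2264⟩,
  ⟨[3486861, 3174457, 97911, 2875110, 3815088, 4192581, 1233345, 2635388, 1690019, 3405505,
  2924543, 1108397, 1085105, 1274829, 1603846, 4115545, 2599585, 311192, 1950828, 44271, 2452509,
  467750], 2160198, 177, [10592463093763, 515396075580, 13200581984453, 9213241721664,
  10000831351872, 3369938743296, 4466767003776, 3765437441, 330738728960, 4535586194184,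
  2214594613504, 300790358032, 9080097743072, 3350376644608, 4952101751297, 1117028626432,
  550831673372, 2216539210016, 6194433376256, 2375268171780, 13263936948234, 554058123408], 2270⟩,
  ⟨[2991843, 1578937, 3343435, 3358029, 2693467, 1127194, 29979, 4099881, 1691861, 2198700,
  3769495, 1827938, 3663060, 1752581, 865945, 2212463, 3437957, 1477478, 3985768, 2510086,
  1415434, 3854076], 1577709, 53, [12884901951, 2267742733251, 9071105162304, 27783070724,
  15537111318528, 4437238185993, 556265553936, 1117230204960, 1726713430144, 13232866070528,
  352483016960, 11168030785536, 9417923887136, 3541242478592, 1291979850240, 320348544,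
  6756054990848, 1925219104772, 4449653768216, 1375330115616, 8864817037378, 833785954368], 2282⟩,
  ⟨[1383370, 224332, 463301, 1485465, 4155842, 1382291, 2548666, 62575, 951511, 1424512, 1849484,
  620376, 1754759, 2708662, 2760948, 1017724, 1078195, 977187, 3190211, 556081, 3932778,
  3559827], 1623638, 43, [1653562408991, 2200365433824, 5362266676224, 4483945881697,
  9191230242816, 37582831618, 10048078087168, 5509373494276, 979277776896, 5020854587392,
  1979973792, 1666791243809, 10221518861, 11133161308480, 10050491916560, 551813656,
  7732149633024, 2203318504068, 9084392706192, 111677704200, 11201610260544, 9107613614080],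
  2300⟩,
  ⟨[443758, 2497205, 3178861, 3470722, 3702091, 3534935, 3318875, 131701, 1536567, 2590208,
  2552252, 894123, 3440146, 3624632, 2070913, 872145, 2735476, 2036955, 3391388, 2425571,
  1411820, 1681183], 2827572, 53, [1171452329999, 6873021415664, 317827587840, 559687934211,
  15272903720960, 244813365264, 6735582724400, 43087593536, 68988142085, 757260746754,
  36667654912, 11154835374208, 1992999052296, 21584152592, 11296437174272, 13211370801152,
  13196405522432, 12647269400576, 75203871880, 40802457089, 1237489569826, 11008873594884], 2306⟩,
  ⟨[1162117, 29644, 2543738, 1490442, 2788516, 782069, 4101061, 3087645, 3593977, 744494, 256518,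
  3326910, 411285, 2153738, 1677944, 765791, 2949950, 205933, 3391735, 3353798, 820926, 3470660],
  408786, 135, [80799072263, 25769804025, 550561124104, 14568529096960, 6769942429696,
  68988276754, 8597803522, 62277550129, 71941760036, 12131680518144, 962610602304, 554336014856,
  48588947458, 6889127755904, 412418050084, 108449302528, 7972168138752, 14485314076672,
  14431111094528, 622845788352, 11016800845824, 549799856197], 2312⟩,
  ⟨[3998668, 3450157, 3391407, 1872751, 4161068, 487959, 1890900, 231247, 2466259, 1365791,
  1042423, 1985498, 3115215, 3226954, 1137189, 740070, 3030960, 3059868, 2425222, 3931550,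
  1775368, 2047845], 1662476, 90, [16114717294595, 2478196129916, 8800387993473, 9380208603268,
  901943623680, 16494823477248, 8828307374344, 9912814411776, 1855530729473, 1236953748096,
  4673058636152, 3023958999088, 4415774262280, 279575724100, 260030070784, 352741195776,
  2268019589697, 3386753679360, 4948945403938, 49929521280, 1142479135236, 4555349955584], 2318⟩,
  ⟨[302812, 1161712, 3727985, 2022373, 900325, 2630046, 767767, 730122, 2706388, 521186, 3156201,
  659453, 2051611, 2220677, 4008217, 2410435, 4084037, 2823149, 1362107, 2581872, 2329429,
  2053745], 2244208, 15, [14637248544775, 2203318223352, 10033043611144, 6047314075649,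
  10084583219714, 12885868548, 2211911303220, 42954014928, 9689471385610, 10779395392,
  4415294543890, 3097494048, 9867108672, 13830096685056, 9517647570945, 2521154454528,
  277060190848, 1873142878208, 290046083200, 225821589505, 6872099196932, 2234459505664], 2348⟩]

theorem D16_chk : D16.all (chk ones22 E22) = true := by decide +kernel

/-- Batch 17 of the codes. -/
def D17 : List Dat := [
  ⟨[4041685, 859463, 452922, 3870330, 1541033, 4119011, 541900, 3813398, 2503098, 3949432,
  859764, 3185528, 2719526, 1570781, 4085476, 240469, 1792462, 793370, 1568956, 2207721, 1195123,
  4072395], 3109000, 29, [11102490460167, 2415919353, 8798508949248, 1108101816328, 112206807057,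
  5086852948224, 8596341256, 182536503314, 8802543864835, 13245729490944, 276488945760,
  8797460957184, 5636621336576, 88114995392, 1181157982216, 11355927085188, 5222680318592,
  2921249374464, 829264237120, 2345090154514, 7993336791040, 1667924230400], 2354⟩,
  ⟨[3326585, 893966, 3825335, 2922847, 3291561, 2651126, 3090714, 1426371, 23765, 3359663,
  307859, 634488, 2801868, 3397750, 3428883, 3462168, 3768722, 1644500, 1298392, 3537824,
  3791176, 3020976], 3012394, 53, [15032385567, 7834020348384, 2201170755104, 1726576903680,
  14435385278465, 14637249331264, 5239861215238, 27931967498, 11046673989632, 10739517469,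
  5153994576000, 7993001377792, 9208814698500, 1666452095233, 34939641864, 2238416177152,
  8903492386832, 10995520114816, 2612682294080, 5222747869472, 112759704576, 3226215488], 2360⟩,
  ⟨[2153173, 2482934, 3019543, 2007119, 1454524, 3708886, 2320237, 3373828, 3287457, 2838612,
  382515, 1231159, 3785246, 1048100, 861096, 2376875, 3617923, 517352, 3679046, 1160961, 1376109,
  2639886], 844642, 45, [4433479991327, 9354438771169, 4155380858880, 3092376456706,
  137439014950, 92342005760, 11824045229568, 4544083264000, 14585717325889, 223339892768,
  1100637802520, 4707378528320, 10995292471456, 13357415408128, 3298576843144, 110863941632,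
  3034394658817, 173967410192, 68989619208, 39829407744, 5498921353220, 4398718656786], 2378⟩,
  ⟨[3870021, 4005100, 1155453, 2543648, 1267630, 2336676, 706100, 2126702, 2955834, 863225,
  2256099, 2505049, 1953989, 2867267, 1843152, 387001, 1961210, 687778, 1163205, 3690397,
  1630672, 3790109], 3973714, 71, [1241245548575, 2272037700576, 8796093086752, 4964982391873,
  489627189376, 6631436847232, 3968550830336, 13305817072130, 13219926376484, 10720288702488,
  283671801856, 268590152, 1104412676609, 147371106324, 4501677279232, 2474274471968,
  60154708368, 14361329922, 2204929491464, 139658059776, 10566157467648, 2063748563012], 2384⟩,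
  ⟨[2749706, 1063034, 3397017, 1209014, 1575179, 3766879, 51559, 1861342, 3917782, 2069995,
  16831, 1335893, 776529, 3553245, 4032941, 3731810, 1687179, 1406060, 3808158, 1633610, 875388,
  3262870], 1395910, 30, [275012124735, 303332065728, 4699231094336, 5858335393921, 756048523264,
  4213362982912, 2200637931520, 8832612966464, 4402358520067, 13744298001156, 1283155558400,
  8798378943744, 4446104977408, 14980846191618, 8832097976896, 2749114615960, 1280984547328,
  10996997554192, 4604340273284, 2222712782880, 11201276035076, 48637149696], 2426⟩,
  ⟨[3121422, 884443, 2197850, 1056057, 1661542, 1890995, 3832971, 4166083, 3733542, 1955441,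
  401089, 1518850, 2874858, 626077, 1688877, 2487317, 3617992, 1868308, 366722, 2760717, 859638,
  1029802], 3149548, 45, [151129161735, 7774964547608, 13211319403488, 653371915264,
  1961726361600, 1099781046312, 86168896552, 6604049095680, 11551316658176, 1649280418880,
  12241466294272, 13211320452000, 6606735544344, 826266353665, 328586494016, 11617895972865,
  35443976576, 1511862141456, 274945311043, 137573245462, 236492169216, 14399423119360], 2432⟩,
  ⟨[110353, 3252211, 2811349, 1273058, 1916205, 2445402, 2906044, 1639981, 1905483, 1177572,
  2601439, 2293133, 385955, 2894192, 3174362, 3606151, 2605805, 4164387, 2812788, 3780504,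
  2891205, 3891544], 1010421, 53, [11553730461703, 4519647772681, 309237646320, 4815732081688,
  3299071784961, 9899899721760, 4487435911168, 2199159072832, 4575216533512, 1102746091648,
  11201278935074, 549772706178, 12300791054338, 1390009122816, 8839260866560, 614585073664,
  11545543266304, 5291425136656, 286186800640, 17385395332, 5085788897281, 19597230152], 2456⟩,
  ⟨[451029, 4169777, 4020231, 1445540, 3633718, 2335710, 3751120, 894866, 3715901, 3425859,
  1561682, 3453086, 799481, 407857, 1762796, 2563089, 2489157, 4181034, 2770460, 835802, 2112908,
  609712], 4186936, 180, [343597383743, 11785390260416, 560493235969, 556198293762,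
  8968965493312, 277025857668, 8934072520705, 4406649128192, 362941531264, 4468963934220,
  2211946168330, 11630839070848, 10034261000256, 6615591813890, 7740605890560, 5670832176,
  1134543519768, 1555384238080, 571771799552, 1103834390592, 4690125652000, 8796840141824], 2492⟩,
  ⟨[419557, 3128082, 1501613, 720253, 519769, 640414, 674033, 3605972, 3554177, 1054570, 2321486,
  838903, 213964, 636479, 2999225, 2512851, 2257652, 1424756, 2980953, 1910425, 2055039,
  2716622], 3603030, 45, [1099511627903, 165356241793, 9216999824386, 1127428939908,
  2267743749120, 5223755055240, 2202259228672, 9150427829264, 9367376109568, 9079627974678,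
  6632643788800, 4398189248781, 38940196904, 3442420500480, 963281715328, 5566882775072,
  5600638402912, 9154722800128, 2199040954896, 9536438075392, 9397491204608, 73920684032], 2510⟩,
  ⟨[3904454, 181716, 3507052, 7797, 3205415, 2563294, 3730872, 3217531, 3667668, 836130, 2417991,
  1730581, 2943597, 3197163, 4180908, 3560494, 1091567, 2674325, 1006053, 3609194, 2712312,
  1339491], 2431083, 27, [26038239263, 11065479921760, 10447507948448, 3440537242688,
  4421668844545, 4479751556096, 4544410992642, 11579903115264, 4827544043522, 281327960068,
  129989873696, 11030725918848, 826389037184, 275045752906, 3436045141264, 9930520920064,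
  611026239520, 5448166047744, 279210639373, 427952704, 10001369006080, 3303171686416], 2534⟩,
  ⟨[4040856, 1912965, 2455821, 174066, 1997329, 424159, 1782374, 2303174, 2640605, 3565318,
  3806106, 2657337, 3656911, 306719, 1850987, 3600306, 1110827, 3553233, 607845, 1823660,
  2118535, 1683126], 4081826, 39, [2345052143647, 6631429505505, 68719492642, 8869107581442,
  846108951584, 2241980794880, 9487608446978, 10445462194176, 8014545289216, 4407454335044,
  636779250688, 4707420471309, 9004415717904, 3444566392968, 763430576128, 1391855960064,
  8813374800128, 4468380926000, 137615454208, 23689515264, 284013363284, 14345191293064], 2546⟩,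
  ⟨[2999480, 1053391, 3033643, 3005288, 3233490, 2439441, 3642864, 2721554, 1132593, 484461,
  3663111, 2248326, 443102, 3457119, 695241, 114368, 324409, 2073546, 289030, 2441988, 1176996,
  1764074], 2264298, 46, [8835955687431, 5304553046024, 9076473856049, 12678743457986,
  2205197271308, 6047448172104, 347087050756, 9646496555028, 1116691622400, 60398116897,
  4538170118272, 5879944478720, 2345590591489, 4580583407872, 8796631336576, 2406255691794,
  78383190352, 9895619404800, 137626648616, 1118943840288, 2785554858368, 8813824508416], 2570⟩]

theorem D17_chk : D17.all (chk ones22 E22) = true := by decide +kernel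

/-- Batch 18 of the codes. -/
def D18 : List Dat := [
  ⟨[686309, 3377160, 1301577, 348972, 3966973, 1355986, 388394, 2806461, 2898592, 392092,
  4059655, 542069, 1906659, 1171513, 3818394, 3493557, 3807050, 1160829, 2065190, 1198477,
  1007714, 2166666], 3850152, 75, [1288490188815, 4406636446704, 1610616033, 4409320861696,
  9002252435458, 3316791705602, 1926297485312, 631369630976, 9448950595584, 4407223676928,
  150359581184, 2784223166465, 6896106866688, 738214469, 8933917851784, 1546188498176,
  9071314894980, 4419723198536, 6876796291584, 8850854922240, 3920231694336, 1168237527054],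
  2576⟩,
  ⟨[1896693, 1356700, 3099872, 64594, 3411828, 249670, 4066667, 1654114, 528111, 28245, 3000604,
  2519774, 2708871, 2841259, 3852176, 3939578, 1649835, 2009774, 3689971, 3304584, 652113,
  763662], 961097, 15, [90194313247, 13522972966944, 1934882767296, 8873402437123, 8942658793540,
  103884571008, 52077461512, 584122974240, 10720246759465, 8866439890560, 2435263236096,
  1660021659648, 2341881381888, 2479338037252, 7013681597504, 1099950276608, 1099861917698,
  6599250944272, 4983372644480, 345007722752, 4539814125592, 2356326465556], 2648⟩,
  ⟨[4110586, 2861890, 1439211, 1832980, 2198700, 1688240, 77477, 706420, 1040146, 3536087,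
  144923, 3075808, 2193412, 4007806, 525018, 3052971, 1967218, 2327675, 2684186, 1679101, 108605,
  3554963], 3247472, 39, [1271310319647, 278384345312, 278115913472, 13207058018304,
  137539715331, 10997934854660, 4312175648, 346818618688, 11272276418564, 717360203776,
  154890404376, 14912411664392, 120397512769, 859732181008, 1684039401472, 11340324274336,
  6598144041987, 6685921902720, 447549538308, 14306587443200, 1108170178576, 579856236928], 2654⟩,
  ⟨[3064088, 2086746, 4066841, 423297, 2003132, 2436637, 63758, 2766270, 2374637, 3612745,
  2668618, 3298826, 899014, 1769451, 2282294, 225854, 2743514, 1356235, 1028528, 4009642, 938440,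
  1662774], 3751881, 30, [2681133334535, 3367254360185, 1100316935064, 5094099655680,
  2482491155584, 17448763808, 8916353679400, 1690608599552, 9355787239936, 4432677371944,
  344148017216, 413407390721, 19428474882, 8821058043920, 7148033565696, 9620898725890,
  827393835072, 1278021208128, 25790890112, 30151278608, 6743132221444, 14401629323264], 2702⟩,
  ⟨[3004404, 834898, 1550792, 511928, 542507, 1816895, 1635414, 3459707, 1719899, 1071317,
  183692, 1403913, 1388512, 2828069, 2721094, 2480164, 3634617, 386350, 336730, 2387061, 3637976,
  3865820], 315288, 39, [281320357919, 10445360464864, 35433511937, 2302639440928, 5514738401350,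
  9113922207776, 4326424714, 9021612392512, 284079685632, 4683261280288, 1099826268416,
  1121053706246, 860067336216, 14046757650432, 13229045056256, 5705192964608, 7318892716288,
  2905579979776, 2291366364160, 11068734971904, 1306913685504, 10762616853], 2714⟩,
  ⟨[2432289, 3904361, 1137309, 2401223, 1923195, 2988109, 1295053, 881694, 2686789, 2962528,
  2808751, 1763950, 1048819, 153084, 2745113, 2559098, 1132431, 429464, 622496, 3456844, 2291047,
  1786140], 3803923, 27, [8901336498183, 103196655672, 2550136832192, 4407039102720, 19126038784,
  293936845312, 9897769009217, 1105954102280, 567071867136, 9934295011330, 3922378900480,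
  13881904857104, 25983844608, 4536032968720, 6597472462852, 9002352378896, 446752161952,
  9629333749764, 301453279748, 6597472985089, 2647848386600, 1663278514176], 2720⟩,
  ⟨[1221401, 4175329, 276370, 3840848, 1522029, 313558, 4114995, 2171356, 3166929, 1344499,
  1585836, 3167434, 883334, 2664903, 628775, 66917, 502988, 3024368, 3582250, 2318048, 1335448,
  2734264], 19957, 30, [6631429505055, 2828235964640, 593779229536, 4466766003233, 3505767073024,
  13471165024258, 13469017477190, 34360730626, 10188200349697, 3437047584008, 4760973355008,
  9492417741312, 11008015859728, 32766066688, 34360672312, 1654216982528, 691695255816,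
  662641311872, 1116758722564, 11551329222656, 9225858187793, 3914072064], 2726⟩,
  ⟨[3416926, 1454027, 1070568, 600639, 1040966, 3056626, 3538644, 3794150, 2048587, 382671,
  3684012, 544345, 1977968, 3980927, 3592437, 1505133, 2388938, 353043, 765257, 2142578, 2066581,
  1312938], 682662, 15, [4709431640079, 317827580400, 4496830762496, 11272141729792,
  141734384144, 13196294881281, 150324449376, 5635005490690, 10033044800513, 6047372675073,
  2201382555776, 3848643027200, 619012769824, 485868437552, 2766697136448, 4531192595456,
  94489346582, 9346288713728, 1102095583240, 1136023306626, 11270044549256, 2252174557248], 2762⟩,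
  ⟨[4119803, 2904537, 3185831, 3843867, 2415347, 1290640, 2682096, 2222513, 714675, 397627,
  3560106, 1841301, 519381, 1253314, 1604911, 2457414, 3857286, 3972934, 230972, 1063621, 86604,
  180479], 1039161, 27, [51539607615, 5782636593344, 417282917184, 4445828025345, 6627134541954,
  10445763125508, 1102061879304, 9517916114944, 2277406412352, 5844377010184, 2236067481732,
  293135450128, 8813287079937, 10445360824580, 2201577791488, 13262885752832, 356516364928,
  276007256096, 9483426398209, 2341430362432, 13282262122496, 721831338032], 2768⟩,
  ⟨[2459164, 460737, 3971014, 895737, 1454524, 1176741, 2683494, 3373828, 1127764, 934712,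
  3478563, 785972, 3100740, 2862327, 1712650, 2871728, 598968, 1411585, 1076041, 1796726,
  3711384, 759050], 4005647, 51, [232465104903, 3368529428504, 2545573429344, 4398113623937,
  2476048658570, 1672017362944, 9363834109984, 5227109842944, 22549217288, 8833675034676,
  11055715581952, 13606592872448, 1239098355840, 4991087607809, 413126885410, 563177603396,
  1099537847824, 4466875042944, 13198501937424, 4578839887936, 3315740059648, 115159334914],
  2864⟩,
  ⟨[2191532, 1074925, 3597778, 1424964, 1122574, 958022, 1001663, 2766263, 2481679, 503830,
  2668613, 4057021, 899011, 2854959, 2974347, 836495, 1776140, 3182674, 2518381, 4009637, 938436,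
  1662771], 4005829, 54, [4948339195935, 6738803687649, 1290637674240, 139586467873,
  5033701902336, 2340757182658, 8839043481700, 3686155681800, 9076877820032, 45097943140,
  2687524869, 240532849408, 825225125904, 2294603055872, 5566882840576, 9896208826386,
  10466971615240, 34666063360, 1928591835138, 276128088192, 4421805671424, 11331197468680], 2996⟩,
  ⟨[738928, 1027754, 3621269, 2137372, 580634, 1653397, 2198328, 1691116, 1576989, 1583022,
  2697441, 3824821, 2322940, 3735521, 690150, 3961930, 2552879, 1932252, 1004191, 3173252,
  763216, 3425817], 4005083, 89, [2478196129823, 10189809909857, 8806562005888, 636728905088,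
  4443143681026, 4436701331492, 3917278743040, 5909875933184, 51555631104, 2210316423176,
  708975788160, 2406324633605, 4707825229834, 1324124995648, 45122609152, 11272812757184,
  8815563505697, 9355546133248, 14300094414848, 682233858, 69055152976, 11695497936896], 3062⟩]

theorem D18_chk : D18.all (chk ones22 E22) = true := by decide +kernel

theorem famE : (fam 22)[4]? = some (9109, E22) := by decide +kernel

/-- All codes. -/
def allD : List Dat :=
  D0 ++ D1 ++ D2 ++ D3 ++ D4 ++ D5 ++ D6 ++ D7 ++ D8 ++ D9 ++ D10 ++ D11 ++ D12 ++ D13 ++ D14 ++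
    D15 ++ D16 ++ D17 ++ D18

theorem allD_length : allD.length = 228 := by decide +kernel

theorem allD_chk : allD.all (chk ones22 E22) = true := by
  simp only [allD, List.all_append, D0_chk, D1_chk, D2_chk, D3_chk, D4_chk, D5_chk, D6_chk, D7_chk, D8_chk, D9_chk, D10_chk, D11_chk, D12_chk, D13_chk, D14_chk, D15_chk, D16_chk, D17_chk, D18_chk, Bool.and_self]

/-- Strictly increasing lists. -/
def incr (p : Nat) : List Dat → Bool
  | [] => true
  | d :: l => Nat.ble (p + 1) d.v && incr d.v l

theorem incr_lt : ∀ (l : List Dat) (p : Nat), incr p l = true → ∀ d ∈ l, p < d.v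
  | [], _, _, _, hd => absurd hd List.not_mem_nil
  | d :: l, p, h, e, he => by
      rw [incr, Bool.and_eq_true] at h
      have h1 : p + 1 ≤ d.v := Nat.le_of_ble_eq_true h.1
      rcases List.mem_cons.mp he with h2 | h2
      · rw [h2]; exact h1
      · exact lt_trans h1 (incr_lt l d.v h.2 e h2)

theorem incr_pairwise : ∀ (l : List Dat) (p : Nat), incr p l = true →
    l.Pairwise (fun d e => d.v < e.v)
  | [], _, _ => List.Pairwise.nil
  | d :: l, p, h => by
      rw [incr, Bool.and_eq_true] at h
      exact List.Pairwise.cons (incr_lt l d.v h.2) (incr_pairwise l d.v h.2)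

theorem allD_incr : incr 0 allD = true := by decide +kernel

/-- One of the codes. -/
def dat (i : Fin 228) : Dat := allD.get (Fin.cast allD_length.symm i)

theorem dat_nice (i : Fin 228) : Nice (code (mat (dat i).M)) (dat i).v := by
  refine chk_nice ones22 E22 9109 (fun i hi => ones44 9109 i hi) (good_fam 22 4 _ famE) _ ?_
  exact List.all_eq_true.mp allD_chk _ (List.get_mem _ _)

theorem dat_lt (i j : Fin 228) (h : i < j) : (dat i).v < (dat j).v :=
  List.pairwise_iff_get.mp (incr_pairwise _ _ allD_incr) _ _ h

end SExt

/-- There exist at least 228 pairwise inequivalent s-extremal singly even self-dual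
`[44, 22, 8]` codes: singly even self-dual codes of length 44 with minimum weight 8
whose shadows have minimum weight 10. -/
theorem exists_228_sExtremal_44 :
    ∃ f : Fin 228 → Submodule (ZMod 2) (Fin 44 → ZMod 2),
      (∀ i, IsSinglyEvenSelfDual (f i) ∧
        Module.finrank (ZMod 2) (f i) = 22 ∧
        minWt (f i) = 8 ∧
        minWtSet (shadow (f i)) = 10) ∧
      ∀ i j, i ≠ j → ¬ CodeEquiv (f i) (f j) := by
  refine ⟨fun i => SExt.code (SExt.mat (SExt.dat i).M), fun i => ?_, fun i j hij h => ?_⟩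
  · have hn := SExt.dat_nice i
    exact ⟨hn.se, hn.dim, hn.mw, hn.sh⟩
  · have h1 := SExt.inv_equiv h
    rw [(SExt.dat_nice i).iv, (SExt.dat_nice j).iv] at h1
    rcases lt_or_gt_of_ne hij with h2 | h2
    · exact absurd h1 (SExt.dat_lt i j h2).ne
    · exact absurd h1 (SExt.dat_lt j i h2).ne'
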